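/- Let K be an algebraically closed field of arbitrary characteristic, Q a finite quiver, and α a dimension vector. The rings SI(Q,α) = K[Rep(Q,α)]^{SL(α)} and I(Q,α) = K[Rep(Q,α)]^{GL(α)} are Cohen-Macaulay. -/

import Mathlib

open MvPolynomial Matrix

/-- The depth of a local ring: the supremum of lengths of regular sequences contained
in the maximal ideal. -/
noncomputable def localRingDepth (R : Type) [CommRing R] [IsLocalRing R] :
    WithBot (WithTop ℕ) :=
  sSup { n : WithBot (WithTop ℕ) | ∃ rs : List R, (rs.length : WithBot (WithTop ℕ)) = n ∧
    RingTheory.Sequence.IsRegular R rs ∧ ∀ r ∈ rs, r ∈ IsLocalRing.maximalIdeal R }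

/-- A commutative ring is Cohen-Macaulay if the localization at every maximal ideal
has depth equal to its Krull dimension. -/
def IsCohenMacaulayRing (R : Type) [CommRing R] : Prop :=
  ∀ (p : Ideal R) (hp : p.IsMaximal),
    haveI := hp.isPrime
    localRingDepth (Localization.AtPrime p) = ringKrullDim (Localization.AtPrime p)

open MvPolynomial Matrix

/-- Coordinate functions of a representation of a quiver with arrows `Q1`,
tail/head maps `ta ha : Q1 → Q0` and dimension vector `α`. -/
def repCoords {K : Type} [Field K] {Q0 Q1 : Type} {ta ha : Q1 → Q0} {α : Q0 → ℕ}
    (v : (a : Q1) → Matrix (Fin (α (ha a))) (Fin (α (ta a))) K) :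
    ((a : Q1) × (Fin (α (ha a)) × Fin (α (ta a)))) → K :=
  fun p => v p.1 p.2.1 p.2.2

/-- The ring of quiver invariants `I(Q,α) = K[Rep(Q,α)]^{GL(α)}`. -/
noncomputable def quiverInvariants (K : Type) [Field K] {Q0 Q1 : Type}
    (ta ha : Q1 → Q0) (α : Q0 → ℕ) :
    Subalgebra K (MvPolynomial ((a : Q1) × (Fin (α (ha a)) × Fin (α (ta a)))) K) :=
  ⨅ (A : (i : Q0) → GeneralLinearGroup (Fin (α i)) K)
    (v : (a : Q1) → Matrix (Fin (α (ha a))) (Fin (α (ta a))) K),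
      AlgHom.equalizer
        (aeval (repCoords fun a => (A (ha a)).val * v a * ((A (ta a))⁻¹).val))
        (aeval (repCoords v))

/-- The ring of quiver semi-invariants `SI(Q,α) = K[Rep(Q,α)]^{SL(α)}`. -/
noncomputable def quiverSemiInvariants (K : Type) [Field K] {Q0 Q1 : Type}
    (ta ha : Q1 → Q0) (α : Q0 → ℕ) :
    Subalgebra K (MvPolynomial ((a : Q1) × (Fin (α (ha a)) × Fin (α (ta a)))) K) :=
  ⨅ (A : (i : Q0) → SpecialLinearGroup (Fin (α i)) K)
    (v : (a : Q1) → Matrix (Fin (α (ha a))) (Fin (α (ta a))) K),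
      AlgHom.equalizer
        (aeval (repCoords fun a => (A (ha a)).val * v a * ((A (ta a))⁻¹).val))
        (aeval (repCoords v))

/-- The weight space `SI(Q,α)_σ` of semi-invariants of weight `σ : Q0 → ℤ`:
those `f` with `A · f = (∏ i, det (A i) ^ σ i) • f`, i.e.
`f(A⁻¹ · v) = (∏ i, det (A i) ^ σ i) * f(v)` for all `A ∈ GL(α)`. -/
noncomputable def quiverSemiInvariantsOfWeight (K : Type) [Field K] {Q0 Q1 : Type}
    [Fintype Q0] (ta ha : Q1 → Q0) (α : Q0 → ℕ) (σ : Q0 → ℤ) :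
    Submodule K (MvPolynomial ((a : Q1) × (Fin (α (ha a)) × Fin (α (ta a)))) K) where
  carrier := { f | ∀ (A : (i : Q0) → GeneralLinearGroup (Fin (α i)) K)
      (v : (a : Q1) → Matrix (Fin (α (ha a))) (Fin (α (ta a))) K),
      aeval (repCoords fun a => ((A (ha a))⁻¹).val * v a * (A (ta a)).val) f
        = (∏ i : Q0, ((A i).val.det) ^ (σ i)) * aeval (repCoords v) f }
  add_mem' := by
    intro f g hf hg A v
    rw [map_add, map_add, hf A v, hg A v, mul_add]
  zero_mem' := by
    intro A v
    simp
  smul_mem' := by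
    intro c f hf A v
    rw [_root_.map_smul, _root_.map_smul, hf A v, smul_eq_mul, smul_eq_mul]
    ring

/-- `IsQuiverPath ta ha x y l` : the list of arrows `l` is a directed path from
vertex `x` to vertex `y`. -/
def IsQuiverPath {Q0 Q1 : Type} (ta ha : Q1 → Q0) (x y : Q0) : List Q1 → Prop
  | [] => x = y
  | a :: l =>
      ta a = x ∧ List.Chain' (fun b c => ha b = ta c) (a :: l) ∧
        ha ((a :: l).getLast (List.cons_ne_nil a l)) = y

/-- The number of directed paths from `x` to `y`. -/
noncomputable def numQuiverPaths {Q0 Q1 : Type} (ta ha : Q1 → Q0) (x y : Q0) : ℕ :=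
  Nat.card { l : List Q1 // IsQuiverPath ta ha x y l }

/-- A quiver has no oriented cycles if there is no nonempty directed path from a
vertex to itself. -/
def HasNoOrientedCycles {Q0 Q1 : Type} (ta ha : Q1 → Q0) : Prop :=
  ∀ (x : Q0) (l : List Q1), l ≠ [] → ¬ IsQuiverPath ta ha x x l

set_option autoImplicit false
set_option linter.all false
open MvPolynomial Matrix
open Finset (sum_congr univ mem_univ prod_congr sum_eq_zero sum_eq_single mul_prod_erase prod_mul_distrib mem_union sum_insert prod_ne_zero_iff prod_eq_single sum_add_distrib sum_sub_distrib mem_image)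
local notation "MP" => MvPolynomial

theorem cmCriterion (K : Type) [Field K] [IsAlgClosed K] (R : Type) [CommRing R] [IsDomain R]
    [Algebra K R] [Algebra.FiniteType K R]
    (TC : ∀ (s : ℕ) (g : MP (Fin s) K →ₐ[K] R), Function.Injective g → g.Finite →
      ∀ (i : Fin s) (r : R), r * g (X i) ∈ Ideal.span ((fun j => g (X j)) '' {j | j < i}) →
        r ∈ Ideal.span ((fun j => g (X j)) '' {j | j < i})) :
    IsCohenMacaulayRing R := by
  intro p hp
  haveI := hp.isPrime
  have hN : IsNoetherianRing R := Algebra.FiniteType.isNoetherianRing K R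
  obtain ⟨s, g0, hinj0, hfin0⟩ := exists_finite_inj_algHom_of_fg K R
  have hmax : (p.comap g0.toRingHom).IsMaximal := by
    apply Ideal.isMaximal_comap_of_isIntegral_of_isMaximal' _ hfin0.to_isIntegral
  obtain ⟨z, hz⟩ := (MvPolynomial.isMaximal_iff_eq_vanishingIdeal_singleton).1 hmax
  let τ : MP (Fin s) K ≃ₐ[K] MP (Fin s) K :=
    AlgEquiv.ofAlgHom (aeval fun i => X i - C (z i)) (aeval fun i => X i + C (z i))
      (by ext i; simp [algebraMap_eq]) (by ext i; simp [algebraMap_eq])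
  let g : MP (Fin s) K →ₐ[K] R := g0.comp τ.toAlgHom
  have hinj : Function.Injective g := hinj0.comp τ.injective
  have hfin : g.Finite := AlgHom.Finite.comp hfin0 (AlgHom.Finite.of_surjective _ τ.surjective)
  have hX : ∀ i, g (X i) ∈ p := by
    intro i
    have : τ (X i) ∈ p.comap g0.toRingHom := by
      rw [hz, mem_vanishingIdeal_singleton_iff]
      simp [τ]
    exact this
  let rs : List R := List.ofFn fun i => g (X i)
  have hreg : RingTheory.Sequence.IsWeaklyRegular R rs := by
    rw [RingTheory.Sequence.isWeaklyRegular_iff]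
    intro i hi
    have hi' : i < s := by simpa [rs] using hi
    have hI : (Ideal.ofList (rs.take i) • ⊤ : Submodule R R)
        = Ideal.span ((fun j => g (X j)) '' {j | j < (⟨i, hi'⟩ : Fin s)}) := by
      rw [smul_eq_mul, Ideal.mul_top, Ideal.ofList]
      congr 1
      ext x
      simp only [rs, Set.mem_setOf_eq, Set.mem_image, List.mem_take_iff_getElem]
      constructor
      · rintro ⟨j, hj, rfl⟩
        simp only [List.length_ofFn, lt_inf_iff] at hj
        exact ⟨⟨j, hj.2⟩, Fin.mk_lt_mk.2 hj.1, by simp⟩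
      · rintro ⟨j, hj, rfl⟩
        exact ⟨j.1, by simp only [List.length_ofFn, lt_inf_iff]; exact ⟨hj, j.2⟩, by simp⟩
    rw [hI, isSMulRegular_iff_right_eq_zero_of_smul]
    intro x hx
    obtain ⟨x, rfl⟩ := Submodule.Quotient.mk_surjective _ x
    rw [← Submodule.Quotient.mk_smul, Submodule.Quotient.mk_eq_zero] at hx
    rw [Submodule.Quotient.mk_eq_zero]
    apply TC s g hinj hfin ⟨i, hi'⟩
    simpa [rs, mul_comm] using hx
  have hmem : ∀ r ∈ rs, r ∈ p := by
    intro r hr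
    obtain ⟨i, rfl⟩ := (List.mem_ofFn' _ _).1 hr
    exact hX i
  have hreg' := hreg.isRegular_of_isLocalization_of_mem (Localization.AtPrime p) p hmem
  have hle : ∀ l : List (Localization.AtPrime p), RingTheory.Sequence.IsRegular (Localization.AtPrime p) l →
      (l.length : WithBot (WithTop ℕ)) ≤ ringKrullDim (Localization.AtPrime p) := by
    intro l hl
    rw [← ringKrullDim_add_length_eq_ringKrullDim_of_isRegular l hl]
    have : Nontrivial (Localization.AtPrime p ⧸ Ideal.ofList l) := by
      apply Ideal.Quotient.nontrivial_iff.2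
      intro h
      apply hl.2
      simp [h]
    have h0 := ringKrullDim_nonneg_of_nontrivial (R := Localization.AtPrime p ⧸ Ideal.ofList l)
    have h3 := add_le_add_left h0 (l.length : WithBot ℕ∞)
    rw [zero_add] at h3
    exact h3
  have hdim : ringKrullDim (Localization.AtPrime p) ≤ s := by
    have h1 : ringKrullDim (Localization.AtPrime p) ≤ ringKrullDim R := by
      rw [IsLocalization.AtPrime.ringKrullDim_eq_height p]
      exact Ideal.height_le_ringKrullDim_of_ne_top hp.ne_top
    have h2 : ringKrullDim R ≤ ringKrullDim (MP (Fin s) K) := by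
      algebraize [g0.toRingHom]
      have : Algebra.IsIntegral (MP (Fin s) K) R := ⟨hfin0.to_isIntegral⟩
      refine Order.krullDim_le_of_strictMono
        (PrimeSpectrum.comap (algebraMap (MP (Fin s) K) R)) ?_
      intro I J hIJ
      exact Ideal.IsIntegral.comap_lt_comap (R := MP (Fin s) K) (I := I.asIdeal)
        (J := J.asIdeal) hIJ
    refine h1.trans (h2.trans ?_)
    rw [MvPolynomial.ringKrullDim_of_isNoetherianRing, ringKrullDim_eq_zero_of_field]
    simp
  apply le_antisymm
  · apply sSup_le
    rintro _ ⟨l, rfl, hl, -⟩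
    exact hle l hl
  · refine hdim.trans (le_sSup ⟨_, ?_, hreg', ?_⟩)
    · simp only [rs, List.length_map, List.length_ofFn]; rfl
    · intro r hr
      obtain ⟨r, hr', rfl⟩ := List.mem_map.1 hr
      exact (IsLocalization.AtPrime.to_map_mem_maximal_iff _ p r).2 (hmem r hr')

theorem sum_pow_prime {R ι : Type*} [CommRing R] {p : ℕ} (hp : p.Prime) (n : ℕ) (s : Finset ι)
    (f : ι → R) : ∃ y, (∑ j ∈ s, f j) ^ p ^ n = (∑ j ∈ s, f j ^ p ^ n) + p * y := by
  classical
  induction s using Finset.induction_on with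
  | empty => exact ⟨0, by simp [hp.ne_zero]⟩
  | insert a s ha ih =>
    obtain ⟨y, hy⟩ := ih
    obtain ⟨r, hr⟩ := exists_add_pow_prime_pow_eq hp (f a) (∑ j ∈ s, f j) n
    refine ⟨y + f a * (∑ j ∈ s, f j) * r, ?_⟩
    rw [sum_insert ha, sum_insert ha, hr, hy]
    ring

theorem mem_span_image_fs {R σ : Type*} [CommRing R] (J : Finset σ) (f : σ → R) (x : R)
    (h : x ∈ Ideal.span (f '' (J : Set σ))) : ∃ b : σ → R, ∑ j ∈ J, b j * f j = x := by
  classical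
  obtain ⟨b, hb⟩ := (Submodule.mem_span_image_finset_iff_exists_fun (R := R)).1 h
  refine ⟨fun j => if hj : j ∈ J then b ⟨j, hj⟩ else 0, ?_⟩
  rw [← hb, ← Finset.sum_attach]
  exact sum_congr rfl fun j _ => by simp

theorem mono_colon {D σ : Type*} [CommRing D] (p Q : ℕ) (J : Finset σ) (i : σ) (hi : i ∉ J)
    (a y : MP σ D) (b : σ → MP σ D)
    (h : a * X i ^ Q = (∑ j ∈ J, b j * X j ^ Q) + (p : MP σ D) * y) :
    a ∈ Ideal.span ((fun j => (X j : MP σ D) ^ Q) '' (J : Set σ)) ⊔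
      Ideal.span {(p : MP σ D)} := by
  classical
  rw [a.as_sum]
  refine Ideal.sum_mem _ fun m hm => ?_
  by_cases hj : ∃ j ∈ J, Q ≤ m j
  · obtain ⟨j, hjJ, hj⟩ := hj
    refine Ideal.mem_sup_left ?_
    have : monomial m (coeff m a) = monomial (m - Finsupp.single j Q) (coeff m a) * X j ^ Q := by
      rw [X_pow_eq_monomial, monomial_mul, mul_one, tsub_add_cancel_of_le]
      simpa using hj
    rw [this]
    exact Ideal.mul_mem_left _ _ (Ideal.subset_span ⟨j, hjJ, rfl⟩)
  · push Not at hj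
    refine Ideal.mem_sup_right ?_
    have h1 := congrArg (coeff (m + Finsupp.single i Q)) h
    rw [X_pow_eq_monomial, coeff_mul_monomial, mul_one, coeff_add, coeff_sum,
      sum_eq_zero, zero_add] at h1
    · rw [h1, Ideal.mem_span_singleton]
      refine ⟨monomial m (coeff (m + Finsupp.single i Q) y), ?_⟩
      rw [← map_natCast (C : D →+* MP σ D), C_mul_monomial, coeff_C_mul]
    · intro j hjJ
      rw [X_pow_eq_monomial, coeff_mul_monomial', if_neg]
      intro hle
      have h2 := hle j
      have hne : j ≠ i := fun h => hi (h ▸ hjJ)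
      simp [Finsupp.single_apply, hne.symm] at h2
      exact absurd h2 (not_le.2 (hj j hjJ))

theorem tcl {D R σ ι : Type*} [CommRing D] [CommRing R] [Algebra (MP σ D) R]
    (e : ι → R) (he : LinearIndependent (MP σ D) e) (c : MP σ D)
    (hc : ∀ x : R, c • x ∈ Submodule.span (MP σ D) (Set.range e))
    {p : ℕ} (hp : p.Prime) (J : Finset σ) (i : σ) (hi : i ∉ J) (r : R)
    (h : r * algebraMap (MP σ D) R (X i) ∈
      Ideal.span ((fun j => algebraMap (MP σ D) R (X j)) '' (J : Set σ))) (n : ℕ) :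
    algebraMap (MP σ D) R c * r ^ p ^ n ∈
      Ideal.span ((fun j => algebraMap (MP σ D) R (X j) ^ p ^ n) '' (J : Set σ)) ⊔
        Ideal.span {(p : R)} := by
  classical
  obtain ⟨b, hb⟩ := mem_span_image_fs J _ _ h
  obtain ⟨y, hy⟩ := sum_pow_prime hp n J
    (fun j => b j * algebraMap (MP σ D) R (X j))
  rw [hb] at hy
  let Λ : R →ₗ[MP σ D] ι →₀ MP σ D :=
    he.repr ∘ₗ (LinearMap.codRestrict _ (LinearMap.lsmul (MP σ D) R c) hc)
  have hΛ : ∀ x, c • x = (Λ x).sum fun l a => a • e l := by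
    intro x
    have := he.linearCombination_repr ⟨c • x, hc x⟩
    rw [Finsupp.linearCombination_apply] at this
    exact this.symm
  have key : ∀ l, Λ (r ^ p ^ n) l ∈
      Ideal.span ((fun j => (X j : MP σ D) ^ p ^ n) '' (J : Set σ)) ⊔
      Ideal.span {(p : MP σ D)} := by
    intro l
    refine mono_colon p (p ^ n) J i hi _ (Λ y l) (fun j => Λ (b j ^ p ^ n) l) ?_
    have h1 : (X i : MP σ D) ^ p ^ n • (r ^ p ^ n) =
        (∑ j ∈ J, (X j : MP σ D) ^ p ^ n • (b j ^ p ^ n)) +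
          (p : MP σ D) • y := by
      simp only [Algebra.smul_def, map_pow, map_natCast]
      rw [← mul_pow, mul_comm, hy]
      congr 1
      refine sum_congr rfl fun j _ => ?_
      rw [mul_pow, mul_comm]
    have h2 := DFunLike.congr_fun (congrArg Λ h1) l
    simp only [map_add, map_sum, map_smul, Finsupp.add_apply, Finsupp.smul_apply,
      Finsupp.finsetSum_apply, smul_eq_mul] at h2
    rw [mul_comm, h2]
    congr 1
    exact sum_congr rfl fun j _ => mul_comm _ _
  rw [← Algebra.smul_def, hΛ]
  refine Ideal.sum_mem _ fun l _ => ?_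
  simp only [Algebra.smul_def]
  refine Ideal.mul_mem_right _ _ ?_
  have := Ideal.mem_map_of_mem (algebraMap (MP σ D) R) (key l)
  rw [Ideal.map_sup, Ideal.map_span, Ideal.map_span, ← Set.image_comp, Set.image_singleton,
    map_natCast] at this
  convert this using 4
  simp

theorem exists_free {A R : Type*} [CommRing A] [IsDomain A] [CommRing R] [Algebra A R]
    {m : ℕ} (v : Fin m → R) (hv : Submodule.span A (Set.range v) = ⊤) :
    ∃ (s : Set (Fin m)) (c : A), c ≠ 0 ∧ LinearIndependent A (fun i : s => v i) ∧
      ∀ i, c • v i ∈ Submodule.span A (Set.range fun i : s => v i) := by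
  classical
  obtain ⟨s, hs, h⟩ := exists_maximal_linearIndepOn A v
  have h' : ∀ i, ∃ a : A, a ≠ 0 ∧ a • v i ∈ Submodule.span A (v '' s) := by
    intro i
    by_cases hi : i ∈ s
    · exact ⟨1, one_ne_zero, by rw [one_smul]; exact Submodule.subset_span ⟨i, hi, rfl⟩⟩
    · exact h i hi
  choose a ha ha' using h'
  have hr : (Set.range fun i : s => v i) = v '' s := by ext; simp
  refine ⟨s, ∏ i, a i, prod_ne_zero_iff.2 fun i _ => ha i, hs, fun i => ?_⟩
  rw [hr, ← mul_prod_erase _ _ (mem_univ i), mul_comm, mul_smul]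
  exact Submodule.smul_mem _ _ (ha' i)

section lsubsec
variable {K : Type*} [Field K] {B : Type*} [CommRing B] [Algebra K B] {τ : Type*} [Fintype τ]
  [DecidableEq τ]

noncomputable def lsub (B : Type*) [CommRing B] [Algebra K B] (A : Matrix τ τ K) :
    MP τ B →ₐ[B] MP τ B :=
  aeval fun v => ∑ w, C (algebraMap K B (A v w)) * X w

theorem lsub_X (A : Matrix τ τ K) (v : τ) :
    lsub B A (X v) = ∑ w, C (algebraMap K B (A v w)) * X w := by simp [lsub]

theorem lsub_mul (A A' : Matrix τ τ K) (f : MP τ B) :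
    lsub B (A * A') f = lsub B A' (lsub B A f) := by
  have : lsub B (A * A') = (lsub B A').comp (lsub B A) := by
    ext v : 1
    rw [AlgHom.comp_apply, lsub_X, lsub_X, map_sum]
    have h1 : ∀ x : B, lsub B A' (C x) = C x := fun x => (lsub B A').commutes x
    simp only [map_mul, h1, lsub_X, Matrix.mul_apply, map_sum, Finset.sum_mul, Finset.mul_sum]
    rw [Finset.sum_comm]
    simp only [mul_assoc]
  rw [this]; rfl

theorem lsub_one (f : MP τ B) : lsub B (1 : Matrix τ τ K) f = f := by
  have : lsub B (1 : Matrix τ τ K) = AlgHom.id B _ := by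
    ext v : 1
    rw [lsub_X, sum_eq_single v]
    · simp
    · intro w _ hw; simp [Matrix.one_apply_ne hw.symm]
    · simp
  rw [this]; rfl

theorem lsub_hom (A : Matrix τ τ K) {f : MP τ B} {d : ℕ} (hf : f.IsHomogeneous d) :
    (lsub B A f).IsHomogeneous d := by
  have := IsHomogeneous.aeval hf (fun v => ∑ w, C (algebraMap K B (A v w)) * X w) (n := 1)
    (fun v => IsHomogeneous.sum _ _ _ fun w _ => by
      simpa using (isHomogeneous_C τ (algebraMap K B (A v w))).mul (isHomogeneous_X B w))
  simpa [lsub] using this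

noncomputable def topE (τ : Type*) [Fintype τ] (k : ℕ) : τ →₀ ℕ :=
  Finsupp.equivFunOnFinite.symm fun _ => k

@[simp] theorem topE_apply (k : ℕ) (v : τ) : topE τ k v = k := rfl

theorem monomial_topE (k : ℕ) : (monomial (topE τ k) 1 : MP τ B) = ∏ v, X v ^ k := by
  rw [monomial_eq, Finsupp.prod_fintype _ _ (by simp)]
  simp

theorem topE_degree (k : ℕ) : (topE τ k).degree = Fintype.card τ * k := by
  rw [Finsupp.degree_eq_sum]; simp

theorem coeff_top_X_pow_mul {k q : ℕ} (h : k < q) (v : τ) (g : MP τ B) :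
    coeff (topE τ k) (X v ^ q * g) = 0 := by
  rw [X_pow_eq_monomial, mul_comm, coeff_mul_monomial', if_neg]
  simpa using h

theorem coeff_top_lsub_of_le (p : ℕ) [Fact p.Prime] [CharP K p] (n : ℕ) (A : Matrix τ τ K)
    (m : τ →₀ ℕ) (v : τ) (hv : p ^ n ≤ m v) :
    coeff (topE τ (p ^ n - 1)) (lsub B A (monomial m 1)) = 0 := by
  have hpB : (p : MP τ B) = 0 := by
    rw [← map_natCast (algebraMap K (MP τ B)), CharP.cast_eq_zero, map_zero]
  have h1 : (monomial m (1 : B)) = X v ^ p ^ n * monomial (m - Finsupp.single v (p ^ n)) 1 := by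
    rw [X_pow_eq_monomial, monomial_mul, mul_one, add_tsub_cancel_of_le]
    simpa using hv
  have hq : p ^ n - 1 < p ^ n := Nat.sub_lt (pow_pos (Fact.out : p.Prime).pos n) one_pos
  obtain ⟨y, hy⟩ := sum_pow_prime (Fact.out : p.Prime) n univ
    (fun w => C (algebraMap K B (A v w)) * X w)
  rw [h1, map_mul, map_pow, lsub_X, hy, hpB, zero_mul, add_zero, Finset.sum_mul, coeff_sum]
  refine sum_eq_zero fun w _ => ?_
  rw [mul_pow, mul_comm (C _ ^ _), mul_assoc, coeff_top_X_pow_mul hq]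

theorem degree_lt_top {k : ℕ} {m : τ →₀ ℕ} (h : ∀ v, m v ≤ k) (hne : m ≠ topE τ k) :
    m.degree < (topE τ k).degree := by
  rw [Finsupp.degree_eq_sum, Finsupp.degree_eq_sum]
  apply Finset.sum_lt_sum (fun v _ => h v)
  by_contra hh
  push Not at hh
  exact hne (Finsupp.ext fun v => le_antisymm (h v) (hh v (mem_univ v)))

theorem coeff_top_lsub_aux (p : ℕ) [Fact p.Prime] [CharP K p] (n : ℕ) (A : Matrix τ τ K)
    (f : MP τ B) :
    coeff (topE τ (p ^ n - 1)) (lsub B A f) =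
      coeff (topE τ (p ^ n - 1)) (lsub B A (monomial (topE τ (p ^ n - 1)) 1)) *
        coeff (topE τ (p ^ n - 1)) f := by
  set t := topE τ (p ^ n - 1) with ht
  have hq : 0 < p ^ n := pow_pos (Fact.out : p.Prime).pos n
  induction f using MvPolynomial.induction_on' with
  | add f g hf hg => rw [map_add, coeff_add, coeff_add, hf, hg, mul_add]
  | monomial m a =>
    have h1 : monomial m a = C a * monomial m 1 := by rw [C_mul_monomial, mul_one]
    have h2 : lsub B A (C a) = C a := (lsub B A).commutes a
    rw [h1, map_mul, h2, coeff_C_mul, coeff_C_mul, coeff_monomial]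
    by_cases hm : m = t
    · subst hm; simp [mul_comm]
    · rw [if_neg hm, mul_zero, mul_zero]
      by_cases hv : ∃ v, p ^ n ≤ m v
      · obtain ⟨v, hv⟩ := hv
        rw [coeff_top_lsub_of_le p n A m v hv, mul_zero]
      · push Not at hv
        have := degree_lt_top (k := p ^ n - 1) (fun v => Nat.le_sub_one_of_lt (hv v)) hm
        rw [(lsub_hom A (isHomogeneous_monomial (1 : B) rfl)).coeff_eq_zero this.ne', mul_zero]

theorem coeff_top_lsub (p : ℕ) [Fact p.Prime] [CharP K p] (n : ℕ) (A : Matrix τ τ K)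
    (f : MP τ B) :
    coeff (topE τ (p ^ n - 1)) (lsub B A f) =
      algebraMap K B (A.det ^ (p ^ n - 1)) * coeff (topE τ (p ^ n - 1)) f := by
  rw [coeff_top_lsub_aux]
  congr 1
  have hq : 0 < p ^ n := pow_pos (Fact.out : p.Prime).pos n
  refine Matrix.diagonal_transvection_induction
    (fun A => coeff (topE τ (p ^ n - 1)) (lsub B A (monomial (topE τ (p ^ n - 1)) 1)) =
      algebraMap K B (A.det ^ (p ^ n - 1))) A ?_ ?_ ?_
  · intro d _
    have h1 : ∀ v, lsub B (diagonal d) (X v) = C (algebraMap K B (d v)) * X v := by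
      intro v
      rw [lsub_X, sum_eq_single v]
      · simp
      · intro w _ hw; simp [Matrix.diagonal_apply_ne _ hw.symm]
      · simp
    rw [monomial_topE, map_prod]
    simp only [map_pow, h1, mul_pow, prod_mul_distrib]
    rw [← monomial_topE, det_diagonal]
    simp only [← map_pow, ← map_prod]
    rw [coeff_C_mul, coeff_monomial, if_pos rfl, mul_one, Finset.prod_pow]
  · intro t
    have h1 : ∀ v, lsub B t.toMatrix (X v) =
        X v + if v = t.i then C (algebraMap K B t.c) * X t.j else 0 := by
      intro v
      rw [lsub_X]
      simp only [TransvectionStruct.toMatrix, transvection, Matrix.add_apply, map_add, add_mul,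
        sum_add_distrib]
      congr 1
      · rw [sum_eq_single v]
        · simp
        · intro w _ hw; simp [Matrix.one_apply_ne hw.symm]
        · simp
      · split_ifs with h
        · rw [sum_eq_single t.j]
          · simp [h]
          · intro w _ hw; rw [Matrix.single_apply_of_ne]; simp; rintro ⟨_, h⟩; exact hw h.symm
          · simp
        · refine sum_eq_zero fun w _ => ?_
          rw [Matrix.single_apply_of_ne]; simp; rintro ⟨h', _⟩; exact h h'.symm
    rw [TransvectionStruct.det, one_pow, (algebraMap K B).map_one, monomial_topE, map_prod]
    simp only [map_pow, h1]
    have hj : t.j ∈ univ.erase t.i := by simp [t.hij.symm]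
    rw [← mul_prod_erase _ _ (mem_univ t.i)]
    have h2 : ∏ x ∈ univ.erase t.i,
        (X x + if x = t.i then C (algebraMap K B t.c) * X t.j else 0 : MP τ B)
          ^ (p ^ n - 1) = ∏ x ∈ univ.erase t.i, X x ^ (p ^ n - 1) := by
      refine prod_congr rfl fun x hx => ?_
      rw [if_neg (Finset.ne_of_mem_erase hx), add_zero]
    rw [h2, if_pos rfl]
    obtain ⟨h, hh⟩ : ∃ h : MP τ B,
        (X t.i + C (algebraMap K B t.c) * X t.j) ^ (p ^ n - 1) =
          X t.i ^ (p ^ n - 1) + X t.j * h := by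
      have := sub_dvd_pow_sub_pow (X t.i + C (algebraMap K B t.c) * X t.j : MP τ B)
        (X t.i) (p ^ n - 1)
      obtain ⟨h, hh⟩ := this
      refine ⟨C (algebraMap K B t.c) * h, ?_⟩
      rw [← sub_eq_iff_eq_add', hh]; ring
    have h3 : (X t.j : MP τ B) * X t.j ^ (p ^ n - 1) = X t.j ^ p ^ n := by
      rw [← pow_succ', Nat.sub_add_cancel hq]
    rw [hh, add_mul, mul_prod_erase univ (fun x => (X x : MP τ B) ^ (p ^ n - 1))
      (mem_univ t.i), ← monomial_topE,
      coeff_add, coeff_monomial, if_pos rfl, ← mul_prod_erase _ _ hj]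
    have h4 : ∀ P : MP τ B, X t.j * h * (X t.j ^ (p ^ n - 1) * P) =
      X t.j ^ p ^ n * (h * P) := by intro P; rw [← h3]; ring
    rw [h4, coeff_top_X_pow_mul (Nat.sub_lt hq one_pos), add_zero]
  · intro A A' hA hA'
    rw [lsub_mul, coeff_top_lsub_aux, hA, hA', ← map_mul, det_mul, mul_pow, mul_comm]
end lsubsec

section trqsec
variable {K : Type*} [Field K] (p : ℕ) [Fact p.Prime] [CharP K p] [PerfectRing K p]
  {τ : Type*} [Fintype τ] [DecidableEq τ]

noncomputable def qroot (n : ℕ) (x : K) : K := (iterateFrobeniusEquiv K p n).symm x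

theorem qroot_add (n : ℕ) (x y : K) : qroot p n (x + y) = qroot p n x + qroot p n y :=
  map_add _ _ _
theorem qroot_mul (n : ℕ) (x y : K) : qroot p n (x * y) = qroot p n x * qroot p n y :=
  map_mul _ _ _
theorem qroot_zero (n : ℕ) : qroot p n (0 : K) = 0 := map_zero _
theorem qroot_one (n : ℕ) : qroot p n (1 : K) = 1 := map_one _
theorem qroot_pow (n : ℕ) (x : K) : qroot p n (x ^ p ^ n) = x :=
  (iterateFrobeniusEquiv K p n).symm_apply_apply x
theorem pow_qroot (n : ℕ) (x : K) : qroot p n x ^ p ^ n = x :=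
  (iterateFrobeniusEquiv K p n).apply_symm_apply x

open Classical in
noncomputable def trq (n : ℕ) (f : MP τ K) : MP τ K :=
  ∑ m ∈ f.support, if (∀ v, m v % p ^ n = p ^ n - 1) then
    monomial (m.mapRange (fun k => k / p ^ n) (Nat.zero_div _)) (qroot p n (coeff m f)) else 0

theorem coeff_trq (n : ℕ) (f : MP τ K) (b : τ →₀ ℕ) :
    coeff b (trq p n f) = qroot p n (coeff (p ^ n • b + topE τ (p ^ n - 1)) f) := by
  classical
  have hq : 0 < p ^ n := pow_pos (Fact.out : p.Prime).pos n
  set m0 := p ^ n • b + topE τ (p ^ n - 1) with hm0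
  have hmod : ∀ v, m0 v % p ^ n = p ^ n - 1 := by
    intro v
    simp only [hm0, Finsupp.add_apply, Finsupp.smul_apply, smul_eq_mul, topE_apply]
    rw [Nat.mul_add_mod, Nat.mod_eq_of_lt (Nat.sub_lt hq one_pos)]
  have hdiv : m0.mapRange (fun k => k / p ^ n) (by simp) = b := by
    ext v
    simp only [hm0, Finsupp.mapRange_apply, Finsupp.add_apply, Finsupp.smul_apply, smul_eq_mul,
      topE_apply]
    rw [Nat.mul_add_div hq, Nat.div_eq_of_lt (Nat.sub_lt hq one_pos), add_zero]
  rw [trq, coeff_sum, sum_eq_single m0]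
  · rw [if_pos hmod, coeff_monomial, if_pos hdiv]
  · intro m _ hm
    split_ifs with h
    · rw [coeff_monomial, if_neg]
      intro hb
      apply hm
      ext v
      have h1 := Nat.div_add_mod (m v) (p ^ n)
      have h2 := DFunLike.congr_fun hb v
      simp only [Finsupp.mapRange_apply] at h2
      rw [h v, h2] at h1
      simp [hm0, h1]
    · simp
  · intro h
    rw [if_pos hmod, notMem_support_iff.1 h, qroot_zero]; simp

theorem trq_add (n : ℕ) (f g : MP τ K) : trq p n (f + g) = trq p n f + trq p n g := by
  ext b; simp [coeff_trq, qroot_add]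

theorem trq_zero (n : ℕ) : trq p n (0 : MP τ K) = 0 := by
  ext b; simp [coeff_trq, qroot_zero]

theorem trq_sum {ι : Type*} (n : ℕ) (s : Finset ι) (f : ι → MP τ K) :
    trq p n (∑ i ∈ s, f i) = ∑ i ∈ s, trq p n (f i) := by
  classical
  induction s using Finset.induction_on with
  | empty => simp [trq_zero]
  | insert a s ha ih => rw [sum_insert ha, sum_insert ha, trq_add, ih]

theorem trq_pow_mul (n : ℕ) (a f : MP τ K) :
    trq p n (a ^ p ^ n * f) = a * trq p n f := by
  classical
  have hq : 0 < p ^ n := pow_pos (Fact.out : p.Prime).pos n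
  induction a using MvPolynomial.induction_on' with
  | add a b ha hb => rw [add_pow_char_pow, add_mul, add_mul, trq_add, ha, hb]
  | monomial m c =>
    ext b
    rw [coeff_trq, monomial_pow, mul_comm (monomial _ _), coeff_mul_monomial',
      mul_comm (monomial _ _), coeff_mul_monomial']
    have hiff : p ^ n • m ≤ p ^ n • b + topE τ (p ^ n - 1) ↔ m ≤ b := by
      refine forall_congr' fun v => ?_
      simp only [Finsupp.add_apply, Finsupp.smul_apply, smul_eq_mul, topE_apply]
      constructor
      · intro h
        by_contra hlt
        have := Nat.mul_le_mul_left (p ^ n) (Nat.succ_le_of_lt (not_le.1 hlt))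
        rw [Nat.mul_succ] at this
        omega
      · intro h
        exact (Nat.mul_le_mul_left _ h).trans (Nat.le_add_right _ _)
    simp only [hiff]
    split_ifs with h
    · rw [qroot_mul, qroot_pow, coeff_trq]
      congr 3
      ext v
      have := Nat.mul_le_mul_left (p ^ n) (h v)
      simp only [Finsupp.add_apply, Finsupp.smul_apply, smul_eq_mul, topE_apply,
        Finsupp.tsub_apply, Nat.mul_sub]
      omega
    · exact qroot_zero p n

theorem trq_of_degree (n : ℕ) (f : MP τ K)
    (hf : ∀ m ∈ f.support, m.degree ≤ Fintype.card τ * (p ^ n - 1)) :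
    trq p n f = C (qroot p n (coeff (topE τ (p ^ n - 1)) f)) := by
  classical
  have hq : 0 < p ^ n := pow_pos (Fact.out : p.Prime).pos n
  ext b
  rw [coeff_trq, coeff_C]
  split_ifs with h
  · rw [← h, smul_zero, zero_add]
  · rw [notMem_support_iff.1, qroot_zero]
    intro hm
    have := hf _ hm
    rw [map_add, map_nsmul, topE_degree] at this
    have h1 : b.degree ≠ 0 := fun hb => h ((Finsupp.degree_eq_zero_iff b).1 hb).symm
    have h2 : 0 < p ^ n • b.degree := by
      rw [smul_eq_mul]; exact Nat.mul_pos hq (Nat.pos_of_ne_zero h1)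
    omega

theorem trq_lsub (n : ℕ) (A : Matrix τ τ K) (hA : A.det = 1) (f : MP τ K) :
    trq p n (lsub K A f) = lsub K A (trq p n f) := by
  classical
  have hq : 0 < p ^ n := pow_pos (Fact.out : p.Prime).pos n
  induction f using MvPolynomial.induction_on' with
  | add f g hf hg => rw [map_add, trq_add, hf, hg, trq_add, map_add]
  | monomial m c =>
    set b := m.mapRange (fun k => k / p ^ n) (Nat.zero_div _) with hb
    set a := m.mapRange (fun k => k % p ^ n) (Nat.zero_mod _) with ha
    have hm : monomial m c = monomial b (qroot p n c) ^ p ^ n * monomial a 1 := by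
      have hmab : p ^ n • b + a = m := by
        ext v
        rw [hb, ha, Finsupp.add_apply, Finsupp.smul_apply, Finsupp.mapRange_apply,
          Finsupp.mapRange_apply, smul_eq_mul, Nat.div_add_mod]
      rw [monomial_pow, monomial_mul, mul_one, pow_qroot, hmab]
    have key : trq p n (lsub K A (monomial a 1)) = lsub K A (trq p n (monomial a (1 : K))) := by
      have hdeg : a.degree ≤ Fintype.card τ * (p ^ n - 1) := by
        rw [← topE_degree (τ := τ), Finsupp.degree_eq_sum, Finsupp.degree_eq_sum]
        refine Finset.sum_le_sum fun v _ => ?_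
        simp only [ha, Finsupp.mapRange_apply, topE_apply]
        exact Nat.le_sub_one_of_lt (Nat.mod_lt _ hq)
      rw [trq_of_degree p n (lsub K A (monomial a 1)), trq_of_degree p n (monomial a (1 : K)),
        coeff_top_lsub, hA, one_pow, map_one, one_mul]
      · exact ((lsub K A).commutes _).symm
      · intro m' hm'
        have := (mem_support_iff.1 hm')
        rw [coeff_monomial] at this
        have : a = m' := by by_contra h; simp [h] at this
        rw [← this]; exact hdeg
      · intro m' hm'
        have h1 := lsub_hom A (isHomogeneous_monomial (1 : K) (rfl : a.degree = a.degree))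
        have : m'.degree = a.degree := by
          by_contra h
          exact mem_support_iff.1 hm' (h1.coeff_eq_zero h)
        rw [this]; exact hdeg
    rw [hm, map_mul, map_pow, trq_pow_mul, trq_pow_mul, map_mul, key]
end trqsec

section framework
variable {K : Type} [Field K] {Q0 Q1 : Type} {ta ha : Q1 → Q0} {α : Q0 → ℕ}

abbrev VV (ta ha : Q1 → Q0) (α : Q0 → ℕ) : Type := (a : Q1) × (Fin (α (ha a)) × Fin (α (ta a)))

abbrev GM (α : Q0 → ℕ) (B : Type) : Type := (b : Q0) → Matrix (Fin (α b)) (Fin (α b)) B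

def vmat {B : Type} (x : (VV ta ha α) → B) (a : Q1) :
    Matrix (Fin (α (ha a))) (Fin (α (ta a))) B := fun i j => x ⟨a, (i, j)⟩

def cj {B : Type} [CommRing B] (g : GM α B) (x : (VV ta ha α) → B) : (VV ta ha α) → B :=
  fun v => (g (ha v.1) * vmat x v.1 * (g (ta v.1)).adjugate) v.2.1 v.2.2

theorem vmat_cj {B : Type} [CommRing B] (g : GM α B) (x : (VV ta ha α) → B) (a : Q1) :
    vmat (cj g x) a = g (ha a) * vmat x a * (g (ta a)).adjugate := rfl

theorem cj_mul {B : Type} [CommRing B] (g h : GM α B) (x : (VV ta ha α) → B) :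
    cj (g * h) x = cj g (cj h x) := by
  funext v
  rw [cj, cj, vmat_cj, Pi.mul_apply, Pi.mul_apply, Matrix.adjugate_mul_distrib]
  simp only [Matrix.mul_assoc]

theorem cj_one {B : Type} [CommRing B] (x : (VV ta ha α) → B) :
    cj (1 : GM α B) x = x := by
  funext v
  rw [cj]; simp [vmat]

def gmap {B B' : Type} [CommRing B] [CommRing B'] (φ : B →+* B') (g : GM α B) : GM α B' :=
  fun b => (g b).map φ

theorem map_cj {B B' : Type} [CommRing B] [CommRing B'] (φ : B →+* B') (g : GM α B)
    (x : (VV ta ha α) → B) : (fun v => φ (cj g x v)) = cj (gmap φ g) (fun v => φ (x v)) := by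
  funext v
  have h : vmat (fun v => φ (x v)) v.1 = (vmat x v.1).map φ := rfl
  rw [cj, cj, h, gmap, gmap]
  have h2 : ((g (ta v.1)).map φ).adjugate = (g (ta v.1)).adjugate.map φ :=
    (RingHom.map_adjugate φ _).symm
  rw [h2, ← Matrix.map_mul, ← Matrix.map_mul]; rfl

theorem gmap_mul {B B' : Type} [CommRing B] [CommRing B'] (φ : B →+* B') (g h : GM α B) :
    gmap φ (g * h) = gmap φ g * gmap φ h := by
  funext b; simp [gmap, Matrix.map_mul]

theorem gmap_one {B B' : Type} [CommRing B] [CommRing B'] (φ : B →+* B') :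
    gmap φ (1 : GM α B) = 1 := by
  funext b; simp [gmap]

noncomputable def act (g : GM α K) :
    (MP (VV ta ha α) K) →ₐ[K] (MP (VV ta ha α) K) :=
  aeval (cj (gmap (C) g) X)

theorem aeval_act {B : Type} [CommRing B] [Algebra K B] (g : GM α K) (x : (VV ta ha α) → B)
    (s : (MP (VV ta ha α) K)) :
    aeval x (act g s) = aeval (cj (gmap (algebraMap K B) g) x) s := by
  have : (aeval x : (MP (VV ta ha α) K) →ₐ[K] B).comp (act g) =
      aeval (cj (gmap (algebraMap K B) g) x) := by
    apply MvPolynomial.algHom_ext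
    intro v
    rw [AlgHom.comp_apply, act, aeval_X, aeval_X]
    have := congrFun (map_cj ((aeval x : (MP (VV ta ha α) K) →ₐ[K] B) : (MP (VV ta ha α) K) →+* B)
      (gmap C g) (X : (VV ta ha α) → _)) v
    refine this.trans ?_
    have e1 : gmap ((aeval x : (MP (VV ta ha α) K) →ₐ[K] B) : (MP (VV ta ha α) K) →+* B) (gmap C g)
        = gmap (algebraMap K B) g := by funext b; ext i j; simp [gmap]
    have e2 : (fun v => ((aeval x : (MP (VV ta ha α) K) →ₐ[K] B) : (MP (VV ta ha α) K) →+* B) (X v)) = x := by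
      funext v; simp
    rw [e1, e2]
  rw [← this]; rfl

theorem act_act (g h : GM α K) (s : (MP (VV ta ha α) K)) :
    act g (act h s) = act (h * g) s := by
  conv_lhs => rw [act]
  rw [aeval_act, ← cj_mul, act, gmap_mul]; rfl

theorem act_one (s : (MP (VV ta ha α) K)) : act (1 : GM α K) s = s := by
  rw [act, gmap_one, cj_one, aeval_X_left]; rfl

theorem act_hom (g : GM α K) {s : (MP (VV ta ha α) K)} {d : ℕ} (hs : s.IsHomogeneous d) :
    (act g s).IsHomogeneous d := by
  have := IsHomogeneous.aeval hs (cj (gmap (C) g) X : (VV ta ha α) → (MP (VV ta ha α) K))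
    (n := 1) ?_
  · simpa [act] using this
  intro v
  rw [cj, Matrix.mul_apply]
  refine IsHomogeneous.sum _ _ _ fun j _ => ?_
  rw [Matrix.mul_apply, Finset.sum_mul]
  refine IsHomogeneous.sum _ _ _ fun i _ => ?_
  have h2 : (gmap (C) g (ta v.1)).adjugate = ((g (ta v.1)).adjugate.map (C (σ := (VV ta ha α)))) :=
    (RingHom.map_adjugate (C (σ := (VV ta ha α))) _).symm
  rw [h2]
  simp only [gmap, Matrix.map_apply, vmat]
  simpa using ((isHomogeneous_C _ _).mul (isHomogeneous_X K _)).mul (isHomogeneous_C _ _)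

theorem act_hc (g : GM α K) (s : (MP (VV ta ha α) K)) (d : ℕ) :
    homogeneousComponent d (act g s) = act g (homogeneousComponent d s) := by
  conv_lhs => rw [← sum_homogeneousComponent s, map_sum, map_sum]
  rw [sum_congr rfl fun i _ => homogeneousComponent_of_mem
    (act_hom g (homogeneousComponent_isHomogeneous i s)), Finset.sum_ite_eq]
  split_ifs with h
  · rfl
  · rw [homogeneousComponent_eq_zero]; · simp
    simp at h; omega

theorem mem_SL [Infinite K] (s : (MP (VV ta ha α) K)) :
    s ∈ (quiverSemiInvariants K ta ha α) ↔ ∀ g : GM α K, (∀ b, (g b).det = 1) → act g s = s := by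
  rw [quiverSemiInvariants]
  simp only [Algebra.mem_iInf, AlgHom.mem_equalizer]
  have key : ∀ (g : GM α K) (v : (a : Q1) → Matrix (Fin (α (ha a))) (Fin (α (ta a))) K),
    aeval (repCoords v) (act g s) = aeval (repCoords fun a => g (ha a) * v a * (g (ta a)).adjugate) s := by
    intro g v
    rw [aeval_act]; rfl
  constructor
  · intro H g hg
    apply MvPolynomial.funext
    intro x
    have := H (fun b => ⟨g b, hg b⟩) (vmat x)
    exact (key g (vmat x)).trans this
  · intro H A v
    have := H (fun b => (A b).val) (fun b => (A b).2)
    refine (key (fun b => (A b).val) v).symm.trans ?_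
    rw [this]

end framework

set_option hygiene false in
local notation "SK" => MvPolynomial (VV ta ha α) K
set_option hygiene false in
local notation "VQ" => VV ta ha α
set_option hygiene false in
local notation "QS" => quiverSemiInvariants K ta ha α
set_option hygiene false in
local notation "QI" => quiverInvariants K ta ha α

theorem density {K : Type} [Field K] [Infinite K] {σ : Type} {A : Type} [CommRing A] [Algebra K A]
    (J : Submodule K A) (f : MP σ A) (h : MP σ K) (hh : h ≠ 0)
    (H : ∀ x : σ → K, eval x h ≠ 0 → eval (fun i => algebraMap K A (x i)) f ∈ J) (m : σ →₀ ℕ) :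
    coeff m f ∈ J := by
  classical
  by_contra hm
  obtain ⟨l, hl, hJ⟩ := Submodule.exists_le_ker_of_notMem hm
  set f' : MP σ K := ∑ d ∈ f.support, monomial d (l (coeff d f)) with hf'
  have e1 : ∀ x : σ → K, eval x f' = l (eval (fun i => algebraMap K A (x i)) f) := by
    intro x
    rw [hf', map_sum, eval_eq (fun i => algebraMap K A (x i)) f, map_sum]
    refine sum_congr rfl fun d _ => ?_
    rw [eval_monomial, Finsupp.prod]
    simp only [← map_pow, ← map_prod]
    rw [mul_comm (coeff d f), ← Algebra.smul_def, _root_.map_smul, smul_eq_mul, mul_comm]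
  have e2 : h * f' = 0 := by
    apply MvPolynomial.funext
    intro x
    rw [map_mul, map_zero]
    by_cases hx : eval x h = 0
    · rw [hx, zero_mul]
    · rw [e1, LinearMap.mem_ker.1 (hJ (H x hx)), mul_zero]
  have e3 : f' = 0 := (mul_eq_zero.1 e2).resolve_left hh
  have e4 : coeff m f' = l (coeff m f) := by
    rw [hf', coeff_sum]
    simp only [coeff_monomial]
    rw [Finset.sum_ite_eq' ]
    split_ifs with h1
    · rfl
    · rw [notMem_support_iff.1 h1, map_zero]
  rw [e3, coeff_zero] at e4
  exact hl e4.symm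

section framework
variable {K : Type} [Field K] {Q0 Q1 : Type} {ta ha : Q1 → Q0} {α : Q0 → ℕ}
  [Fintype Q0] [DecidableEq Q0]

abbrev XX (μ α : Q0 → ℕ) : Type := (b : Q0) × (Fin (μ b) × Fin (α b))

noncomputable def Xi (B : Type) [CommRing B] (α : Q0 → ℕ) : GM α (MP (XX α α) B) :=
  fun b i j => X ⟨b, (i, j)⟩

noncomputable def del (s : SK) :
    MP (XX α α) SK :=
  aeval (cj (Xi _ α) (fun v => C (X v))) s

def gpt {B : Type} (g : GM α B) : XX α α → B := fun x => g x.1 x.2.1 x.2.2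

theorem map_aeval_cj {B B' : Type} [CommRing B] [CommRing B'] [Algebra K B] [Algebra K B']
    (φ : B →+* B') (hφ : ∀ c : K, φ (algebraMap K B c) = algebraMap K B' c) (g : GM α B)
    (x : VQ → B) (s : SK) :
    φ (aeval (cj g x) s) = aeval (cj (gmap φ g) (fun v => φ (x v))) s := by
  let φ' : B →ₐ[K] B' := { φ with commutes' := hφ }
  have := congrArg (fun f : SK →ₐ[K] B' => f s)
    (comp_aeval (cj g x) φ')
  refine this.trans ?_
  have h2 : (fun i => φ' (cj g x i)) = cj (gmap φ g) (fun v => φ (x v)) := map_cj φ g x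
  simp only [h2]

theorem eval_del (g : GM α K) (s : SK) :
    eval (fun i => algebraMap K _ (gpt g i)) (del s) = act g s := by
  rw [del, map_aeval_cj, act]
  · have e1 : gmap (eval fun i => algebraMap K SK (gpt g i)) (Xi _ α)
        = gmap C g := by
      funext b; ext1 i j
      simp only [gmap, Xi, gpt, Matrix.map_apply, eval_X, MvPolynomial.algebraMap_eq]
    have e2 : (fun v => eval (fun i => algebraMap K SK (gpt g i))
        (C (X v))) = (X : VQ → SK) := by
      funext v; rw [eval_C]
    rw [e1, e2]
  · intro c
    exact eval_C _

theorem det_bd' {m : Q0 → Type} [∀ b, Fintype (m b)] [∀ b, DecidableEq (m b)]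
    (M : ∀ b, Matrix (m b) (m b) K) : (blockDiagonal' M).det = ∏ b, (M b).det := by
  letI : LinearOrder Q0 := LinearOrder.lift' (Fintype.equivFin Q0) (Fintype.equivFin Q0).injective
  rw [BlockTriangular.det_fintype (b := Sigma.fst)]
  · refine prod_congr rfl fun k _ => ?_
    rw [← det_submatrix_equiv_self (Equiv.sigmaSubtype k).symm]
    congr 1
    ext i j
    exact blockDiagonal'_apply_eq _ _ _ _
  · rintro ⟨i, x⟩ ⟨j, y⟩ hij
    exact blockDiagonal'_apply_ne _ _ _ (ne_of_gt hij)

noncomputable def rmat (μ : Q0 → ℕ) (g : GM α K) : Matrix (XX μ α) (XX μ α) K :=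
  blockDiagonal' fun b => Matrix.kroneckerMap (· * ·) (1 : Matrix (Fin (μ b)) (Fin (μ b)) K) (g b)ᵀ

theorem lsub_rmat {B : Type} [CommRing B] [Algebra K B] (μ : Q0 → ℕ) (g : GM α K) (b : Q0)
    (i : Fin (μ b)) (j : Fin (α b)) :
    lsub B (rmat μ g) (X ⟨b, (i, j)⟩) = ∑ k, X ⟨b, (i, k)⟩ * C (algebraMap K B (g b k j)) := by
  rw [lsub_X, Fintype.sum_sigma, sum_eq_single b]
  · rw [Fintype.sum_prod_type, sum_eq_single i]
    · refine sum_congr rfl fun k _ => ?_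
      rw [rmat, blockDiagonal'_apply_eq, kroneckerMap_apply, mul_comm]; simp
    · intro i' _ hi'
      refine sum_eq_zero fun k _ => ?_
      rw [rmat, blockDiagonal'_apply_eq, kroneckerMap_apply, Matrix.one_apply_ne hi'.symm]; simp
    · simp
  · intro b' _ hb'
    refine sum_eq_zero fun k _ => ?_
    rw [rmat, blockDiagonal'_apply_ne _ _ _ hb'.symm]; simp
  · simp

theorem det_rmat (μ : Q0 → ℕ) (g : GM α K) (hg : ∀ b, (g b).det = 1) : (rmat μ g).det = 1 := by
  rw [rmat, det_bd']
  refine Finset.prod_eq_one fun b _ => ?_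
  have := det_kronecker (1 : Matrix (Fin (μ b)) (Fin (μ b)) K) (g b)ᵀ
  refine this.trans ?_
  rw [det_transpose, hg, det_one]; simp

theorem map_act_del (g : GM α K) (s : SK) :
    MvPolynomial.map (act g : SK →ₐ[K] _).toRingHom
      (del s) = lsub _ (rmat α g) (del s) := by
  have hK : ∀ c : K, algebraMap K (MP (XX α α) SK) c
      = C (algebraMap K _ c) := fun c => rfl
  rw [del, map_aeval_cj]
  refine Eq.trans ?_ (map_aeval_cj (lsub SK (rmat α g)).toRingHom
    ?_ _ _ _).symm
  · have e1 : gmap (MvPolynomial.map (act g : SK →ₐ[K] _).toRingHom) (Xi _ α) = Xi _ α := by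
      funext b; ext1 i j; simp [gmap, Xi]
    have e2 : gmap ((lsub SK (rmat α g)).toRingHom) (Xi _ α)
          = Xi _ α * gmap (algebraMap K _) g := by
      funext b; ext1 i j
      simp only [gmap, Xi, Matrix.map_apply, Pi.mul_apply, Matrix.mul_apply]
      exact lsub_rmat α g b i j
    have e3 : (fun v => MvPolynomial.map (σ := XX α α) (act g : SK →ₐ[K] _).toRingHom (C (X v))) = cj (gmap (algebraMap K
        (MP (XX α α) SK)) g) (fun v : VQ => C (X v)) := by
      funext v
      rw [map_C]
      have h1 : act g (X v : SK) = cj (gmap C g) X v := by rw [act, aeval_X]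
      show C (act g (X v)) = _
      rw [h1]
      have h2 := congrFun (map_cj (C : _ →+* MP (XX α α) SK)
        (gmap C g) (X : VQ → _)) v
      refine h2.trans ?_
      congr 1
    have e4 : (fun v => (lsub SK (rmat α g)).toRingHom (C (X v))) =
        fun v : VQ => C (X v) := by
      funext v
      exact (lsub _ _).commutes _
    rw [e1, e2, e3, e4, cj_mul]
  · intro c; rw [hK]; exact (lsub _ _).commutes _
  · intro c; rw [hK, map_C]; congr 1; exact (act g).commutes c

end framework

section lemG
variable {K : Type} [Field K] {V : Type}

theorem hc_mul_homog (c f : MP V K) (d n : ℕ) (hf : f.IsHomogeneous d) :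
    homogeneousComponent n (c * f) = if d ≤ n then homogeneousComponent (n - d) c * f else 0 := by
  conv_lhs => rw [← sum_homogeneousComponent c, Finset.sum_mul, map_sum]
  rw [sum_congr rfl fun i _ => homogeneousComponent_of_mem
    ((homogeneousComponent_isHomogeneous i c).mul hf)]
  split_ifs with h
  · have : ∀ i, (n = i + d) ↔ (n - d = i) := fun i => by omega
    simp only [this]
    rw [Finset.sum_ite_eq]
    split_ifs with h2
    · rfl
    · rw [homogeneousComponent_eq_zero]; · simp
      simp at h2; omega
  · exact sum_eq_zero fun i _ => if_neg (by omega)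

theorem hc_mul (c f : MP V K) (n : ℕ) :
    homogeneousComponent n (c * f) = ∑ d ∈ Finset.range (f.totalDegree + 1),
      if d ≤ n then homogeneousComponent (n - d) c * homogeneousComponent d f else 0 := by
  conv_lhs => rw [← sum_homogeneousComponent f, Finset.mul_sum, map_sum]
  exact sum_congr rfl fun d _ => hc_mul_homog _ _ _ _ (homogeneousComponent_isHomogeneous d f)

theorem lemG (R : Subalgebra K (MP V K)) (J : Ideal (MP V K))
    (hR : ∀ r ∈ R, ∀ d, homogeneousComponent d r ∈ R)
    (hJ : ∀ r ∈ J, ∀ d, homogeneousComponent d r ∈ J)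
    (F : Finset (MP V K)) (hF : ∀ f ∈ F, f ∈ R ∧ coeff 0 f = 0)
    (H : ∀ r ∈ R, coeff 0 r = 0 → ∃ c : MP V K → MP V K, (∀ f, c f ∈ R) ∧
      r - ∑ f ∈ F, c f * f ∈ J) : (R.map (Ideal.Quotient.mkₐ K J)).FG := by
  classical
  set T : Finset (MP V K) := F.biUnion fun f =>
    (Finset.range (f.totalDegree + 1)).image fun d => homogeneousComponent d f with hT
  have hTR : ∀ t ∈ T, t ∈ R := by
    intro t ht
    simp only [hT, Finset.mem_biUnion, mem_image] at ht
    obtain ⟨f, hf, d, _, rfl⟩ := ht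
    exact hR _ (hF f hf).1 _
  have main : ∀ n, ∀ r ∈ R, r.IsHomogeneous n →
      ∃ y ∈ Algebra.adjoin K (T : Set (MP V K)), r - y ∈ J := by
    intro n
    induction n using Nat.strong_induction_on with
    | _ n ih =>
    intro r hr hn
    rcases Nat.eq_zero_or_pos n with h0 | hpos
    · rw [h0] at hn
      refine ⟨r, ?_, by simp⟩
      have : r = C (coeff 0 r) := by
        have h5 := homogeneousComponent_of_mem (n := 0) (m := 0) hn
        rw [if_pos rfl, homogeneousComponent_zero] at h5
        exact h5.symm
      rw [this]; exact Subalgebra.algebraMap_mem _ _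
    · have hc0 : coeff 0 r = 0 := by
        have h1 := homogeneousComponent_of_mem (m := 0) (n := n) hn
        rw [if_neg (by omega), homogeneousComponent_zero] at h1
        exact C_injective V K (by simpa using h1)
      obtain ⟨c, hc, hcJ⟩ := H r hr hc0
      have h2 := hJ _ hcJ n
      rw [map_sub, homogeneousComponent_of_mem hn, if_pos rfl, map_sum] at h2
      have h3 : ∀ f ∈ F, ∃ y ∈ Algebra.adjoin K (T : Set (MP V K)),
          homogeneousComponent n (c f * f) - y ∈ J := by
        intro f hf
        have h4 : ∀ d ∈ Finset.range (f.totalDegree + 1),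
            ∃ y ∈ Algebra.adjoin K (T : Set (MP V K)),
            (if d ≤ n then homogeneousComponent (n - d) (c f) * homogeneousComponent d f else 0) - y ∈ J := by
          intro d hd
          split_ifs with h
          · rcases Nat.eq_zero_or_pos d with h0 | h0
            · refine ⟨0, Subalgebra.zero_mem _, ?_⟩
              rw [h0, homogeneousComponent_zero, (hF f hf).2]; simp
            · obtain ⟨y, hy, hyJ⟩ := ih (n - d) (by omega) _ (hR _ (hc f) (n - d))
                (homogeneousComponent_isHomogeneous _ _)
              refine ⟨y * homogeneousComponent d f, Subalgebra.mul_mem _ hy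
                (Algebra.subset_adjoin ?_), ?_⟩
              · simp only [hT, Finset.coe_biUnion, Set.mem_iUnion, Finset.coe_image]
                exact ⟨f, hf, d, hd, rfl⟩
              · rw [← sub_mul]; exact J.mul_mem_right _ hyJ
          · exact ⟨0, Subalgebra.zero_mem _, by simp⟩
        choose! y hy hyJ using h4
        refine ⟨∑ d ∈ Finset.range (f.totalDegree + 1), y d, Subalgebra.sum_mem _ hy, ?_⟩
        rw [hc_mul, ← sum_sub_distrib]
        exact J.sum_mem hyJ
      choose! y hy hyJ using h3
      refine ⟨∑ f ∈ F, y f, Subalgebra.sum_mem _ hy, ?_⟩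
      have := J.add_mem h2 (J.sum_mem hyJ)
      rw [sum_sub_distrib] at this
      simpa using this
  refine ⟨T.image (Ideal.Quotient.mkₐ K J), ?_⟩
  rw [Finset.coe_image, Algebra.adjoin_image]
  apply le_antisymm
  · exact Subalgebra.map_mono (Algebra.adjoin_le hTR)
  · rintro _ ⟨r, hr, rfl⟩
    choose y hy hyJ using fun d => main d _ (hR r hr d) (homogeneousComponent_isHomogeneous d r)
    refine ⟨∑ d ∈ Finset.range (r.totalDegree + 1), y d, Subalgebra.sum_mem _ fun d _ => hy d, ?_⟩
    refine Eq.symm ((Ideal.Quotient.mk_eq_mk_iff_sub_mem _ _).2 ?_)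
    conv => enter [2, 1]; rw [← sum_homogeneousComponent r]
    rw [← sum_sub_distrib]
    exact J.sum_mem fun d _ => hyJ d

end lemG

section nagata
variable {K : Type} [Field K]

theorem artin_tate_sub {T : Type} [CommRing T] [Algebra K T] (C E : Subalgebra K T) (h : C ≤ E)
    (hE : E.FG) (hi : ∀ x ∈ E, IsIntegral C x) : C.FG := by
  letI := (Subalgebra.inclusion h).toAlgebra
  haveI : IsScalarTower K C E := IsScalarTower.of_algebraMap_eq' rfl
  haveI : Algebra.FiniteType K E := E.fg_iff_finiteType.1 hE
  haveI : Algebra.FiniteType C E := Algebra.FiniteType.of_restrictScalars_finiteType K C E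
  haveI : IsScalarTower C E T := IsScalarTower.of_algebraMap_eq' rfl
  haveI : Algebra.IsIntegral C E := ⟨fun x => by
    have := hi x x.2
    exact (isIntegral_algebraMap_iff (A := E) (B := T) Subtype.val_injective).1 this⟩
  haveI : Module.Finite C E := Algebra.IsIntegral.finite
  exact C.fg_top.1 (fg_of_fg_of_fg K C E (Algebra.FiniteType.out) (Module.Finite.fg_top)
    (Subalgebra.inclusion_injective h))

theorem fin_gens {S : Type} [CommRing S] [Algebra K S] (R E : Subalgebra K S) (h : R ≤ E)
    (J : Ideal S) (hE : (E.map (Ideal.Quotient.mkₐ K J)).FG)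
    (hi : ∀ x ∈ E, IsIntegral (R.map (Ideal.Quotient.mkₐ K J)) (Ideal.Quotient.mkₐ K J x)) :
    ∃ G : Finset S, (∀ g ∈ G, g ∈ E) ∧ ∀ s ∈ E, ∃ c : S → S, (∀ g, c g ∈ R) ∧
      s - ∑ g ∈ G, c g * g ∈ J := by
  classical
  set π := Ideal.Quotient.mkₐ K J
  have hle : R.map π ≤ E.map π := Subalgebra.map_mono h
  letI := (Subalgebra.inclusion hle).toAlgebra
  haveI : IsScalarTower K (R.map π) (E.map π) := IsScalarTower.of_algebraMap_eq' rfl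
  haveI : Algebra.FiniteType K (E.map π) := (E.map π).fg_iff_finiteType.1 hE
  haveI : Algebra.FiniteType (R.map π) (E.map π) :=
    Algebra.FiniteType.of_restrictScalars_finiteType K _ _
  haveI : IsScalarTower (R.map π) (E.map π) (S ⧸ J) := IsScalarTower.of_algebraMap_eq' rfl
  haveI : Algebra.IsIntegral (R.map π) (E.map π) := ⟨by
    rintro ⟨_, x, hx, rfl⟩
    exact (isIntegral_algebraMap_iff (A := E.map π) (B := S ⧸ J) Subtype.val_injective).1 (hi x hx)⟩
  haveI : Module.Finite (R.map π) (E.map π) := Algebra.IsIntegral.finite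
  obtain ⟨n, w, hw⟩ := Module.Finite.exists_fin (R := R.map π) (M := E.map π)
  choose g hg hgw using fun i => (w i).2
  refine ⟨univ.image g, ?_, ?_⟩
  · intro x hx
    obtain ⟨i, _, rfl⟩ := mem_image.1 hx
    exact hg i
  · intro s hs
    have hs' : (⟨π s, s, hs, rfl⟩ : E.map π) ∈ Submodule.span (R.map π) (Set.range w) := by
      rw [hw]; trivial
    obtain ⟨c, hc⟩ := (Submodule.mem_span_range_iff_exists_fun _).1 hs'
    choose r hr hrc using fun i => (c i).2
    refine ⟨fun x => ∑ i with g i = x, r i, fun x => Subalgebra.sum_mem _ fun i _ => hr i, ?_⟩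
    rw [← Ideal.Quotient.mk_eq_mk_iff_sub_mem]
    have e1 : ∑ x ∈ univ.image g, (∑ i with g i = x, r i) * x = ∑ i, r i * g i := by
      rw [← Finset.sum_fiberwise_of_maps_to (s := univ) (t := univ.image g) (g := g)
        (fun i _ => Finset.mem_image_of_mem g (mem_univ i))]
      refine sum_congr rfl fun x _ => ?_
      rw [Finset.sum_mul]
      refine sum_congr rfl fun i hi => ?_
      rw [(Finset.mem_filter.1 hi).2]
    rw [e1]
    have e2 := congrArg Subtype.val hc
    refine e2.symm.trans ?_
    rw [map_sum, AddSubmonoidClass.coe_finset_sum]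
    refine sum_congr rfl fun i _ => ?_
    have h1 : Ideal.Quotient.mk J (r i) = (c i).1 := hrc i
    have h2 : Ideal.Quotient.mk J (g i) = (w i).1 := hgw i
    rw [map_mul, h1, h2]; rfl

theorem nagata {S : Type} [CommRing S] [Algebra K S] [IsNoetherianRing S] (R : Subalgebra K S)
    (ε : S →ₐ[K] K) (𝒥 : Ideal S → Prop) (Rh : Ideal S → Subalgebra K S)
    (hR : ∀ J, 𝒥 J → R ≤ Rh J) (hmono : ∀ J J', J ≤ J' → Rh J ≤ Rh J')
    (hJR : ∀ J, 𝒥 J → ∀ x ∈ J, x ∈ Rh J)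
    (hINT : ∀ J, 𝒥 J → ∀ s ∈ Rh J,
      IsIntegral (R.map (Ideal.Quotient.mkₐ K J)) (Ideal.Quotient.mkₐ K J s))
    (hELT : ∀ J, 𝒥 J → (∀ s ∈ Rh J, ∃ k : K, s - algebraMap K S k ∈ J) ∨
      ∃ a J', a ∉ J ∧ a ∈ Rh J ∧ ε a = 0 ∧ 𝒥 (J ⊔ Ideal.span {a}) ∧ 𝒥 J' ∧ J ≤ J' ∧
        (∀ s ∈ J', a * s ∈ J) ∧ ∀ s, a * s ∈ Rh J ↔ s ∈ Rh J')
    (hG : ∀ J, 𝒥 J → ∀ F : Finset S, (∀ f ∈ F, f ∈ Rh J ∧ ε f = 0) →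
      (∀ r ∈ Rh J, ε r = 0 → ∃ c : S → S, (∀ f, c f ∈ Rh J) ∧ r - ∑ f ∈ F, c f * f ∈ J) →
      ((Rh J).map (Ideal.Quotient.mkₐ K J)).FG) (J : Ideal S) (hJ : 𝒥 J) :
    ((Rh J).map (Ideal.Quotient.mkₐ K J)).FG := by
  classical
  induction J using WellFoundedGT.induction with
  | _ J ih =>
  rcases hELT J hJ with h | ⟨a, J', haJ, haR, hea, h1, h2, hJJ', haJ', hcol⟩
  · have : (Rh J).map (Ideal.Quotient.mkₐ K J) = ⊥ := by
      rw [eq_bot_iff]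
      rintro _ ⟨s, hs, rfl⟩
      obtain ⟨k, hk⟩ := h s hs
      exact ⟨k, ((Ideal.Quotient.mk_eq_mk_iff_sub_mem _ _).2 hk).symm⟩
    rw [this]; exact Subalgebra.fg_bot
  · set J1 := J ⊔ Ideal.span {a} with hJ1
    have hlt : J < J1 := by
      refine lt_of_le_of_ne le_sup_left fun h => haJ ?_
      rw [h]; exact (le_sup_right : _ ≤ J1) (Ideal.mem_span_singleton_self a)
    have hE := ih J1 hlt h1
    set π := Ideal.Quotient.mkₐ K J1
    have hC : ((Rh J).map π).FG := by
      refine artin_tate_sub _ _ (Subalgebra.map_mono (hmono _ _ hlt.le)) hE ?_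
      rintro _ ⟨s, hs, rfl⟩
      have h3 := hINT J1 h1 s hs
      have hle : R.map π ≤ (Rh J).map π := Subalgebra.map_mono (hR J hJ)
      letI := (Subalgebra.inclusion hle).toAlgebra
      haveI : IsScalarTower (R.map π) ((Rh J).map π) (S ⧸ J1) := IsScalarTower.of_algebraMap_eq' rfl
      exact h3.tower_top
    haveI : IsNoetherianRing ((Rh J).map π) := isNoetherianRing_of_fg hC
    let φ : Rh J →+* (Rh J).map π := ((π.comp (Rh J).val).codRestrict ((Rh J).map π)
      (fun x => ⟨x.1, x.2, rfl⟩)).toRingHom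
    have hφ : Function.Surjective φ := by
      rintro ⟨_, x, hx, rfl⟩; exact ⟨⟨x, hx⟩, rfl⟩
    let m : Ideal (Rh J) := RingHom.ker ((ε.comp (Rh J).val).toRingHom)
    obtain ⟨F0, hF0, hF0s⟩ := Submodule.fg_span_iff_fg_span_finset_subset (R := (Rh J).map π) (φ '' m) |>.1
      (IsNoetherian.noetherian (Ideal.map φ m))
    have hF0' : ∀ y ∈ F0, ∃ x : Rh J, x ∈ m ∧ φ x = y := fun y hy => hF0 hy
    choose! f hfm hfy using hF0'
    obtain ⟨G, hG1, hG2⟩ : ∃ G : Finset S, (∀ g ∈ G, g ∈ Rh J') ∧ ∀ s ∈ Rh J', ∃ c : S → S,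
        (∀ g, c g ∈ Rh J) ∧ s - ∑ g ∈ G, c g * g ∈ J' := by
      by_cases hJe : J' = J
      · subst hJe
        refine ⟨{1}, by simp [Subalgebra.one_mem], fun s hs => ⟨fun _ => s, fun _ => hs, by simp⟩⟩
      · have hJlt : J < J' := lt_of_le_of_ne hJJ' (Ne.symm hJe)
        obtain ⟨G, hG1, hG2⟩ := fin_gens R (Rh J') (hR _ h2) J' (ih J' hJlt h2) (hINT J' h2)
        refine ⟨G, hG1, fun s hs => ?_⟩
        obtain ⟨c, hc, hc'⟩ := hG2 s hs
        exact ⟨c, fun g => hR J hJ (hc g), hc'⟩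
    have hsumJ : ∀ (ι : Type) (t : Finset ι) (u v : ι → S), ∃ w : S → S, 
        (∀ T : Subalgebra K S, (∀ i ∈ t, u i ∈ T) → ∀ x, w x ∈ T) ∧
        ∑ i ∈ t, u i * v i = ∑ x ∈ t.image v, w x * x := by
      intro ι t u v
      refine ⟨fun x => ∑ i ∈ t with v i = x, u i, fun T hT x => Subalgebra.sum_mem _ fun i hi =>
        hT i (Finset.mem_filter.1 hi).1, ?_⟩
      rw [← Finset.sum_fiberwise_of_maps_to (s := t) (t := t.image v) (g := v)
        (fun i hi => Finset.mem_image_of_mem v hi)]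
      refine sum_congr rfl fun x _ => ?_
      rw [Finset.sum_mul]
      refine sum_congr rfl fun i hi => ?_
      rw [(Finset.mem_filter.1 hi).2]
    refine hG J hJ ((F0.disjSum G).image (Sum.elim (fun y => (f y : S)) (fun g => a * g))) ?_ ?_
    · intro x hx
      obtain ⟨i, hi, rfl⟩ := mem_image.1 hx
      rcases Finset.mem_disjSum.1 hi with ⟨y, hy, rfl⟩ | ⟨g, hg, rfl⟩
      · exact ⟨(f y).2, hfm y hy⟩
      · refine ⟨(hcol g).2 (hG1 g hg), ?_⟩
        show ε (a * g) = 0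
        rw [map_mul, hea, zero_mul]
    · intro r hr her
      have hrm : φ ⟨r, hr⟩ ∈ Submodule.span ((Rh J).map π) (F0 : Set ((Rh J).map π)) := by
        rw [← hF0s]
        exact Ideal.mem_map_of_mem φ (show (⟨r, hr⟩ : Rh J) ∈ m from her)
      obtain ⟨c0, hc0⟩ := Submodule.mem_span_finset'.1 hrm
      choose c hc using fun y => hφ (c0 y)
      have h4 : r - ∑ y : F0, (c y : S) * (f y : S) ∈ J1 := by
        rw [← Ideal.Quotient.mk_eq_mk_iff_sub_mem]
        have e2 := congrArg Subtype.val hc0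
        refine e2.symm.trans ?_
        rw [map_sum, AddSubmonoidClass.coe_finset_sum]
        refine sum_congr rfl fun y _ => ?_
        have h1 : Ideal.Quotient.mk J1 (c y : S) = (c0 y).1 := congrArg Subtype.val (hc y)
        have h2 : Ideal.Quotient.mk J1 (f y : S) = (y : (Rh J).map π).1 :=
          congrArg Subtype.val (hfy y y.2)
        rw [map_mul, h1, h2]; rfl
      obtain ⟨j, hj, z, hz, hjz⟩ := Submodule.mem_sup.1 h4
      obtain ⟨s, rfl⟩ := Ideal.mem_span_singleton'.1 hz
      have hsR : s ∈ Rh J' := by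
        rw [← hcol]
        have : a * s = r - ∑ y : F0, (c y : S) * (f y : S) - j := by rw [← hjz]; ring
        rw [this]
        exact Subalgebra.sub_mem _ (Subalgebra.sub_mem _ hr (Subalgebra.sum_mem _ fun y _ =>
          Subalgebra.mul_mem _ (c y).2 (f y).2)) (hJR J hJ j hj)
      obtain ⟨c', hc', hc'J⟩ := hG2 s hsR
      obtain ⟨w, hw1, hw2⟩ := hsumJ _ (F0.disjSum G) (Sum.elim
        (fun y => if h : y ∈ F0 then (c ⟨y, h⟩ : S) else 0) c')
        (Sum.elim (fun y => (f y : S)) (fun g => a * g))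
      refine ⟨w, hw1 _ ?_, ?_⟩
      · rintro (y | g) hi
        · simp only [Sum.elim_inl]; split_ifs
          · exact (c _).2
          · exact Subalgebra.zero_mem _
        · exact hc' g
      · rw [← hw2, Finset.sum_disjSum]
        simp only [Sum.elim_inl, Sum.elim_inr]
        have e3 : ∑ y ∈ F0, (if h : y ∈ F0 then (c ⟨y, h⟩ : S) else 0) * (f y : S)
            = ∑ y : F0, (c y : S) * (f y : S) := by
          rw [← Finset.sum_coe_sort]
          refine sum_congr rfl fun y _ => ?_
          simp
        have e4 : ∑ g ∈ G, c' g * (a * g) = a * ∑ g ∈ G, c' g * g := by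
          rw [Finset.mul_sum]; exact sum_congr rfl fun _ _ => by ring
        rw [e3, e4]
        have : r - (∑ y : F0, (c y : S) * (f y : S) + a * ∑ g ∈ G, c' g * g)
          = j + a * (s - ∑ g ∈ G, c' g * g) := by
          have : r = j + s * a + ∑ y : F0, (c y : S) * (f y : S) := by rw [hjz]; ring
          rw [this]; ring
        rw [this]
        exact J.add_mem hj (haJ' _ hc'J)
end nagata

section stab
variable {K : Type} [Field K] {Q0 Q1 : Type} {ta ha : Q1 → Q0} {α : Q0 → ℕ}
  [Fintype Q0] [DecidableEq Q0]

def IsGL (g : GM α K) : Prop := ∀ b, (g b).det ≠ 0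
def IsSL (g : GM α K) : Prop := ∀ b, (g b).det = 1

theorem IsSL.gl {g : GM α K} (h : IsSL g) : IsGL g := fun b => by rw [h b]; exact one_ne_zero

structure Jok (J : Ideal SK) : Prop where
  st : ∀ g : GM α K, IsGL g → ∀ s ∈ J, act g s ∈ J
  hc : ∀ s ∈ J, ∀ d, homogeneousComponent d s ∈ J

def Rhat (J : Ideal SK) :
    Subalgebra K SK where
  carrier := {s | ∀ g : GM α K, IsSL g → act g s - s ∈ J}
  mul_mem' := by
    intro s t hs ht g hg
    have : act g (s * t) - s * t = act g s * (act g t - t) + (act g s - s) * t := by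
      rw [map_mul]; ring
    rw [this]
    exact J.add_mem (J.mul_mem_left _ (ht g hg)) (J.mul_mem_right _ (hs g hg))
  add_mem' := by
    intro s t hs ht g hg
    have : act g (s + t) - (s + t) = (act g s - s) + (act g t - t) := by
      rw [map_add]; ring
    rw [this]
    exact J.add_mem (hs g hg) (ht g hg)
  algebraMap_mem' := by
    intro c g hg
    rw [AlgHom.commutes, sub_self]; exact J.zero_mem

theorem mem_Rhat (J : Ideal SK) (s : SK) :
    s ∈ Rhat J ↔ ∀ g : GM α K, IsSL g → act g s - s ∈ J := Iff.rfl

def delt (g : GM α K) (j : Q0 →₀ ℕ) : K := ∏ b, (g b).det ^ j b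

def SemiInv (J : Ideal SK) (j : Q0 →₀ ℕ)
    (a : SK) : Prop :=
  ∀ g : GM α K, IsGL g → act g a - C (delt g j) * a ∈ J

noncomputable def dg {B : Type} [CommRing B] (t : Q0 → B) : GM α B :=
  fun b => diagonal fun i => if i.val = 0 then t b else 1

theorem det_dg {B : Type} [CommRing B] (t : Q0 → B) (b : Q0) (h : 0 < α b) :
    (dg (α := α) t b).det = t b := by
  rw [dg, det_diagonal, prod_eq_single (⟨0, h⟩ : Fin (α b))]
  · simp
  · intro i _ hi
    rw [if_neg]; intro h0; exact hi (Fin.ext h0)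
  · simp

theorem dg_one : dg (α := α) (fun _ => (1 : K)) = 1 := by
  funext b; simp [dg]

noncomputable def FF (s : SK) :
    MP Q0 SK :=
  aeval (cj (dg (X : Q0 → MP Q0 SK)) (fun v : VQ => C (X v))) s

theorem eval_FF (t : Q0 → K) (s : SK) :
    eval (fun b => algebraMap K SK (t b)) (FF s) = act (dg t) s := by
  rw [FF, map_aeval_cj, act]
  · have e1 : gmap (eval fun b => algebraMap K SK (t b)) (dg X)
        = gmap C (dg (α := α) t) := by
      funext b; ext1 i j
      simp only [gmap, dg, Matrix.map_apply, diagonal_apply]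
      split_ifs <;> simp [MvPolynomial.algebraMap_eq]
    have e2 : (fun v => eval (fun b => algebraMap K SK (t b))
        (C (X v))) = (X : VQ → SK) := by
      funext v; rw [eval_C]
    rw [e1, e2]
  · intro c
    exact eval_C _

theorem act_FF {J : Ideal SK} (hJ : Jok J)
    {s : SK} (hs : s ∈ Rhat J) (g : GM α K) (hg : IsGL g) :
    act g s - act (dg fun b => (g b).det) s ∈ J := by
  set t : Q0 → K := fun b => (g b).det
  set g' : GM α K := g * dg (fun b => (t b)⁻¹) with hg'
  have h1 : g = g' * dg t := by
    funext b
    rw [hg', Pi.mul_apply, Pi.mul_apply, mul_assoc, dg, dg, diagonal_mul_diagonal]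
    have : (fun i : Fin (α b) => (if i.val = 0 then (t b)⁻¹ else 1) * if i.val = 0 then t b else 1)
      = fun _ => 1 := by
      funext i; split_ifs
      · exact inv_mul_cancel₀ (hg b)
      · simp
    rw [this]; simp
  have h2 : IsSL g' := by
    intro b
    rcases Nat.eq_zero_or_pos (α b) with h | h
    · haveI : IsEmpty (Fin (α b)) := by rw [h]; infer_instance
      exact det_isEmpty
    · rw [hg', Pi.mul_apply, det_mul, det_dg _ _ h]; exact mul_inv_cancel₀ (hg b)
  have h3 : IsGL (dg (α := α) t) := by
    intro b
    rcases Nat.eq_zero_or_pos (α b) with h | h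
    · haveI : IsEmpty (Fin (α b)) := by rw [h]; infer_instance
      rw [det_isEmpty]; exact one_ne_zero
    · rw [det_dg _ _ h]; exact hg b
  have h4 := hJ.st _ h3 _ (hs g' h2)
  rw [map_sub, act_act, ← h1] at h4
  exact h4

theorem semi_FF [Infinite K] {J : Ideal SK} (hJ : Jok J)
    {s : SK} (hs : s ∈ Rhat J) (j : Q0 →₀ ℕ) :
    SemiInv J j (coeff j (FF s)) := by
  classical
  intro u hu
  set G : MP Q0 SK := ∑ i ∈ (FF s).support,
    monomial i (act u (coeff i (FF s)) - C (delt u i) * coeff i (FF s)) with hGdef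
  have hG : ∀ i, coeff i G = act u (coeff i (FF s)) - C (delt u i) * coeff i (FF s) := by
    intro i
    rw [hGdef, coeff_sum]
    simp only [coeff_monomial]
    rw [Finset.sum_ite_eq']
    split_ifs with h1
    · rfl
    · rw [notMem_support_iff.1 h1, map_zero, mul_zero, sub_zero]
  rw [← hG]
  refine density (J.restrictScalars K) G (∏ b, X b) (prod_ne_zero_iff.2 fun b _ => X_ne_zero b) ?_ j
  intro t ht
  rw [map_prod, prod_ne_zero_iff] at ht
  simp only [eval_X] at ht
  have e1 : eval (fun b => algebraMap K SK (t b)) G =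
      act u (act (dg t) s) - act (dg fun b => t b * (u b).det) s := by
    rw [← eval_FF, ← eval_FF, hGdef, map_sum, eval_eq', eval_eq', map_sum, ← sum_sub_distrib]
    refine sum_congr rfl fun i _ => ?_
    rw [eval_monomial, map_mul, map_prod, Finsupp.prod_fintype _ _ (fun _ => pow_zero _)]
    simp only [map_pow, AlgHom.commutes, map_mul, mul_pow, prod_mul_distrib]
    rw [delt, map_prod]
    simp only [map_pow, MvPolynomial.algebraMap_eq]
    ring
  rw [e1, act_act]
  have h3 : IsGL (dg (α := α) t * u) := by
    intro b
    rw [Pi.mul_apply, det_mul]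
    refine mul_ne_zero ?_ (hu b)
    rcases Nat.eq_zero_or_pos (α b) with h | h
    · haveI : IsEmpty (Fin (α b)) := by rw [h]; infer_instance
      rw [det_isEmpty]; exact one_ne_zero
    · rw [det_dg _ _ h]; exact ht b (mem_univ b)
  have h4 := act_FF hJ hs _ h3
  have h5 : (dg fun b => ((dg t * u : GM α K) b).det : GM α K) = dg fun b => t b * (u b).det := by
    funext b
    rcases Nat.eq_zero_or_pos (α b) with h | h
    · haveI : IsEmpty (Fin (α b)) := by rw [h]; infer_instance
      exact Subsingleton.elim _ _
    · rw [dg, dg, Pi.mul_apply, det_mul, det_dg _ _ h]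
  rw [h5] at h4
  exact h4

theorem sum_FF (s : SK) :
    s = ∑ j ∈ (FF s).support, coeff j (FF s) := by
  have h := eval_FF (fun _ => (1 : K)) s
  rw [dg_one, act_one, eval_eq'] at h
  simpa using h.symm

theorem elt [Infinite K] (J : Ideal SK) (hJ : Jok J) :
    (∀ s ∈ Rhat J, ∃ k : K, s - algebraMap K _ k ∈ J) ∨
      ∃ a J', a ∉ J ∧ a ∈ Rhat J ∧ constantCoeff a = 0 ∧ Jok (J ⊔ Ideal.span {a}) ∧ Jok J' ∧ J ≤ J' ∧
        (∀ s ∈ J', a * s ∈ J) ∧ ∀ s, a * s ∈ Rhat J ↔ s ∈ Rhat J' := by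
  by_cases hK : (∀ s ∈ Rhat J, ∃ k : K, s - algebraMap K _ k ∈ J)
  · exact Or.inl hK
  right
  push Not at hK
  obtain ⟨s, hs, hsk⟩ := hK
  obtain ⟨d, hd, hds⟩ : ∃ d, 0 < d ∧ homogeneousComponent d s ∉ J := by
    by_contra hcon
    push Not at hcon
    refine hsk (coeff 0 s) ?_
    conv => enter [2, 1]; rw [← sum_homogeneousComponent s]
    rw [Finset.sum_range_succ', homogeneousComponent_zero, MvPolynomial.algebraMap_eq,
      add_sub_cancel_right]
    exact J.sum_mem fun i _ => hcon _ (Nat.succ_pos i)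
  obtain ⟨j, hj⟩ : ∃ j, homogeneousComponent d (coeff j (FF s)) ∉ J := by
    by_contra hcon
    push Not at hcon
    apply hds
    rw [sum_FF s, map_sum]
    exact J.sum_mem fun i _ => hcon i
  set a := homogeneousComponent d (coeff j (FF s)) with ha
  have hah : a.IsHomogeneous d := homogeneousComponent_isHomogeneous _ _
  have hsemi : SemiInv J j a := by
    intro g hg
    have := hJ.hc _ (semi_FF hJ hs j g hg) d
    rw [map_sub, act_hc, homogeneousComponent_C_mul] at this
    exact this
  have hsl : ∀ g : GM α K, IsSL g → act g a - a ∈ J := by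
    intro g hg
    have := hsemi g hg.gl
    have h1 : delt g j = 1 := by
      rw [delt]; exact Finset.prod_eq_one fun b _ => by rw [hg b, one_pow]
    rwa [h1, C_1, one_mul] at this
  refine ⟨a, Submodule.comap (LinearMap.mulLeft _ a) J, hj, hsl, ?_, ⟨?_, ?_⟩, ⟨?_, ?_⟩, ?_, ?_, ?_⟩
  · have h1 := homogeneousComponent_of_mem (m := 0) (n := d) hah
    rw [if_neg (by omega), homogeneousComponent_zero] at h1
    rw [constantCoeff_eq]
    exact (map_eq_zero_iff C (C_injective _ K)).1 h1
  · intro g hg x hx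
    obtain ⟨y, hy, z, hz, rfl⟩ := Submodule.mem_sup.1 hx
    obtain ⟨w, rfl⟩ := Ideal.mem_span_singleton'.1 hz
    have : act g (y + w * a) = act g y + act g w * (act g a - C (delt g j) * a)
      + act g w * C (delt g j) * a := by rw [map_add, map_mul]; ring
    rw [this]
    refine Submodule.add_mem_sup (J.add_mem (hJ.st g hg _ hy) (J.mul_mem_left _ (hsemi g hg))) ?_
    exact Ideal.mul_mem_left _ _ (Ideal.mem_span_singleton_self a)
  · intro x hx n
    obtain ⟨y, hy, z, hz, rfl⟩ := Submodule.mem_sup.1 hx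
    obtain ⟨w, rfl⟩ := Ideal.mem_span_singleton'.1 hz
    rw [map_add, hc_mul_homog _ _ d n hah]
    refine Submodule.add_mem_sup (hJ.hc _ hy n) ?_
    split_ifs
    · exact Ideal.mul_mem_left _ _ (Ideal.mem_span_singleton_self a)
    · exact Submodule.zero_mem _
  · intro g hg x hx
    have hx : a * x ∈ J := hx
    show a * act g x ∈ J
    have hδ : delt g j ≠ 0 := by
      rw [delt]; exact prod_ne_zero_iff.2 fun b _ => pow_ne_zero _ (hg b)
    have h1 := J.sub_mem (hJ.st g hg _ hx) (J.mul_mem_right (act g x) (hsemi g hg))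
    have h2 := J.mul_mem_left (C (delt g j)⁻¹) h1
    have : C (delt g j)⁻¹ * (act g (a * x) - (act g a - C (delt g j) * a) * act g x)
      = C ((delt g j)⁻¹ * delt g j) * (a * act g x) := by rw [map_mul, C_mul]; ring
    rwa [this, inv_mul_cancel₀ hδ, C_1, one_mul] at h2
  · intro x hx n
    have hx : a * x ∈ J := hx
    show a * homogeneousComponent n x ∈ J
    have := hJ.hc _ hx (n + d)
    rw [mul_comm, hc_mul_homog _ _ d (n + d) hah, if_pos (by omega), Nat.add_sub_cancel] at this
    rwa [mul_comm]
  · intro x hx; exact J.mul_mem_left _ hx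
  · intro x hx; exact hx
  · intro x
    have key : ∀ g : GM α K, IsSL g → (act g (a * x) - a * x ∈ J ↔ a * (act g x - x) ∈ J) := by
      intro g hg
      have : act g (a * x) - a * x = a * (act g x - x) + (act g a - a) * act g x := by
        rw [map_mul]; ring
      rw [this]
      exact Submodule.add_mem_iff_left _ (J.mul_mem_right _ (hsl g hg))
    exact forall_congr' fun g => forall_congr' fun hg => key g hg

theorem fg_of_int [Infinite K] [Finite Q1]
    (hINT : ∀ J : Ideal SK, Jok J → ∀ j s, SemiInv J j s →
      IsIntegral ((QS).map (Ideal.Quotient.mkₐ K J))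
        (Ideal.Quotient.mkₐ K J s)) : (QS).FG := by
  set R := QS with hRdef
  have hbot : Jok (⊥ : Ideal SK) :=
    ⟨fun g _ s hs => by rw [Ideal.mem_bot] at hs ⊢; rw [hs, map_zero],
     fun s hs d => by rw [Ideal.mem_bot] at hs ⊢; rw [hs, map_zero]⟩
  have hle : ∀ J : Ideal SK, R ≤ Rhat J := by
    intro J s hs g hg
    rw [hRdef, mem_SL] at hs
    rw [hs g hg, sub_self]; exact J.zero_mem
  have hε : ∀ r : SK, aeval (fun _ => (0 : K)) r = coeff 0 r := by
    intro r; simp [MvPolynomial.aeval_zero', constantCoeff_eq]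
  have h := nagata R (aeval (fun _ => (0 : K))) Jok Rhat (fun J _ => hle J)
    (fun J J' h s hs g hg => h (hs g hg))
    (fun J hJ x hx g hg => J.sub_mem (hJ.st g hg.gl x hx) hx)
    (fun J hJ s hs => by
      rw [sum_FF s, map_sum]
      exact IsIntegral.sum _ fun j _ => hINT J hJ j _ (semi_FF hJ hs j))
    (fun J hJ => by
      rcases elt J hJ with h | ⟨a, J', h1, h2, h3, h4⟩
      · exact Or.inl h
      · refine Or.inr ⟨a, J', h1, h2, ?_, h4⟩
        exact (hε a).trans h3)
    (fun J hJ F hF H => by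
      refine lemG (Rhat J) J ?_ hJ.hc F ?_ ?_
      · intro r hr d g hg
        rw [← act_hc, ← map_sub]; exact hJ.hc _ (hr g hg) d
      · intro f hf
        refine ⟨(hF f hf).1, ?_⟩
        exact (hε f).symm.trans (hF f hf).2
      · intro r hr hr0
        refine H r hr ?_
        exact (hε r).trans hr0) ⊥ hbot
  have hR : Rhat (⊥ : Ideal SK) = R := by
    ext s
    rw [hRdef, mem_SL, mem_Rhat]
    simp only [Ideal.mem_bot, sub_eq_zero]; rfl
  rw [hR] at h
  refine Subalgebra.fg_of_fg_map _ _ ?_ h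
  intro x y hxy
  have := (Ideal.Quotient.mk_eq_mk_iff_sub_mem _ _).1 hxy
  exact sub_eq_zero.1 (Ideal.mem_bot.1 this)
end stab

section boxed
variable {B : Type} [CommRing B] {τ : Type} [Fintype τ] [DecidableEq τ] {q : ℕ}

noncomputable def fe (a : τ → Fin q) : τ →₀ ℕ := Finsupp.equivFunOnFinite.symm fun v => (a v : ℕ)

theorem fe_apply (a : τ → Fin q) (v : τ) : fe a v = (a v : ℕ) := rfl

theorem fe_inj {a a' : τ → Fin q} (h : fe a = fe a') : a = a' := by
  funext v; apply Fin.ext; have := DFunLike.congr_fun h v; simpa [fe_apply] using this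

theorem box_lin (φ : MP τ B →ₗ[B] B) (hφ : ∀ v g, φ (X v ^ q * g) = 0)
    (f : MP τ B) :
    φ f = ∑ a : τ → Fin q, coeff (fe a) f * φ (monomial (fe a) 1) := by
  induction f using MvPolynomial.induction_on' with
  | add f g hf hg => simp only [map_add, hf, hg, coeff_add, add_mul, sum_add_distrib]
  | monomial m c =>
    have hc : (monomial m c : MP τ B) = c • monomial m 1 := by simp [smul_monomial]
    by_cases hm : ∀ v, m v < q
    · set a : τ → Fin q := fun v => ⟨m v, hm v⟩ with ha
      have hfa : fe a = m := by ext v; rfl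
      rw [sum_eq_single a]
      · rw [hfa, coeff_monomial, if_pos rfl, hc, _root_.map_smul, smul_eq_mul]
      · intro a' _ ha'
        rw [coeff_monomial, if_neg, zero_mul]
        intro h; rw [← hfa] at h; exact ha' (fe_inj h.symm)
      · simp
    · push Not at hm
      obtain ⟨v, hv⟩ := hm
      have h1 : (monomial m c : MP τ B) =
          X v ^ q * monomial (m - Finsupp.single v q) c := by
        rw [X_pow_eq_monomial, monomial_mul, one_mul, add_tsub_cancel_of_le]
        simpa using hv
      rw [sum_eq_zero]
      · rw [h1, hφ]
      · intro a _
        rw [coeff_monomial, if_neg, zero_mul]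
        intro h
        have := (a v).2
        rw [← fe_apply a v, ← h] at this; omega

noncomputable def boxM (L : MP τ B →ₐ[B] MP τ B) (q : ℕ) :
    Matrix (τ → Fin q) (τ → Fin q) B :=
  Matrix.of fun c a => coeff (fe c) (L (monomial (fe a) 1))

theorem box_bil (Φ : MP τ B →ₗ[B] MP τ B →ₗ[B] B)
    (h1 : ∀ v g f, Φ (X v ^ q * g) f = 0) (h2 : ∀ v g f, Φ f (X v ^ q * g) = 0)
    (L : MP τ B →ₐ[B] MP τ B) :
    (boxM L q)ᵀ * (Matrix.of fun a a' : τ → Fin q => Φ (monomial (fe a) 1) (monomial (fe a') 1)) *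
      boxM L q = Matrix.of fun a a' : τ → Fin q =>
        Φ (L (monomial (fe a) 1)) (L (monomial (fe a') 1)) := by
  ext a a'
  rw [Matrix.mul_assoc, Matrix.mul_apply, Matrix.of_apply]
  have e1 := box_lin (Φ.flip (L (monomial (fe a') 1))) (fun v g => h1 v g _) (L (monomial (fe a) 1))
  refine Eq.trans ?_ e1.symm
  refine sum_congr rfl fun c _ => ?_
  rw [Matrix.transpose_apply, boxM, Matrix.of_apply]
  congr 1
  have e2 := box_lin (Φ (monomial (fe c) 1)) (fun v g => h2 v g _) (L (monomial (fe a') 1))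
  refine Eq.trans ?_ e2.symm
  rw [Matrix.mul_apply]
  refine sum_congr rfl fun c' _ => ?_
  rw [mul_comm]; rfl

noncomputable def lamL (τ B : Type) [CommRing B] [Fintype τ] (k : ℕ) : MP τ B →ₗ[B] B :=
  MvPolynomial.lcoeff B (topE τ k)

theorem lamL_apply (k : ℕ) (f : MP τ B) : lamL τ B k f = coeff (topE τ k) f := rfl

noncomputable def WW (τ B : Type) [CommRing B] [Fintype τ] [DecidableEq τ] (q : ℕ) :
    Matrix (τ → Fin q) (τ → Fin q) B :=
  Matrix.of fun a a' => lamL τ B (q - 1) (monomial (fe a) 1 * monomial (fe a') 1)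

theorem WW_apply (hq : 0 < q) (a a' : τ → Fin q) :
    WW τ B q a a' = if a = (fun v => (a' v).rev) then 1 else 0 := by
  rw [WW, Matrix.of_apply, lamL_apply, monomial_mul, mul_one, coeff_monomial]
  refine if_congr ?_ rfl rfl
  rw [Finsupp.ext_iff, funext_iff]
  refine forall_congr' fun v => ?_
  rw [Finsupp.add_apply, fe_apply, fe_apply, topE_apply, Fin.ext_iff, Fin.val_rev]
  have := (a v).2; have := (a' v).2
  omega

theorem mul_WW (hq : 0 < q) (M : Matrix (τ → Fin q) (τ → Fin q) B) (a a' : τ → Fin q) :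
    (M * WW τ B q) a a' = M a (fun v => (a' v).rev) := by
  rw [Matrix.mul_apply, sum_eq_single (fun v => (a' v).rev)]
  · rw [WW_apply hq, if_pos rfl, mul_one]
  · intro c _ hc; rw [WW_apply hq, if_neg hc, mul_zero]
  · simp

theorem WW_sq (hq : 0 < q) : WW τ B q * WW τ B q = 1 := by
  ext a a'
  rw [mul_WW hq, WW_apply hq, Matrix.one_apply]
  simp [Fin.rev_rev]

theorem charpoly_box {ι : Type} [Fintype ι] [DecidableEq ι] (T T' W ρ : Matrix ι ι B)
    (hW : W * W = 1) (h1 : ρᵀ * T' * ρ = T) (h2 : ρᵀ * W * ρ = W) :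
    (T' * W).charpoly = (T * W).charpoly := by
  have e1 : (W * ρᵀ * W) * ρ = 1 := by
    rw [Matrix.mul_assoc, Matrix.mul_assoc, ← Matrix.mul_assoc ρᵀ, h2, hW]
  have e2 : ρ * (W * ρᵀ * W) = 1 := mul_eq_one_comm.1 e1
  have e3 : ρ * W * ρᵀ = W := by
    have : ρ * W * ρᵀ * (W * W) = W := by
      rw [← Matrix.mul_assoc, Matrix.mul_assoc (ρ * W), Matrix.mul_assoc ρ, ← Matrix.mul_assoc W,
        e2, one_mul] 
    rwa [hW, mul_one] at this
  rw [← h1, Matrix.mul_assoc, Matrix.mul_assoc, Matrix.charpoly_mul_comm ρᵀ, Matrix.mul_assoc, e3]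

theorem charpoly_eval_mem {ι : Type} [Fintype ι] [DecidableEq ι] (J : Ideal B) (T : Matrix ι ι B)
    (s : B) (i : ι) (h : ∀ a, (if a = i then s else 0) - T a i ∈ J) : T.charpoly.eval s ∈ J := by
  rw [Matrix.eval_charpoly, ← Ideal.Quotient.eq_zero_iff_mem, RingHom.map_det]
  apply Matrix.det_eq_zero_of_column_eq_zero i
  intro a
  rw [RingHom.mapMatrix_apply, Matrix.map_apply, Ideal.Quotient.eq_zero_iff_mem]
  have := h a
  rwa [Matrix.sub_apply, Matrix.scalar_apply, Matrix.diagonal_apply,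
    show (if a = i then s else 0) = (if a = i then s else 0) from rfl]

theorem integral_of_mem {K : Type} [Field K] [Algebra K B] (R : Subalgebra K B) (J : Ideal B)
    (P : Polynomial B) (hP : P.Monic) (hc : ∀ n, P.coeff n ∈ R) (s : B) (hs : P.eval s ∈ J) :
    IsIntegral (R.map (Ideal.Quotient.mkₐ K J)) (Ideal.Quotient.mkₐ K J s) := by
  have hl : P ∈ Polynomial.lifts (R.val.toRingHom) := by
    rw [Polynomial.lifts_iff_coeff_lifts]
    intro n; exact ⟨⟨_, hc n⟩, rfl⟩
  obtain ⟨P', h1, h2, h3⟩ := Polynomial.lifts_and_natDegree_eq_and_monic hl hP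
  let φ : R →+* R.map (Ideal.Quotient.mkₐ K J) :=
    { toFun := fun r => ⟨Ideal.Quotient.mkₐ K J r, ⟨r, r.2, rfl⟩⟩
      map_one' := rfl
      map_mul' := fun _ _ => rfl
      map_zero' := rfl
      map_add' := fun _ _ => rfl }
  refine ⟨P'.map φ, h3.map φ, ?_⟩
  rw [Polynomial.eval₂_map]
  have h4 : (algebraMap (R.map (Ideal.Quotient.mkₐ K J)) (B ⧸ J)).comp φ =
    (Ideal.Quotient.mkₐ K J).toRingHom.comp R.val.toRingHom := rfl
  rw [h4, ← Polynomial.eval₂_map, h1]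
  have h5 := Polynomial.hom_eval₂ P (RingHom.id B) (Ideal.Quotient.mkₐ K J).toRingHom s
  rw [RingHom.comp_id] at h5
  refine h5.symm.trans ?_
  exact Ideal.Quotient.eq_zero_iff_mem.2 hs
end boxed

section INT
variable {K : Type} [Field K] {Q0 Q1 : Type} {ta ha : Q1 → Q0} {α : Q0 → ℕ}
  [Fintype Q0] [DecidableEq Q0]

abbrev mu1 (α : Q0 → ℕ) : Q0 → ℕ := fun b => α b - 1

def em1 (v : XX (mu1 α) α) : XX α α := ⟨v.1, (⟨v.2.1.val, by have := v.2.1.2; simp only [mu1] at this; omega⟩, v.2.2)⟩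
def em2 (v : XX (mu1 α) α) : XX α α := ⟨v.1, (⟨v.2.1.val + 1, by have := v.2.1.2; simp only [mu1] at this; omega⟩, v.2.2)⟩

theorem em1_inj : Function.Injective (em1 (α := α)) := by
  rintro ⟨b, ⟨i, hi⟩, c⟩ ⟨b', ⟨i', hi'⟩, c'⟩ h
  simp only [em1, Sigma.mk.injEq] at h
  obtain ⟨rfl, h⟩ := h
  simp at h
  simp [h]

theorem em2_inj : Function.Injective (em2 (α := α)) := by
  rintro ⟨b, ⟨i, hi⟩, c⟩ ⟨b', ⟨i', hi'⟩, c'⟩ h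
  simp only [em2, Sigma.mk.injEq] at h
  obtain ⟨rfl, h⟩ := h
  simp at h
  simp [h]

theorem em1_ok (b : Q0) (i : Fin (mu1 α b)) :
    ∃ i' : Fin (α b), ∀ c : Fin (α b), em1 ⟨b, (i, c)⟩ = (⟨b, (i', c)⟩ : XX α α) :=
  ⟨⟨i.val, by have := i.2; simp only [mu1] at this; omega⟩, fun c => rfl⟩
theorem em2_ok (b : Q0) (i : Fin (mu1 α b)) :
    ∃ i' : Fin (α b), ∀ c : Fin (α b), em2 ⟨b, (i, c)⟩ = (⟨b, (i', c)⟩ : XX α α) :=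
  ⟨⟨i.val + 1, by have := i.2; simp only [mu1] at this; omega⟩, fun c => rfl⟩

theorem rename_lsub {B : Type} [CommRing B] [Algebra K B] (e : XX (mu1 α) α → XX α α)
    (he : ∀ b i, ∃ i', ∀ c, e ⟨b, (i, c)⟩ = ⟨b, (i', c)⟩)
    (g : GM α K) (f : MP (XX (mu1 α) α) B) :
    rename e (lsub B (rmat (mu1 α) g) f) = lsub B (rmat α g) (rename e f) := by
  have : ((rename e : _ →ₐ[B] MP (XX α α) B)).comp (lsub B (rmat (mu1 α) g)) =
      (lsub B (rmat α g)).comp (rename e) := by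
    apply MvPolynomial.algHom_ext
    rintro ⟨b, i, c⟩
    obtain ⟨i', hi'⟩ := he b i
    rw [AlgHom.comp_apply, AlgHom.comp_apply, rename_X, hi', lsub_rmat, lsub_rmat, map_sum]
    refine sum_congr rfl fun k _ => ?_
    rw [map_mul, rename_X, rename_C, hi']
  exact DFunLike.congr_fun this f

variable {B : Type} [CommRing B]

noncomputable def bigT (P : MP (XX α α) B) (k : ℕ) :
    MP (XX (mu1 α) α) B →ₗ[B] MP (XX (mu1 α) α) B →ₗ[B] B :=
  LinearMap.mk₂ B (fun f f' => lamL (XX α α) B k (P * rename em1 f * rename em2 f'))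
    (fun f g f' => by rw [map_add, mul_add, add_mul, map_add])
    (fun c f f' => by rw [_root_.map_smul, mul_smul_comm, smul_mul_assoc, _root_.map_smul])
    (fun f g f' => by rw [map_add, mul_add, map_add])
    (fun c f f' => by rw [_root_.map_smul, mul_smul_comm, _root_.map_smul])

theorem bigT_apply (P : MP (XX α α) B) (k : ℕ) (f f' : MP (XX (mu1 α) α) B) :
    bigT P k f f' = coeff (topE _ k) (P * rename em1 f * rename em2 f') := rfl

theorem bigT_kill1 {q : ℕ} (hq : 0 < q) (P : MP (XX α α) B) (v) (g f) :
    bigT P (q - 1) (X v ^ q * g) f = 0 := by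
  rw [bigT_apply, map_mul, map_pow, rename_X]
  have : P * (X (em1 v) ^ q * rename em1 g) * rename em2 f =
    X (em1 v) ^ q * (P * rename em1 g * rename em2 f) := by ring
  rw [this]; exact coeff_top_X_pow_mul (by omega) _ _

theorem bigT_kill2 {q : ℕ} (hq : 0 < q) (P : MP (XX α α) B) (v) (g f) :
    bigT P (q - 1) f (X v ^ q * g) = 0 := by
  rw [bigT_apply, map_mul, map_pow, rename_X]
  have : P * rename em1 f * (X (em2 v) ^ q * rename em2 g) =
    X (em2 v) ^ q * (P * rename em1 f * rename em2 g) := by ring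
  rw [this]; exact coeff_top_X_pow_mul (by omega) _ _

noncomputable def bigW (k : ℕ) :
    MP (XX (mu1 α) α) B →ₗ[B] MP (XX (mu1 α) α) B →ₗ[B] B :=
  LinearMap.mk₂ B (fun f f' => lamL (XX (mu1 α) α) B k (f * f'))
    (fun f g f' => by rw [add_mul, map_add])
    (fun c f f' => by rw [smul_mul_assoc, _root_.map_smul])
    (fun f g f' => by rw [mul_add, map_add])
    (fun c f f' => by rw [mul_smul_comm, _root_.map_smul])

theorem bigW_apply (k : ℕ) (f f' : MP (XX (mu1 α) α) B) :
    bigW k f f' = coeff (topE _ k) (f * f') := rfl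

noncomputable def matT (P : MP (XX α α) B) (q : ℕ) :
    Matrix (XX (mu1 α) α → Fin q) (XX (mu1 α) α → Fin q) B :=
  Matrix.of fun a a' => bigT P (q - 1) (monomial (fe a) 1) (monomial (fe a') 1)

theorem charpoly_inv [Algebra K B] (p n : ℕ) [Fact p.Prime] [CharP K p] (g : GM α K) (hg : IsSL g)
    (P : MP (XX α α) B) :
    (matT (lsub B (rmat α g) P) (p ^ n) * WW _ B (p ^ n)).charpoly =
      (matT P (p ^ n) * WW _ B (p ^ n)).charpoly := by
  have hq : 0 < p ^ n := pow_pos (Fact.out : p.Prime).pos n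
  refine charpoly_box _ _ _ (boxM (lsub B (rmat (mu1 α) g)) (p ^ n)) (WW_sq hq) ?_ ?_
  · rw [matT, box_bil _ (bigT_kill1 hq _) (bigT_kill2 hq _), matT]
    congr 1; funext a a'
    rw [bigT_apply, bigT_apply, rename_lsub em1 em1_ok,
      rename_lsub em2 em2_ok, ← map_mul, ← map_mul,
      coeff_top_lsub, det_rmat _ _ hg, one_pow, map_one, one_mul]
  · have := box_bil (bigW (B := B) (α := α) (p ^ n - 1)) (q := p ^ n) (fun v g f => ?_) (fun v g f => ?_)
      (lsub B (rmat (mu1 α) g))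
    · refine this.trans ?_
      rw [WW]; congr 1; funext a a'
      rw [bigW_apply, lamL_apply, ← map_mul,
        coeff_top_lsub, det_rmat _ _ hg, one_pow, map_one, one_mul]
    · rw [bigW_apply, mul_assoc]; exact coeff_top_X_pow_mul (by omega) _ _
    · rw [bigW_apply, mul_left_comm]; exact coeff_top_X_pow_mul (by omega) _ _

theorem matT_map {B' : Type} [CommRing B'] (φ : B →+* B') (P : MP (XX α α) B) (q : ℕ) :
    matT (MvPolynomial.map φ P) q = (matT P q).map φ := by
  ext a a'
  rw [Matrix.map_apply, matT, matT, Matrix.of_apply, Matrix.of_apply, bigT_apply, bigT_apply,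
    ← MvPolynomial.coeff_map, map_mul, map_mul, MvPolynomial.map_rename, MvPolynomial.map_rename,
    map_monomial, map_monomial, map_one φ]

theorem WW_map {τ B B' : Type} [CommRing B] [CommRing B'] [Fintype τ] [DecidableEq τ] (φ : B →+* B')
    (q : ℕ) (hq : 0 < q) : (WW τ B q).map φ = WW τ B' q := by
  ext a a'
  rw [Matrix.map_apply, WW_apply hq, WW_apply hq]; split_ifs <;> simp

theorem charpoly_coeff_mem [Infinite K] (p n : ℕ) [Fact p.Prime] [CharP K p]
    (P : MP (XX α α) SK)
    (hP : ∀ g : GM α K, IsSL g → MvPolynomial.map (act g : SK →ₐ[K] _).toRingHom P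
      = lsub _ (rmat α g) P) (i : ℕ) :
    (matT P (p ^ n) * WW _ _ (p ^ n)).charpoly.coeff i ∈ QS := by
  have hq : 0 < p ^ n := pow_pos (Fact.out : p.Prime).pos n
  rw [mem_SL]
  intro g hg
  have h1 : act g ((matT P (p ^ n) * WW _ _ (p ^ n)).charpoly.coeff i) =
    (((matT P (p ^ n) * WW _ _ (p ^ n)).charpoly).map (act g : SK →ₐ[K] _).toRingHom).coeff i := by
    rw [Polynomial.coeff_map]; rfl
  rw [h1, ← Matrix.charpoly_map, Matrix.map_mul, ← matT_map, WW_map _ _ hq, hP g hg,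
    charpoly_inv p n g hg]

end INT

section INT
variable {K : Type} [Field K] {Q0 Q1 : Type} {ta ha : Q1 → Q0} {α : Q0 → ℕ}
  [Fintype Q0] [DecidableEq Q0] {B : Type} [CommRing B]

noncomputable def qI (τ B : Type) [CommRing B] (q : ℕ) : Ideal (MP τ B) :=
  Ideal.span (Set.range fun v : τ => X v ^ q)

theorem coeff_top_qI {τ : Type} [Fintype τ] {q : ℕ} (hq : 0 < q) {f : MP τ B} (hf : f ∈ qI τ B q) :
    coeff (topE τ (q - 1)) f = 0 := by
  classical
  obtain ⟨c, rfl⟩ := Ideal.mem_span_range_iff_exists_fun.1 hf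
  rw [coeff_sum]
  refine sum_eq_zero fun v _ => ?_
  rw [mul_comm]
  exact coeff_top_X_pow_mul (by omega) v _

noncomputable def lowP (B : Type) [CommRing B] (α : Q0 → ℕ) (k : ℕ) : MP (XX α α) B :=
  ∏ v : XX α α, X v ^ (if v.2.2 < v.2.1 then k else 0)

theorem lowP_mul_X {q : ℕ} (hq : 0 < q) (b : Q0) (i c : Fin (α b)) (h : c < i) :
    lowP B α (q - 1) * X ⟨b, (i, c)⟩ ∈ qI (XX α α) B q := by
  classical
  rw [lowP, ← mul_prod_erase _ _ (mem_univ (⟨b, (i, c)⟩ : XX α α))]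
  rw [if_pos h, mul_right_comm, ← pow_succ, Nat.sub_add_cancel hq]
  exact Ideal.mul_mem_right _ _ (Ideal.subset_span ⟨_, rfl⟩)

noncomputable def dgP (B : Type) [CommRing B] (α : Q0 → ℕ) (b : Q0) : MP (XX α α) B :=
  ∏ i : Fin (α b), X ⟨b, (i, i)⟩

theorem exists_lt_of_perm {n : ℕ} (σ : Equiv.Perm (Fin n)) (hσ : σ ≠ 1) : ∃ i, σ i < i := by
  by_contra h
  push Not at h
  apply hσ
  have h2 : ∑ i : Fin n, ((σ i : Fin n) : ℕ) = ∑ i : Fin n, (i : ℕ) :=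
    Equiv.sum_comp σ (fun i : Fin n => (i : ℕ))
  have h3 := (Finset.sum_eq_sum_iff_of_le (s := univ) (f := fun i : Fin n => (i : ℕ))
    (g := fun i => ((σ i : Fin n) : ℕ)) (fun i _ => h i)).1 h2.symm
  ext i
  exact (h3 i (mem_univ i)).symm

theorem lowP_mul_det {q : ℕ} (hq : 0 < q) (b : Q0) :
    lowP B α (q - 1) * ((Xi B α b).det - dgP B α b) ∈ qI (XX α α) B q := by
  classical
  rw [← Matrix.det_transpose, Matrix.det_apply, ← Finset.add_sum_erase _ _ (mem_univ (1 : Equiv.Perm (Fin (α b))))]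
  have : (Equiv.Perm.sign (1 : Equiv.Perm (Fin (α b)))) • ∏ i, (Xi B α b)ᵀ ((1 : Equiv.Perm (Fin (α b))) i) i = dgP B α b := by
    simp [dgP, Xi]
  rw [this, add_sub_cancel_left, Finset.mul_sum]
  refine Ideal.sum_mem _ fun σ hσ => ?_
  obtain ⟨i, hi⟩ := exists_lt_of_perm σ (Finset.mem_erase.1 hσ).1
  rw [mul_smul_comm]
  refine Submodule.smul_of_tower_mem _ _ ?_
  rw [← mul_prod_erase _ _ (mem_univ i), ← mul_assoc]
  exact Ideal.mul_mem_right _ _ (lowP_mul_X hq b i (σ i) hi)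

theorem lowP_mul_pow {q : ℕ} (hq : 0 < q) (b : Q0) (m : ℕ) (f : MP (XX α α) B) :
    lowP B α (q - 1) * ((Xi B α b).det ^ m * f) - lowP B α (q - 1) * (dgP B α b ^ m * f)
      ∈ qI (XX α α) B q := by
  obtain ⟨g, hg⟩ := sub_dvd_pow_sub_pow (Xi B α b).det (dgP B α b) m
  have : lowP B α (q - 1) * ((Xi B α b).det ^ m * f) - lowP B α (q - 1) * (dgP B α b ^ m * f) =
    (lowP B α (q - 1) * ((Xi B α b).det - dgP B α b)) * (g * f) := by
    rw [← mul_sub, ← sub_mul, hg]; ring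
  rw [this]
  exact Ideal.mul_mem_right _ _ (lowP_mul_det hq b)

theorem lowP_mul_prod {q : ℕ} (hq : 0 < q) (m : ℕ) (T : Finset Q0) (f : MP (XX α α) B) :
    lowP B α (q - 1) * ((∏ b ∈ T, (Xi B α b).det ^ m) * f) -
      lowP B α (q - 1) * ((∏ b ∈ T, dgP B α b ^ m) * f) ∈ qI (XX α α) B q := by
  induction T using Finset.induction_on generalizing f with
  | empty => simp
  | insert b T hb ih =>
    rw [Finset.prod_insert hb, Finset.prod_insert hb]
    have h1 := lowP_mul_pow hq b m ((∏ b ∈ T, (Xi B α b).det ^ m) * f)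
    have h2 := ih (dgP B α b ^ m * f)
    have := Ideal.add_mem _ h1 h2
    convert this using 1
    ring

def hcol (α : Q0 → ℕ) (q : ℕ) (hq : 0 < q) : XX (mu1 α) α → Fin q :=
  fun v => if v.2.2.val ≤ v.2.1.val then ⟨q - 1, by omega⟩ else ⟨0, hq⟩

theorem mon_prod {τ : Type} [Fintype τ] (m : τ →₀ ℕ) :
    (monomial m 1 : MP τ B) = ∏ v, X v ^ m v := by
  rw [monomial_eq, Finsupp.prod_fintype _ _ (by simp), C_1, one_mul]

theorem ren_em2 {q : ℕ} (hq : 0 < q) :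
    rename em2 (monomial (fe (hcol α q hq)) 1) = lowP B α (q - 1) := by
  rw [mon_prod, map_prod, lowP]
  refine Fintype.prod_of_injective em2 em2_inj _ _ ?_ ?_
  · rintro ⟨b, i, c⟩ hv
    rw [if_neg, pow_zero]
    intro hci
    apply hv
    have h1 : c.val < i.val := hci
    have h2 := i.2
    refine ⟨⟨b, (⟨i.val - 1, ?_⟩, c)⟩, ?_⟩
    · simp only [mu1]; omega
    · simp only [em2]
      have : (⟨i.val - 1 + 1, by omega⟩ : Fin (α b)) = i := Fin.ext (by simp; omega)
      rw [this]
  · rintro ⟨b, i, c⟩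
    rw [map_pow, rename_X, fe_apply, hcol]
    congr 1
    show ((if c.val ≤ i.val then (⟨q - 1, by omega⟩ : Fin q) else ⟨0, hq⟩ : Fin q) : ℕ) =
      if (c.val < i.val + 1) then q - 1 else 0
    by_cases h : c.val ≤ i.val
    · rw [if_pos h, if_pos (by omega)]
    · rw [if_neg h, if_neg (by omega)]

theorem dgP_prod (m : ℕ) : ∏ b, dgP B α b ^ m =
    ∏ v : XX α α, X v ^ (if v.2.2 = v.2.1 then m else 0) := by
  rw [Fintype.prod_sigma]
  refine prod_congr rfl fun b _ => ?_
  rw [Fintype.prod_prod_type, dgP, ← Finset.prod_pow]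
  refine prod_congr rfl fun i _ => ?_
  rw [prod_eq_single i]
  · simp
  · intro c _ hc; rw [if_neg hc, pow_zero]
  · simp

theorem ren_em1 (q : ℕ) (a : XX (mu1 α) α → Fin q) :
    rename em1 (monomial (fe a) 1) = ∏ v : XX α α, (X v : MP (XX α α) B) ^
      (if h : v.2.1.val < mu1 α v.1 then (a ⟨v.1, (⟨v.2.1.val, h⟩, v.2.2)⟩ : ℕ) else 0) := by
  rw [mon_prod, map_prod]
  refine Fintype.prod_of_injective em1 em1_inj _ _ ?_ ?_
  · rintro ⟨b, i, c⟩ hv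
    rw [dif_neg, pow_zero]
    intro hci
    exact hv ⟨⟨b, (⟨i.val, hci⟩, c)⟩, rfl⟩
  · rintro ⟨b, i, c⟩
    rw [map_pow, rename_X, fe_apply]
    congr 1
    rw [dif_pos (show (em1 (⟨b, (i, c)⟩ : XX (mu1 α) α)).2.1.val <
      mu1 α (em1 (⟨b, (i, c)⟩ : XX (mu1 α) α)).1 from i.2)]
    rfl

theorem bigT_col {q : ℕ} (hq : 0 < q) (a : XX (mu1 α) α → Fin q) :
    bigT (∏ b, (Xi B α b).det ^ (q - 1)) (q - 1) (monomial (fe a) 1) (monomial (fe (hcol α q hq)) 1)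
      = if a = (fun v => (hcol α q hq v).rev) then 1 else 0 := by
  classical
  rw [bigT_apply, ren_em2, mul_comm]
  have h1 := coeff_top_qI hq (lowP_mul_prod (B := B) (α := α) hq (q - 1) univ (rename em1 (monomial (fe a) 1)))
  rw [coeff_sub, sub_eq_zero] at h1
  rw [h1, dgP_prod, ren_em1, lowP, ← prod_mul_distrib, ← prod_mul_distrib]
  simp only [← pow_add]
  set F : XX α α →₀ ℕ := Finsupp.equivFunOnFinite.symm fun v =>
    (if v.2.2 < v.2.1 then q - 1 else 0) + ((if v.2.2 = v.2.1 then q - 1 else 0) +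
     (if h : v.2.1.val < mu1 α v.1 then (a ⟨v.1, (⟨v.2.1.val, h⟩, v.2.2)⟩ : ℕ) else 0)) with hF
  have h2 := mon_prod (B := B) F
  refine (congrArg (coeff _) h2.symm).trans ?_
  rw [coeff_monomial]
  refine if_congr ?_ rfl rfl
  rw [Finsupp.ext_iff, funext_iff]
  constructor
  · rintro H ⟨b, i, c⟩
    have h4 : (if c.val < i.val then q - 1 else 0) + ((if c.val = i.val then q - 1 else 0) +
        (a ⟨b, (i, c)⟩ : ℕ)) = q - 1 := by
      have := H (em1 ⟨b, (i, c)⟩)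
      rw [hF, topE_apply] at this
      simp only [Finsupp.equivFunOnFinite_symm_apply_apply, Fin.lt_def, Fin.ext_iff] at this
      rw [dif_pos (show (em1 (⟨b, (i, c)⟩ : XX (mu1 α) α)).2.1.val <
        mu1 α (em1 (⟨b, (i, c)⟩ : XX (mu1 α) α)).1 from i.2)] at this
      exact this
    apply Fin.ext
    rw [Fin.val_rev, hcol]
    have h3 := (a ⟨b, (i, c)⟩).2
    rcases lt_trichotomy c.val i.val with h | h | h
    · rw [if_pos h, if_neg (by omega)] at h4
      rw [if_pos (by exact h.le)]; simp only; omega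
    · rw [if_neg (by omega), if_pos h] at h4
      rw [if_pos (by exact h.le)]; simp only; omega
    · rw [if_neg (by omega), if_neg (by omega)] at h4
      rw [if_neg (by simp only; omega)]; simp only; omega
  · rintro H ⟨b, i, c⟩
    rw [hF, topE_apply]
    simp only [Finsupp.equivFunOnFinite_symm_apply_apply, Fin.lt_def, Fin.ext_iff]
    have hi := i.2
    have hc := c.2
    by_cases h : i.val < mu1 α b
    · rw [dif_pos h, H]
      have h5 : ((hcol α q hq ⟨b, (⟨i.val, h⟩, c)⟩).rev : ℕ) = if c.val ≤ i.val then 0 else q - 1 := by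
        rw [Fin.val_rev, hcol]
        by_cases h6 : c.val ≤ i.val
        · rw [if_pos (by exact h6), if_pos h6]; simp only; omega
        · rw [if_neg (by exact h6), if_neg h6]
      rw [h5]
      split_ifs <;> omega
    · rw [dif_neg h]
      simp only [mu1] at h
      split_ifs <;> omega
end INT

section INT
variable {K : Type} [Field K] {Q0 Q1 : Type} {ta ha : Q1 → Q0} {α : Q0 → ℕ}
  [Fintype Q0] [DecidableEq Q0]

theorem Xi_map {B B' : Type} [CommRing B] [CommRing B'] (φ : B →+* B') (b : Q0) :
    MvPolynomial.map φ (Xi B α b).det = (Xi B' α b).det := by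
  rw [RingHom.map_det]; congr 1
  ext1 i j
  simp [Xi]

theorem Xi_lsub {B : Type} [CommRing B] [Algebra K B] (g : GM α K) (b : Q0) :
    lsub B (rmat α g) (Xi B α b).det = (Xi B α b).det * C (algebraMap K B (g b).det) := by
  have h1 : (g b).map (fun x => (C (algebraMap K B x) : MP (XX α α) B)) =
    ((C : B →+* MP (XX α α) B).comp (algebraMap K B)).mapMatrix (g b) := rfl
  have h2 : (C (algebraMap K B (g b).det) : MP (XX α α) B) =
    ((C : B →+* MP (XX α α) B).comp (algebraMap K B)) (g b).det := rfl
  rw [AlgHom.map_det, h2, RingHom.map_det, ← h1, ← Matrix.det_mul]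
  congr 1
  ext1 i j
  rw [AlgHom.mapMatrix_apply, Matrix.map_apply, Matrix.mul_apply]
  exact lsub_rmat α g b i j

theorem Xi_eval {B : Type} [CommRing B] (x : XX α α → B) (b : Q0) :
    eval x (Xi B α b).det = (Matrix.of fun i j => x ⟨b, (i, j)⟩).det := by
  rw [RingHom.map_det]; congr 1
  ext1 i j
  simp [Xi]

theorem semi_del [Infinite K] {J : Ideal SK} {j : Q0 →₀ ℕ}
    {s : SK} (hs : SemiInv J j s) :
    del s - C s * ∏ b, (Xi _ α b).det ^ (j b) ∈ J.map (C : _ →+* MP (XX α α) SK) := by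
  rw [mem_map_C_iff]
  intro m
  refine density (J.restrictScalars K) _ (∏ b, (Xi K α b).det) ?_ ?_ m
  · intro h0
    have := congrArg (eval (gpt (1 : GM α K))) h0
    rw [map_prod, map_zero, Finset.prod_eq_zero_iff] at this
    obtain ⟨b, _, hb⟩ := this
    rw [Xi_eval] at hb
    have h1 : (Matrix.of fun i j => gpt (1 : GM α K) ⟨b, (i, j)⟩) = 1 := rfl
    rw [h1, det_one] at hb; exact one_ne_zero hb
  · intro x hx
    rw [map_prod, prod_ne_zero_iff] at hx
    set g : GM α K := fun b => Matrix.of fun i j => x ⟨b, (i, j)⟩ with hg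
    have hgl : IsGL g := by
      intro b
      have := hx b (mem_univ b)
      rwa [Xi_eval] at this
    have e1 : eval (fun i => algebraMap K SK (x i)) (del s) = act g s :=
      eval_del g s
    have e2 : eval (fun i => algebraMap K SK (x i))
        (C s * ∏ b, (Xi _ α b).det ^ (j b)) = C (delt g j) * s := by
      rw [map_mul, eval_C, map_prod, delt, map_prod, mul_comm]
      congr 1
      refine prod_congr rfl fun b _ => ?_
      rw [map_pow, map_pow, Xi_eval, RingHom.map_det]
      rfl
    rw [map_sub, e1, e2]
    exact hs g hgl

theorem INT_charp [Infinite K] (p : ℕ) [Fact p.Prime] [CharP K p]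
    (J : Ideal SK) (j : Q0 →₀ ℕ) (s : SK)
    (hs : SemiInv J j s) :
    IsIntegral ((QS).map (Ideal.Quotient.mkₐ K J))
        (Ideal.Quotient.mkₐ K J s) := by
  classical
  set n := ∑ b, j b with hn
  have hj : ∀ b, j b < p ^ n := fun b =>
    lt_of_le_of_lt (Finset.single_le_sum (f := fun b => j b) (fun _ _ => Nat.zero_le _) (mem_univ b))
      (Nat.lt_pow_self (Fact.out : p.Prime).one_lt)
  have hq : 0 < p ^ n := pow_pos (Fact.out : p.Prime).pos n
  set q := p ^ n with hqdef
  set P : MP (XX α α) SK := del s * ∏ b, (Xi SK α b).det ^ (q - 1 - j b) with hPdef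
  refine integral_of_mem (K := K) QS J (matT P q * WW _ _ q).charpoly (Matrix.charpoly_monic _) ?_ s ?_
  · intro i
    refine charpoly_coeff_mem p n P ?_ i
    intro g hg
    rw [hPdef, map_mul, map_mul, map_act_del, map_prod, map_prod]
    congr 1
    refine prod_congr rfl fun b _ => ?_
    rw [map_pow, map_pow, Xi_map, Xi_lsub, hg b, map_one, map_one, mul_one]
  · refine charpoly_eval_mem J _ s (fun v => (hcol α q hq v).rev) ?_
    intro a
    rw [mul_WW hq]
    simp only [Fin.rev_rev]
    have h1 : P - C s * ∏ b, (Xi SK α b).det ^ (q - 1) ∈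
        J.map (C : _ →+* MP (XX α α) SK) := by
      have := Ideal.mul_mem_right (∏ b, (Xi SK α b).det ^ (q - 1 - j b)) _ (semi_del hs)
      rw [sub_mul, mul_assoc, ← prod_mul_distrib] at this
      have e : ∀ b, (Xi SK α b).det ^ j b * (Xi SK α b).det ^ (q - 1 - j b) =
          (Xi SK α b).det ^ (q - 1) := by
        intro b; rw [← pow_add]; congr 1; have := hj b; omega
      simpa only [e] using this
    have h2 := bigT_col (B := SK) (α := α) hq a
    have h3 : bigT (C s * ∏ b, (Xi SK α b).det ^ (q - 1)) (q - 1) (monomial (fe a) 1)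
        (monomial (fe (hcol α q hq)) 1) = (if a = fun v => (hcol α q hq v).rev then s else 0) := by
      rw [bigT_apply, mul_assoc, mul_assoc, coeff_C_mul, ← mul_assoc, ← bigT_apply, h2]
      split_ifs <;> simp
    rw [← h3, matT, Matrix.of_apply, bigT_apply, bigT_apply, ← coeff_sub, ← sub_mul, ← sub_mul]
    refine mem_map_C_iff.1 ?_ _
    refine Ideal.mul_mem_right _ _ (Ideal.mul_mem_right _ _ ?_)
    rw [← neg_sub]; exact Submodule.neg_mem _ h1

theorem SL_fg_charp [Infinite K] [Finite Q1] (p : ℕ) [Fact p.Prime] [CharP K p] :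
    (QS).FG :=
  fg_of_int fun J _ j s hs => INT_charp p J j s hs
end INT

section SLgen
variable {K : Type} [Field K]

theorem trm {n m : Type} [Fintype n] [DecidableEq n] {A : Type} [CommRing A] (i j : n) (c : A)
    (M : Matrix n m A) (a : n) (b : m) :
    (transvection i j c * M) a b = M a b + if a = i then c * M j b else 0 := by
  by_cases h : a = i
  · subst h; rw [transvection_mul_apply_same, if_pos rfl]
  · rw [transvection_mul_apply_of_ne _ _ _ _ h, if_neg h, add_zero]

theorem trans_comm {n : Type} [Fintype n] [DecidableEq n] (i m j : n) (c : K) (h1 : i ≠ m) (h2 : m ≠ j)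
    (h3 : i ≠ j) : transvection i j c =
    transvection i m c * (transvection m j 1 * (transvection i m (-c) * (transvection m j (-1) * 1))) := by
  have e : transvection i j c = transvection i j c * 1 := (mul_one _).symm
  rw [e]
  ext a b
  simp only [trm, h1, h2, h3, h1.symm, h2.symm, h3.symm, if_true, if_false]
  by_cases ha : a = i
  · subst ha; simp [h1]; ring
  · by_cases hb : a = m
    · subst hb; simp [ha, h2]
    · simp [ha, hb]

theorem trans_diag {n : Type} [Fintype n] [DecidableEq n] (i j : n) (t : K) (ht : t ≠ 0) (h : i ≠ j) (d : n → K) :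
    transvection i j t * (transvection j i (-t⁻¹) * (transvection i j t * (transvection i j (-1) *
      (transvection j i 1 * (transvection i j (-1) * diagonal d)))))
    = diagonal (fun k => if k = i then t * d i else if k = j then t⁻¹ * d j else d k) := by
  ext a b
  simp only [trm, h, h.symm, if_true, if_false, diagonal_apply]
  by_cases ha : a = i
  · subst ha
    by_cases hb : a = b
    · subst hb; simp [h, h.symm]; field_simp; simp
    · by_cases hc : j = b
      · subst hc; simp [h, h.symm]; field_simp; ring
      · simp [hb, hc]
  · by_cases hb : a = j
    · subst hb
      by_cases hc : a = b
      · subst hc; simp [h, h.symm]; try field_simp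
      · by_cases hc' : i = b
        · subst hc'; simp [h, h.symm]; field_simp; ring
        · simp [hc, hc']
    · by_cases hc : a = b
      · subst hc; simp [ha, hb]
      · simp [ha, hb, hc]

theorem SL_gen {n : ℕ} (P : Matrix (Fin n) (Fin n) K → Prop) (h1 : P 1)
    (hm : ∀ a b, P a → P b → P (a * b))
    (hT : ∀ (i j : Fin n) (c : K), (i.1 + 1 = j.1 ∨ j.1 + 1 = i.1) → P (transvection i j c))
    (g : Matrix (Fin n) (Fin n) K) (hg : g.det = 1) : P g := by
  classical
  have hTT : ∀ (k : ℕ) (i j : Fin n) (c : K), (i.1 + (k + 1) = j.1 ∨ j.1 + (k + 1) = i.1) →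
      P (transvection i j c) := by
    intro k
    induction k with
    | zero => exact hT
    | succ k ih =>
      intro i j c h
      obtain ⟨m, hm1, hm2⟩ : ∃ m : Fin n, (i.1 + (k + 1) = m.1 ∨ m.1 + (k + 1) = i.1) ∧
          (m.1 + 1 = j.1 ∨ j.1 + 1 = m.1) := by
        rcases h with h | h
        · exact ⟨⟨i.1 + (k + 1), by have := j.2; omega⟩, by simp, by simp; omega⟩
        · exact ⟨⟨j.1 + 1, by have := i.2; omega⟩, by simp; omega, by simp⟩
      have n1 : i ≠ m := by intro h; rw [Fin.ext_iff] at h; omega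
      have n2 : m ≠ j := by intro h; rw [Fin.ext_iff] at h; omega
      have n3 : i ≠ j := by intro h; rw [Fin.ext_iff] at h; omega
      rw [trans_comm i m j c n1 n2 n3]
      exact hm _ _ (ih _ _ _ hm1) (hm _ _ (hT _ _ _ hm2) (hm _ _ (ih _ _ _ hm1)
        (hm _ _ (hT _ _ _ hm2) h1)))
  have hA : ∀ (i j : Fin n) (c : K), i ≠ j → P (transvection i j c) := by
    intro i j c h
    have h' : i.1 ≠ j.1 := fun h' => h (Fin.ext h')
    rcases lt_or_gt_of_ne h' with h2 | h2
    · exact hTT (j.1 - i.1 - 1) i j c (Or.inl (by omega))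
    · exact hTT (i.1 - j.1 - 1) i j c (Or.inr (by omega))
  have hL : ∀ L : List (TransvectionStruct (Fin n) K), P (L.map TransvectionStruct.toMatrix).prod := by
    intro L
    induction L with
    | nil => simpa using h1
    | cons t L ih =>
      rw [List.map_cons, List.prod_cons]
      exact hm _ _ (hA _ _ _ t.hij) ih
  have hD : ∀ (k : ℕ) (d : Fin n → K), (∏ i, d i = 1) → (univ.filter fun i => d i ≠ 1).card = k →
      P (diagonal d) := by
    intro k
    induction k using Nat.strong_induction_on with
    | _ k ih =>
    intro d hd hk
    by_cases hall : ∀ i, d i = 1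
    · have : d = fun _ => 1 := funext hall
      rw [this, Matrix.diagonal_one]; exact h1
    push Not at hall
    obtain ⟨i, hi⟩ := hall
    obtain ⟨j, hji, hj⟩ : ∃ j, j ≠ i ∧ d j ≠ 1 := by
      by_contra hc
      push Not at hc
      rw [prod_eq_single i (fun j _ h => hc j h) (by simp)] at hd
      exact hi hd
    have hi0 : d i ≠ 0 := by
      intro h; rw [Finset.prod_eq_zero (mem_univ i) h] at hd; exact zero_ne_one hd
    set d' : Fin n → K := fun k => if k = i then 1 else if k = j then d i * d j else d k with hd'
    have key := trans_diag i j (d i) hi0 hji.symm d'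
    have e2 : (fun k => if k = i then d i * d' i else if k = j then (d i)⁻¹ * d' j else d' k) = d := by
      funext k
      by_cases hki : k = i
      · subst hki; simp [hd']
      · by_cases hkj : k = j
        · subst hkj; simp [hd', hki, hi0]
        · simp [hd', hki, hkj]
    rw [e2] at key
    rw [← key]
    refine hm _ _ (hA _ _ _ hji.symm) (hm _ _ (hA _ _ _ hji) (hm _ _ (hA _ _ _ hji.symm)
      (hm _ _ (hA _ _ _ hji.symm) (hm _ _ (hA _ _ _ hji) (hm _ _ (hA _ _ _ hji.symm) ?_)))))
    refine ih _ ?_ d' ?_ rfl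
    · rw [← hk]
      apply Finset.card_lt_card
      rw [Finset.ssubset_iff_of_subset]
      · exact ⟨i, by simpa using hi, by simp [hd']⟩
      · intro x
        simp only [Finset.mem_filter, mem_univ, true_and, hd']
        by_cases hki : x = i
        · simp [hki]
        · by_cases hkj : x = j
          · subst hkj; intro _; exact hj
          · simp [hki, hkj]
    · have := congrArg Matrix.det key
      simp only [Matrix.det_mul, Matrix.det_transvection_of_ne _ _ hji, Matrix.det_transvection_of_ne _ _ hji.symm,
        one_mul, Matrix.det_diagonal] at this
      rw [this, hd]
  obtain ⟨L, L', D, h⟩ := Matrix.Pivot.exists_list_transvec_mul_diagonal_mul_list_transvec g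
  rw [h]
  refine hm _ _ (hm _ _ (hL L) (hD _ D ?_ rfl)) (hL L')
  have := congrArg Matrix.det h
  rw [hg, Matrix.det_mul, Matrix.det_mul, TransvectionStruct.det_toMatrix_prod,
    TransvectionStruct.det_toMatrix_prod, Matrix.det_diagonal] at this
  simpa using this.symm

variable {Q0 Q1 : Type} [Fintype Q0] [DecidableEq Q0] {ta ha : Q1 → Q0} {α : Q0 → ℕ}

def el (b : Q0) (i j : Fin (α b)) (c : K) : GM α K := Function.update 1 b (transvection i j c)

theorem mem_SL_of_el [Infinite K] (s : SK)
    (h : ∀ (b : Q0) (i j : Fin (α b)) (c : K), (i.1 + 1 = j.1 ∨ j.1 + 1 = i.1) → act (el b i j c) s = s) :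
    s ∈ QS := by
  rw [mem_SL]
  have h1 : ∀ b (g : Matrix (Fin (α b)) (Fin (α b)) K), g.det = 1 →
      act (Function.update (1 : GM α K) b g) s = s := by
    intro b g hg
    refine SL_gen (fun g => act (Function.update (1 : GM α K) b g) s = s) ?_ ?_ (h b) g hg
    · have e : Function.update (1 : GM α K) b 1 = 1 := by
        exact Function.update_eq_self b (1 : GM α K)
      show act (Function.update (1 : GM α K) b 1) s = s
      rw [e, act_one]
    · intro x y hx hy
      show act (Function.update (1 : GM α K) b (x * y)) s = s
      have e : Function.update (1 : GM α K) b (x * y) =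
          Function.update (1 : GM α K) b x * Function.update (1 : GM α K) b y := by
        funext b'
        rw [Pi.mul_apply]
        by_cases hb : b' = b
        · subst hb; simp
        · simp [hb]
      rw [e, ← act_act, hx, hy]
  intro g hg
  have h2 : ∀ T : Finset Q0, act (fun b => if b ∈ T then g b else 1 : GM α K) s = s := by
    intro T
    induction T using Finset.induction_on with
    | empty => simp only [Finset.notMem_empty, if_false]; exact act_one s
    | insert b T hb ih =>
      have e : (fun b' => if b' ∈ insert b T then g b' else 1 : GM α K) =
          Function.update (1 : GM α K) b (g b) * (fun b => if b ∈ T then g b else 1 : GM α K) := by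
        funext b'
        rw [Pi.mul_apply]
        by_cases hb' : b' = b
        · subst hb'; simp [hb]
        · simp [hb']
      rw [e, ← act_act, h1 b _ (hg b), ih]
  simpa using h2 univ

end SLgen

section minors
variable {A : Type} [CommRing A]

def off {ρ γ : Type} {m N : ℕ} (er : ρ ≃ Fin m) (ec : γ ≃ Fin N) (d : ρ × γ) : ℤ :=
  ((ec d.2 : ℕ) : ℤ) - ((er d.1 : ℕ) : ℤ)

def mnr {ρ γ : Type} [Fintype ρ] [Fintype γ] [DecidableEq ρ] [DecidableEq γ] {m N : ℕ}
    (er : ρ ≃ Fin m) (ec : γ ≃ Fin N) (δ : ℤ) (M : Matrix ρ γ A) : A :=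
  Matrix.det (Matrix.of fun d d' : {d : ρ × γ // off er ec d = δ} => M d.1.1 d'.1.2)

noncomputable def Fp {ρ γ : Type} [Fintype ρ] [Fintype γ] [DecidableEq ρ] [DecidableEq γ] {m N : ℕ}
    (er : ρ ≃ Fin m) (ec : γ ≃ Fin N) (δ₀ : ℤ) (M : Matrix ρ γ A) : A :=
  ∏ δ ∈ (Finset.Icc (-((m : ℤ) + N)) (m + N)).erase δ₀, mnr er ec δ M

variable {ρ γ : Type} [Fintype ρ] [Fintype γ] [DecidableEq ρ] [DecidableEq γ] {m N : ℕ}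
    (er : ρ ≃ Fin m) (ec : γ ≃ Fin N)

theorem mnr_row (M : Matrix ρ γ A) (r r' : ρ)
    (h : (er r).1 + 1 = (er r').1 ∨ (er r').1 + 1 = (er r).1) :
    ∃ δs : ℤ, ∀ δ, ∃ G : A, (δ ≠ δs → G = 0) ∧
      ∀ t, mnr er ec δ (M.updateRow r (M r + t • M r')) = mnr er ec δ M + t * G := by
  refine ⟨if (er r).1 + 1 = (er r').1 then N - 1 - (er r).1 else - (er r).1, fun δ => ?_⟩
  by_cases h0 : ∃ d : {d : ρ × γ // off er ec d = δ}, d.1.1 = r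
  · obtain ⟨d0, hd0⟩ := h0
    set sub := Matrix.of fun d d' : {d : ρ × γ // off er ec d = δ} => M d.1.1 d'.1.2 with hsub
    refine ⟨(sub.updateRow d0 (fun d' => M r' d'.1.2)).det, ?_, ?_⟩
    · intro hδ
      have h1 : ∃ d : {d : ρ × γ // off er ec d = δ}, d.1.1 = r' := by
        have e0 := d0.2
        rw [off, hd0] at e0
        have b1 := (ec d0.1.2).2
        have b2 : 0 ≤ ((er r').1 : ℤ) + δ ∧ ((er r').1 : ℤ) + δ < N := by
          rcases h with h | h
          · rw [if_pos h] at hδ; omega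
          · rw [if_neg (by omega)] at hδ; omega
        refine ⟨⟨(r', ec.symm ⟨(((er r').1 : ℤ) + δ).toNat, by omega⟩), ?_⟩, rfl⟩
        rw [off]; simp; omega
      obtain ⟨d1, hd1⟩ := h1
      have hne : d0 ≠ d1 := by
        intro hh; rw [hh, hd1] at hd0; rw [hd0] at h; omega
      apply Matrix.det_zero_of_row_eq hne
      funext d'
      rw [updateRow_self, updateRow_ne hne.symm, hsub, of_apply, hd1]
    · intro t
      have e1 : (Matrix.of fun d d' : {d : ρ × γ // off er ec d = δ} =>
          (M.updateRow r (M r + t • M r')) d.1.1 d'.1.2) =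
          sub.updateRow d0 (sub d0 + t • (fun d' => M r' d'.1.2)) := by
        ext d d'
        rw [of_apply]
        by_cases hd : d = d0
        · subst hd
          rw [hd0, updateRow_self, updateRow_self]
          simp [hsub, hd0]
        · rw [updateRow_ne hd, updateRow_ne, hsub, of_apply]
          intro hr
          apply hd
          have q1 := d.2
          have q2 := d0.2
          rw [off, hr] at q1
          rw [off, hd0] at q2
          apply Subtype.ext
          refine Prod.ext (hr.trans hd0.symm) ?_
          apply ec.injective
          apply Fin.ext
          omega
      rw [mnr, e1, det_updateRow_add, det_updateRow_smul, updateRow_eq_self]; rfl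
  · refine ⟨0, fun _ => rfl, fun t => ?_⟩
    rw [mul_zero, add_zero, mnr, mnr]
    congr 1
    ext d d'
    rw [of_apply, of_apply, updateRow_ne]
    intro hd; exact h0 ⟨d, hd⟩

theorem Fp_row (δ₀ : ℤ) (M : Matrix ρ γ A) (r r' : ρ)
    (h : (er r).1 + 1 = (er r').1 ∨ (er r').1 + 1 = (er r).1) :
    ∃ G : A, ∀ t, Fp er ec δ₀ (M.updateRow r (M r + t • M r')) = Fp er ec δ₀ M + t * G := by
  obtain ⟨δs, H⟩ := mnr_row er ec M r r' h
  choose G h0 hG using H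
  simp only [Fp, hG]
  generalize (Finset.Icc (-((m : ℤ) + N)) (m + N)).erase δ₀ = T
  by_cases hT : δs ∈ T
  · refine ⟨G δs * ∏ δ ∈ T.erase δs, mnr er ec δ M, fun t => ?_⟩
    rw [← mul_prod_erase T _ hT, ← mul_prod_erase T (fun δ => mnr er ec δ M) hT,
      prod_congr rfl (g := fun δ => mnr er ec δ M)]
    · ring
    · intro δ hδ
      rw [h0 δ (Finset.ne_of_mem_erase hδ)]; ring
  · refine ⟨0, fun t => ?_⟩
    rw [mul_zero, add_zero]
    refine prod_congr rfl fun δ hδ => ?_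
    rw [h0 δ (fun e => hT (e ▸ hδ))]; ring

theorem mnr_transpose (δ : ℤ) (M : Matrix ρ γ A) : mnr er ec δ M = mnr ec er (-δ) Mᵀ := by
  let e : {d : ρ × γ // off er ec d = δ} ≃ {d : γ × ρ // off ec er d = -δ} :=
    { toFun := fun d => ⟨d.1.swap, by have := d.2; simp only [off, Prod.fst_swap, Prod.snd_swap] at this ⊢; omega⟩
      invFun := fun d => ⟨d.1.swap, by have := d.2; simp only [off, Prod.fst_swap, Prod.snd_swap] at this ⊢; omega⟩
      left_inv := fun d => rfl
      right_inv := fun d => rfl }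
  rw [mnr, mnr, ← Matrix.det_transpose, ← Matrix.det_reindex_self e]
  rfl

theorem Fp_transpose (δ₀ : ℤ) (M : Matrix ρ γ A) : Fp er ec δ₀ M = Fp ec er (-δ₀) Mᵀ := by
  rw [Fp, Fp]
  refine Finset.prod_nbij' (fun δ => -δ) (fun δ => -δ) ?_ ?_ ?_ ?_ ?_
  · intro δ h; simp at h ⊢; omega
  · intro δ h; simp at h ⊢; omega
  · intro δ h; simp
  · intro δ h; simp
  · intro δ h; exact mnr_transpose er ec δ M

def rop {ρ γ : Type} [DecidableEq ρ] (r r' : ρ) (t : A) (M : Matrix ρ γ A) : Matrix ρ γ A :=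
  Matrix.of fun x y => M x y + if x = r then t * M r' y else 0

def cop {ρ γ : Type} [DecidableEq γ] (c c' : γ) (t : A) (M : Matrix ρ γ A) : Matrix ρ γ A :=
  Matrix.of fun x y => M x y + if y = c then t * M x c' else 0

theorem Fp_rop (δ₀ : ℤ) (M : Matrix ρ γ A) (r r' : ρ)
    (h : (er r).1 + 1 = (er r').1 ∨ (er r').1 + 1 = (er r).1) :
    ∃ G : A, ∀ t, Fp er ec δ₀ (rop r r' t M) = Fp er ec δ₀ M + t * G := by
  obtain ⟨G, hG⟩ := Fp_row er ec δ₀ M r r' h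
  refine ⟨G, fun t => ?_⟩
  rw [← hG]
  congr 1
  ext x y
  rw [rop, of_apply, updateRow_apply]
  by_cases hx : x = r
  · subst hx; simp
  · simp [hx]

theorem Fp_cop (δ₀ : ℤ) (M : Matrix ρ γ A) (c c' : γ)
    (h : (ec c).1 + 1 = (ec c').1 ∨ (ec c').1 + 1 = (ec c).1) :
    ∃ G : A, ∀ t, Fp er ec δ₀ (cop c c' t M) = Fp er ec δ₀ M + t * G := by
  obtain ⟨G, hG⟩ := Fp_rop ec er (-δ₀) Mᵀ c c' h
  refine ⟨G, fun t => ?_⟩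
  rw [Fp_transpose er ec δ₀ M, ← hG, Fp_transpose]
  rfl

theorem map_mnr {B : Type} [CommRing B] (φ : A →+* B) (δ : ℤ) (M : Matrix ρ γ A) :
    φ (mnr er ec δ M) = mnr er ec δ (M.map φ) := by
  rw [mnr, RingHom.map_det, mnr]; rfl

theorem map_Fp {B : Type} [CommRing B] (φ : A →+* B) (δ : ℤ) (M : Matrix ρ γ A) :
    φ (Fp er ec δ M) = Fp er ec δ (M.map φ) := by
  rw [Fp, map_prod, Fp]
  exact prod_congr rfl fun δ _ => map_mnr er ec φ δ M

end minors

section lead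
variable {K : Type} [Field K] {τ : Type} (w : τ → ℕ)

def Hi (k e : ℕ) (g : MP τ K) : Prop :=
  ∀ m ∈ g.support, k ≤ Finsupp.weight w m ∧ m.degree = e

theorem Hi.add {k e : ℕ} {f g : MP τ K} (hf : Hi w k e f) (hg : Hi w k e g) :
    Hi w k e (f + g) := by
  classical
  intro m hm
  rcases mem_union.1 (MvPolynomial.support_add hm) with h | h
  · exact hf m h
  · exact hg m h

theorem Hi.mul {k e k' e' : ℕ} {f g : MP τ K} (hf : Hi w k e f) (hg : Hi w k' e' g) :
    Hi w (k + k') (e + e') (f * g) := by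
  classical
  intro m hm
  obtain ⟨a, ha, b, hb, rfl⟩ := Finset.mem_add.1 (MvPolynomial.support_mul f g hm)
  rw [map_add, map_add, (hf a ha).2, (hg b hb).2]
  exact ⟨add_le_add (hf a ha).1 (hg b hb).1, rfl⟩

theorem Hi.mono {k k' e : ℕ} {f : MP τ K} (hf : Hi w k e f) (h : k' ≤ k) : Hi w k' e f :=
  fun m hm => ⟨h.trans (hf m hm).1, (hf m hm).2⟩

theorem Hi.sum {ι : Type} {k e : ℕ} (s : Finset ι) (f : ι → MP τ K) (h : ∀ i ∈ s, Hi w k e (f i)) :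
    Hi w k e (∑ i ∈ s, f i) := by
  classical
  induction s using Finset.induction_on with
  | empty => intro m hm; simp at hm
  | insert a s ha ih =>
    rw [sum_insert ha]
    exact (h a (Finset.mem_insert_self a s)).add w (ih fun i hi => h i (Finset.mem_insert_of_mem hi))

theorem Hi_mon (m : τ →₀ ℕ) (c : K) : Hi w (Finsupp.weight w m) m.degree (monomial m c) := by
  intro a ha
  rw [Finset.mem_singleton.1 (MvPolynomial.support_monomial_subset ha)]
  exact ⟨le_rfl, rfl⟩

def Lead (f : MP τ K) (m : τ →₀ ℕ) : Prop :=
  ∃ g, f = monomial m 1 + g ∧ Hi w (Finsupp.weight w m + 1) m.degree g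

theorem Lead.mul {f f' : MP τ K} {m m' : τ →₀ ℕ} (h : Lead w f m) (h' : Lead w f' m') :
    Lead w (f * f') (m + m') := by
  obtain ⟨g, rfl, hg⟩ := h
  obtain ⟨g', rfl, hg'⟩ := h'
  refine ⟨monomial m 1 * g' + g * monomial m' 1 + g * g', ?_, ?_⟩
  · rw [← one_mul (1 : K), ← monomial_mul]; simp only [one_mul]; ring
  · rw [map_add, map_add]
    refine Hi.add w (Hi.add w ?_ ?_) ?_
    · exact ((Hi_mon w m 1).mul w hg').mono w (by omega)
    · exact (hg.mul w (Hi_mon w m' 1)).mono w (by omega)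
    · exact (hg.mul w hg').mono w (by omega)

theorem Lead_one : Lead w (1 : MP τ K) 0 :=
  ⟨0, by rw [add_zero]; rfl, fun m hm => by simp at hm⟩

theorem Lead.pow {f : MP τ K} {m : τ →₀ ℕ} (h : Lead w f m) (k : ℕ) :
    Lead w (f ^ k) (k • m) := by
  induction k with
  | zero => rw [pow_zero, zero_smul]; exact Lead_one w
  | succ k ih => rw [pow_succ, succ_nsmul]; exact ih.mul w h

theorem Lead.prod {ι : Type} (s : Finset ι) (f : ι → MP τ K) (m : ι → τ →₀ ℕ)
    (h : ∀ i ∈ s, Lead w (f i) (m i)) : Lead w (∏ i ∈ s, f i) (∑ i ∈ s, m i) := by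
  classical
  induction s using Finset.induction_on with
  | empty => simpa using Lead_one w
  | insert a s ha ih =>
    rw [sum_insert ha, Finset.prod_insert ha]
    exact (h a (Finset.mem_insert_self a s)).mul w (ih fun i hi => h i (Finset.mem_insert_of_mem hi))

theorem Lead.deg {f : MP τ K} {m : τ →₀ ℕ} (h : Lead w f m) (a : τ →₀ ℕ) (ha : a ∈ f.support) :
    a.degree = m.degree := by
  classical
  obtain ⟨g, rfl, hg⟩ := h
  rcases mem_union.1 (MvPolynomial.support_add ha) with h | h
  · rw [Finset.mem_singleton.1 (MvPolynomial.support_monomial_subset h)]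
  · exact (hg a h).2

theorem Lead.coeff {f : MP τ K} {m : τ →₀ ℕ} (h : Lead w f m) : coeff m f = 1 := by
  classical
  obtain ⟨g, rfl, hg⟩ := h
  rw [coeff_add, coeff_monomial, if_pos rfl, notMem_support_iff.1, add_zero]
  intro hm
  have := (hg m hm).1
  omega

end lead

section leadmin
variable {K : Type} [Field K] {ρ γ : Type} [Fintype ρ] [Fintype γ] [DecidableEq ρ] [DecidableEq γ] {m N : ℕ}
    (er : ρ ≃ Fin m) (ec : γ ≃ Fin N)

def wof (d : ρ × γ) : ℕ := (off er ec d ^ 2).toNat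

noncomputable def Xm (K : Type) [Field K] (ρ γ : Type) : Matrix ρ γ (MP (ρ × γ) K) :=
  Matrix.of fun r c => X (r, c)

theorem Lead_det {D : Type} [Fintype D] [DecidableEq D] (r : D → ρ) (c : D → γ) (δ : ℤ)
    (hr : Function.Injective r) (h : ∀ d, off er ec (r d, c d) = δ) :
    Lead (wof er ec) (Matrix.det (Matrix.of fun d d' : D => Xm K ρ γ (r d) (c d')))
      (∑ d, Finsupp.single (r d, c d) 1) := by
  classical
  have hpm : ∀ σ : Equiv.Perm D, (∏ d, (Matrix.of fun d d' : D => Xm K ρ γ (r d) (c d')) (σ d) d) =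
      monomial (∑ d, Finsupp.single (r (σ d), c d) 1) 1 := by
    intro σ
    rw [MvPolynomial.monomial_sum_one]; rfl
  refine ⟨∑ σ ∈ univ.erase (1 : Equiv.Perm D), (Equiv.Perm.sign σ : ℤ) •
    monomial (∑ d, Finsupp.single (r (σ d), c d) 1) 1, ?_, ?_⟩
  · rw [Matrix.det_apply, ← Finset.add_sum_erase _ _ (mem_univ (1 : Equiv.Perm D)), hpm]
    congr 1
    · simp
    · refine sum_congr rfl fun σ _ => ?_
      rw [hpm]; rfl
  · refine Hi.sum _ _ _ fun σ hσ => ?_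
    have hs : σ ≠ 1 := Finset.ne_of_mem_erase hσ
    intro a ha
    have ha' : a = ∑ d, Finsupp.single (r (σ d), c d) 1 := by
      have := MvPolynomial.support_smul ha
      exact Finset.mem_singleton.1 (MvPolynomial.support_monomial_subset this)
    subst ha'
    refine ⟨?_, by simp [Finsupp.degree_eq_sum, map_sum]⟩
    rw [map_sum, map_sum]
    simp only [Finsupp.weight_single, smul_eq_mul, one_mul]
    rw [Nat.add_one_le_iff]
    zify
    simp only [wof, Int.toNat_of_nonneg (sq_nonneg _)]
    set P : D → ℤ := fun d => ((er (r d) : ℕ) : ℤ) with hP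
    have e1 : ∀ d d', off er ec (r d', c d) = P d - P d' + δ := by
      intro d d'
      have := h d
      simp only [off] at this ⊢
      simp only [hP]; omega
    simp only [e1, sub_self, zero_add]
    have e2 : ∑ d, (P d - P (σ d) + δ) ^ 2 = ∑ d, (P d - P (σ d)) ^ 2 + 2 * δ * (∑ d, P d - ∑ d, P (σ d)) + ∑ d : D, δ ^ 2 := by
      rw [← sum_sub_distrib, Finset.mul_sum, ← sum_add_distrib, ← sum_add_distrib]
      exact sum_congr rfl fun d _ => by ring
    rw [e2, Equiv.sum_comp σ P, sub_self, mul_zero, add_zero, lt_add_iff_pos_left]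
    obtain ⟨d, hd⟩ : ∃ d, σ d ≠ d := by
      by_contra hc; push Not at hc; exact hs (Equiv.ext hc)
    refine Finset.sum_pos' (fun d _ => sq_nonneg _) ⟨d, mem_univ d, ?_⟩
    have : P d - P (σ d) ≠ 0 := by
      intro h0
      apply hd
      apply hr
      apply er.injective
      apply Fin.ext
      simp only [hP] at h0; omega
    positivity

theorem Lead_Fp (δ₀ : ℤ) (d0 : MP (ρ × γ) K) (m0 : ρ × γ →₀ ℕ)
    (h0 : Lead (wof er ec) d0 m0) (hm0 : ∀ v, m0 v = if off er ec v = δ₀ then 1 else 0) :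
    Lead (wof er ec) (d0 * Fp er ec δ₀ (Xm K ρ γ)) (topE (ρ × γ) 1) := by
  have h1 := h0.mul _ (Lead.prod (wof er ec) ((Finset.Icc (-((m : ℤ) + N)) (m + N)).erase δ₀)
    (fun δ => mnr er ec δ (Xm K ρ γ))
    (fun δ => ∑ d : {d : ρ × γ // off er ec d = δ}, Finsupp.single (d.1.1, d.1.2) 1) ?_)
  · convert h1 using 1
    · rfl
    ext v
    rw [topE_apply, Finsupp.add_apply, hm0, Finsupp.finset_sum_apply]
    have e : ∀ δ, (∑ d : {d : ρ × γ // off er ec d = δ}, Finsupp.single (d.1.1, d.1.2) 1 : ρ × γ →₀ ℕ) v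
        = if off er ec v = δ then 1 else 0 := by
      intro δ
      rw [Finsupp.finset_sum_apply]
      by_cases hv : off er ec v = δ
      · rw [if_pos hv, sum_eq_single ⟨v, hv⟩]
        · simp
        · intro d _ hd
          rw [Finsupp.single_apply, if_neg]
          intro hh; exact hd (Subtype.ext hh)
        · simp
      · rw [if_neg hv]
        refine sum_eq_zero fun d _ => ?_
        rw [Finsupp.single_apply, if_neg]
        intro hh; apply hv; rw [← d.2, ← hh]
    simp only [e]
    rw [Finset.sum_ite_eq]
    by_cases hv : off er ec v = δ₀
    · simp [hv]
    · rw [if_neg hv, if_pos]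
      rw [Finset.mem_erase, Finset.mem_Icc]
      have b1 := (er v.1).2
      have b2 := (ec v.2).2
      refine ⟨hv, ?_⟩
      simp only [off]; omega
  · intro δ _
    refine Lead_det er ec (fun d : {d : ρ × γ // off er ec d = δ} => d.1.1) (fun d => d.1.2) δ ?_ (fun d => d.2)
    intro d d' hd
    have q1 := d.2
    have q2 := d'.2
    simp only [off] at q1 q2
    simp only at hd
    apply Subtype.ext
    refine Prod.ext hd (ec.injective (Fin.ext ?_))
    rw [hd] at q1; omega

theorem trq_one (p : ℕ) [Fact p.Prime] [CharP K p] [PerfectRing K p] (n : ℕ) (w : ρ × γ → ℕ)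
    (f : MP (ρ × γ) K) (hf : Lead w f (topE (ρ × γ) 1)) :
    trq p n (f ^ (p ^ n - 1)) = 1 := by
  have h := hf.pow w (p ^ n - 1)
  have e : (p ^ n - 1) • topE (ρ × γ) 1 = topE (ρ × γ) (p ^ n - 1) := by ext v; simp
  rw [e] at h
  rw [trq_of_degree, h.coeff, qroot_one, C_1]
  intro a ha
  rw [h.deg w a ha, topE_degree]

end leadmin

section trinv
variable {K : Type} [Field K] [Infinite K] {τ : Type} [Fintype τ] [DecidableEq τ]

theorem pol_ext (P P' : Polynomial (MP τ K)) (h : ∀ t : K, P.eval (C t) = P'.eval (C t)) : P = P' := by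
  apply Polynomial.eq_of_infinite_eval_eq
  refine Set.Infinite.mono ?_ (Set.infinite_range_of_injective (MvPolynomial.C_injective τ K))
  rintro _ ⟨t, rfl⟩
  exact h t

theorem trq_inv (p : ℕ) [Fact p.Prime] [CharP K p] [PerfectRing K p] (n : ℕ)
    (E : MP τ K → Polynomial (MP τ K)) (A : K → Matrix τ τ K)
    (hE : ∀ t f, (E f).eval (C t) = lsub K (A t) f) (hA : ∀ t, (A t).det = 1) (hA0 : A 0 = 1)
    (h : MP τ K) (hd : (E h).natDegree < p ^ n) (t : K) :
    lsub K (A t) (trq p n h) = trq p n h := by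
  have hq : 0 < p ^ n := pow_pos (Fact.out : p.Prime).pos n
  have key : Polynomial.expand _ (p ^ n) (E (trq p n h)) =
      ∑ i ∈ Finset.range (p ^ n), Polynomial.C (trq p n ((E h).coeff i)) * Polynomial.X ^ i := by
    apply pol_ext
    intro u
    rw [Polynomial.expand_eval, ← C_pow, hE, ← trq_lsub p n _ (hA _), ← hE,
      Polynomial.eval_eq_sum_range' hd, trq_sum, Polynomial.eval_finset_sum]
    refine sum_congr rfl fun i _ => ?_
    rw [Polynomial.eval_mul, Polynomial.eval_C, Polynomial.eval_pow, Polynomial.eval_X]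
    have e : (E h).coeff i * (C (u ^ p ^ n)) ^ i = (C u ^ i) ^ p ^ n * (E h).coeff i := by
      rw [C_pow]; ring
    rw [e, trq_pow_mul, mul_comm]
  have hc : E (trq p n h) = Polynomial.C ((E (trq p n h)).coeff 0) := by
    ext1 j
    rw [Polynomial.coeff_C]
    split_ifs with hj
    · rw [hj]
    · rw [← Polynomial.coeff_expand_mul hq, key, Polynomial.finset_sum_coeff]
      refine sum_eq_zero fun i hi => ?_
      rw [Polynomial.coeff_C_mul, Polynomial.coeff_X_pow, if_neg, mul_zero]
      have : i < p ^ n := Finset.mem_range.1 hi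
      have : p ^ n ≤ j * p ^ n := Nat.le_mul_of_pos_left _ (Nat.pos_of_ne_zero hj)
      omega
  have h1 := hE t (trq p n h)
  have h0 := hE 0 (trq p n h)
  rw [hA0, lsub_one] at h0
  rw [hc, Polynomial.eval_C] at h0 h1
  exact h1.symm.trans h0

theorem trq_inv' (p : ℕ) [Fact p.Prime] [CharP K p] [PerfectRing K p] (n : ℕ)
    (E : MP τ K →ₐ[K] Polynomial (MP τ K)) (A : K → Matrix τ τ K)
    (hE : ∀ t f, (E f).eval (C t) = lsub K (A t) f) (hA : ∀ t, (A t).det = 1) (hA0 : A 0 = 1)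
    (a F : MP τ K) (ha : ∀ t, lsub K (A t) a = a)
    (hF : ∃ G, ∀ t, lsub K (A t) F = F + C t * G) (t : K) :
    lsub K (A t) (trq p n (a * F ^ (p ^ n - 1))) = trq p n (a * F ^ (p ^ n - 1)) := by
  have hq : 0 < p ^ n := pow_pos (Fact.out : p.Prime).pos n
  refine trq_inv p n E A hE hA hA0 _ ?_ t
  have e1 : E a = Polynomial.C a := pol_ext _ _ fun t => by rw [hE, ha, Polynomial.eval_C]
  obtain ⟨G, hG⟩ := hF
  have e2 : E F = Polynomial.C G * Polynomial.X + Polynomial.C F := pol_ext _ _ fun t => by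
    rw [hE, hG]; simp; ring
  rw [map_mul, map_pow, e1, e2]
  have h1 : (Polynomial.C G * Polynomial.X + Polynomial.C F).natDegree ≤ 1 :=
    Polynomial.natDegree_linear_le
  have h2 := Polynomial.natDegree_C_mul_le a ((Polynomial.C G * Polynomial.X + Polynomial.C F) ^ (p ^ n - 1))
  have h3 := Polynomial.natDegree_pow_le_of_le (p ^ n - 1) h1
  omega

variable {ρ γ : Type} [Fintype ρ] [Fintype γ] [DecidableEq ρ] [DecidableEq γ]

noncomputable def sbt {B : Type} [CommRing B] [Algebra K B] (M : Matrix ρ γ B) :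
    MP (ρ × γ) K →ₐ[K] B := aeval (fun v => M v.1 v.2)

def IRow (r r' : ρ) (f : MP (ρ × γ) K) : Prop :=
  ∀ (t : K) (M : Matrix ρ γ K), sbt (rop r r' t M) f = sbt M f
def ICol (c c' : γ) (f : MP (ρ × γ) K) : Prop :=
  ∀ (t : K) (M : Matrix ρ γ K), sbt (cop c c' t M) f = sbt M f

theorem sbt_lsub_row (r r' : ρ) (t : K) {B : Type} [CommRing B] [Algebra K B] (M : Matrix ρ γ B)
    (f : MP (ρ × γ) K) :
    sbt M (lsub K (kroneckerMap (· * ·) (transvection r r' t) (1 : Matrix γ γ K)) f) =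
      sbt (rop r r' (algebraMap K B t) M) f := by
  have : (sbt M).comp (lsub K (kroneckerMap (· * ·) (transvection r r' t) (1 : Matrix γ γ K))) =
      sbt (rop r r' (algebraMap K B t) M) := by
    apply MvPolynomial.algHom_ext
    rintro ⟨x, y⟩
    rw [AlgHom.comp_apply, lsub_X, map_sum, Fintype.sum_prod_type]
    have e : ∀ x' : ρ, ∑ y' : γ, sbt M (C (algebraMap K K (kroneckerMap (· * ·) (transvection r r' t)
        (1 : Matrix γ γ K) (x, y) (x', y'))) * X (x', y')) = algebraMap K B (transvection r r' t x x') * M x' y := by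
      intro x'
      rw [sum_eq_single y]
      · simp [sbt, kroneckerMap_apply]
      · intro y' _ hy
        simp [sbt, kroneckerMap_apply, Matrix.one_apply_ne hy.symm]
      · simp
    rw [sum_congr rfl fun x' _ => e x']
    have := trm r r' (algebraMap K B t) M x y
    rw [Matrix.mul_apply] at this
    have e2 : ∀ x', algebraMap K B (transvection r r' t x x') = transvection r r' (algebraMap K B t) x x' := by
      intro x'
      simp [transvection, Matrix.one_apply, Matrix.single_apply, apply_ite (algebraMap K B)]
    simp only [e2, this]
    rw [sbt, aeval_X, rop, of_apply]
  exact congrArg (fun g => g f) this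

theorem sbt_lsub_col (c c' : γ) (t : K) {B : Type} [CommRing B] [Algebra K B] (M : Matrix ρ γ B)
    (f : MP (ρ × γ) K) :
    sbt M (lsub K (kroneckerMap (· * ·) (1 : Matrix ρ ρ K) (transvection c c' t)) f) =
      sbt (cop c c' (algebraMap K B t) M) f := by
  have : (sbt M).comp (lsub K (kroneckerMap (· * ·) (1 : Matrix ρ ρ K) (transvection c c' t))) =
      sbt (cop c c' (algebraMap K B t) M) := by
    apply MvPolynomial.algHom_ext
    rintro ⟨x, y⟩
    rw [AlgHom.comp_apply, lsub_X, map_sum, Fintype.sum_prod_type_right]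
    have e : ∀ y' : γ, ∑ x' : ρ, sbt M (C (algebraMap K K (kroneckerMap (· * ·) (1 : Matrix ρ ρ K) (transvection c c' t)
        (x, y) (x', y'))) * X (x', y')) = algebraMap K B (transvection c c' t y y') * M x y' := by
      intro y'
      rw [sum_eq_single x]
      · simp [sbt, kroneckerMap_apply]
      · intro x' _ hx
        simp [sbt, kroneckerMap_apply, Matrix.one_apply_ne hx.symm]
      · simp
    rw [sum_congr rfl fun x' _ => e x']
    have := trm c c' (algebraMap K B t) Mᵀ y x
    rw [Matrix.mul_apply] at this
    have e2 : ∀ x', algebraMap K B (transvection c c' t y x') = transvection c c' (algebraMap K B t) y x' := by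
      intro x'
      simp [transvection, Matrix.one_apply, Matrix.single_apply, apply_ite (algebraMap K B)]
    simp only [e2]
    rw [sbt, aeval_X, cop, of_apply]
    exact this
  exact congrArg (fun g => g f) this

theorem eval_sbt_X (f : MP (ρ × γ) K) : sbt (Xm K ρ γ) f = f := by
  rw [sbt]; exact congrArg (fun g => g f) aeval_X_left

theorem sbt_map {B B' : Type} [CommRing B] [Algebra K B] [CommRing B'] [Algebra K B'] (φ : B →ₐ[K] B')
    (M : Matrix ρ γ B) (f : MP (ρ × γ) K) : φ (sbt M f) = sbt (M.map φ) f := by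
  rw [sbt, ← AlgHom.comp_apply, comp_aeval]; rfl

theorem IRow_iff (r r' : ρ) (f : MP (ρ × γ) K) : IRow r r' f ↔
    ∀ t, lsub K (kroneckerMap (· * ·) (transvection r r' t) (1 : Matrix γ γ K)) f = f := by
  constructor
  · intro h t
    apply MvPolynomial.funext
    intro x
    exact (sbt_lsub_row r r' t (Matrix.of fun a b => x (a, b)) f).trans (h t _)
  · intro h t M
    have := sbt_lsub_row r r' t M f
    rw [h] at this; exact this.symm

theorem ICol_iff (c c' : γ) (f : MP (ρ × γ) K) : ICol c c' f ↔
    ∀ t, lsub K (kroneckerMap (· * ·) (1 : Matrix ρ ρ K) (transvection c c' t)) f = f := by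
  constructor
  · intro h t
    apply MvPolynomial.funext
    intro x
    exact (sbt_lsub_col c c' t (Matrix.of fun a b => x (a, b)) f).trans (h t _)
  · intro h t M
    have := sbt_lsub_col c c' t M f
    rw [h] at this; exact this.symm

theorem rop_map {A B : Type} [CommRing A] [CommRing B] (φ : A →+* B) (r r' : ρ) (t : A) (M : Matrix ρ γ A) :
    (rop r r' t M).map φ = rop r r' (φ t) (M.map φ) := by
  ext x y; simp [rop, apply_ite φ]

theorem cop_map {A B : Type} [CommRing A] [CommRing B] (φ : A →+* B) (r r' : γ) (t : A) (M : Matrix ρ γ A) :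
    (cop r r' t M).map φ = cop r r' (φ t) (M.map φ) := by
  ext x y; simp [cop, apply_ite φ]

variable {m N : ℕ} (er : ρ ≃ Fin m) (ec : γ ≃ Fin N)

theorem tr_IRow (p : ℕ) [Fact p.Prime] [CharP K p] [PerfectRing K p] (n : ℕ) (δ₀ : ℤ) (r r' : ρ)
    (h : (er r).1 + 1 = (er r').1 ∨ (er r').1 + 1 = (er r).1) (a : MP (ρ × γ) K)
    (ha : IRow r r' a) : IRow r r' (trq p n (a * Fp er ec δ₀ (Xm K ρ γ) ^ (p ^ n - 1))) := by
  rw [IRow_iff] at ha ⊢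
  have hne : r ≠ r' := by rintro rfl; omega
  refine trq_inv' p n (sbt (rop r r' Polynomial.X ((Xm K ρ γ).map Polynomial.C))) _ ?_ ?_ ?_ a _ ha ?_
  · intro t f
    let φ : Polynomial (MP (ρ × γ) K) →ₐ[K] MP (ρ × γ) K :=
      (Polynomial.aeval (C t : MP (ρ × γ) K)).restrictScalars K
    have hφ : ∀ P, φ P = P.eval (C t) := fun P => rfl
    rw [← hφ, sbt_map, ← eval_sbt_X (lsub K _ f), sbt_lsub_row]
    congr 1
    have : (rop r r' Polynomial.X ((Xm K ρ γ).map Polynomial.C)).map φ = rop r r' (φ Polynomial.X)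
      (((Xm K ρ γ).map Polynomial.C).map φ) := rop_map φ.toRingHom r r' _ _
    rw [this, hφ, Polynomial.eval_X]
    congr 2
    ext1 x y
    simp [hφ]
  · intro t
    rw [Matrix.det_kronecker, det_transvection_of_ne _ _ hne]; simp
  · simp
  · obtain ⟨G, hG⟩ := Fp_rop er ec δ₀ (Xm K ρ γ) r r' h
    refine ⟨G, fun t => ?_⟩
    rw [← hG, ← eval_sbt_X (lsub K _ _), sbt_lsub_row]
    refine (map_Fp er ec (sbt (rop r r' (algebraMap K (MP (ρ × γ) K) t) (Xm K ρ γ))).toRingHom δ₀ _).trans ?_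
    congr 1
    ext1 x y
    exact aeval_X _ _

theorem tr_ICol (p : ℕ) [Fact p.Prime] [CharP K p] [PerfectRing K p] (n : ℕ) (δ₀ : ℤ) (c c' : γ)
    (h : (ec c).1 + 1 = (ec c').1 ∨ (ec c').1 + 1 = (ec c).1) (a : MP (ρ × γ) K)
    (ha : ICol c c' a) : ICol c c' (trq p n (a * Fp er ec δ₀ (Xm K ρ γ) ^ (p ^ n - 1))) := by
  rw [ICol_iff] at ha ⊢
  have hne : c ≠ c' := by rintro rfl; omega
  refine trq_inv' p n (sbt (cop c c' Polynomial.X ((Xm K ρ γ).map Polynomial.C))) _ ?_ ?_ ?_ a _ ha ?_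
  · intro t f
    let φ : Polynomial (MP (ρ × γ) K) →ₐ[K] MP (ρ × γ) K :=
      (Polynomial.aeval (C t : MP (ρ × γ) K)).restrictScalars K
    have hφ : ∀ P, φ P = P.eval (C t) := fun P => rfl
    rw [← hφ, sbt_map, ← eval_sbt_X (lsub K _ f), sbt_lsub_col]
    congr 1
    have : (cop c c' Polynomial.X ((Xm K ρ γ).map Polynomial.C)).map φ = cop c c' (φ Polynomial.X)
      (((Xm K ρ γ).map Polynomial.C).map φ) := cop_map φ.toRingHom c c' _ _
    rw [this, hφ, Polynomial.eval_X]
    congr 2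
    ext1 x y
    simp [hφ]
  · intro t
    rw [Matrix.det_kronecker, det_transvection_of_ne _ _ hne]; simp
  · simp
  · obtain ⟨G, hG⟩ := Fp_cop er ec δ₀ (Xm K ρ γ) c c' h
    refine ⟨G, fun t => ?_⟩
    rw [← hG, ← eval_sbt_X (lsub K _ _), sbt_lsub_col]
    refine (map_Fp er ec (sbt (cop c c' (algebraMap K (MP (ρ × γ) K) t) (Xm K ρ γ))).toRingHom δ₀ _).trans ?_
    congr 1
    ext1 x y
    exact aeval_X _ _

end trinv

section blocks
variable {K : Type} [Field K] {Q0 Q1 : Type} [DecidableEq Q0] [DecidableEq Q1] {ta ha : Q1 → Q0} {α : Q0 → ℕ}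

abbrev II (α : Q0 → ℕ) : Type := (b : Q0) × Fin (α b)
abbrev RR (α : Q0 → ℕ) : Type := Fin 2 × II α
abbrev CC (Q1 : Type) (α : Q0 → ℕ) : Type := Option (Option Q1) × II α

def blk {A : Type} (M : Matrix (RR α) (CC Q1 α) A) (s : Fin 2) (b : Q0) (t : Option (Option Q1)) (b' : Q0) :
    Matrix (Fin (α b)) (Fin (α b')) A := Matrix.of fun i j => M (s, ⟨b, i⟩) (t, ⟨b', j⟩)

variable {A : Type} [CommRing A]

def gact (g : Fin 2 → GM α A) (h : Option (Option Q1) → GM α A) (M : Matrix (RR α) (CC Q1 α) A) :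
    Matrix (RR α) (CC Q1 α) A :=
  Matrix.of fun x y => (g x.1 x.2.1 * blk M x.1 x.2.1 y.1 y.2.1 * h y.1 y.2.1) x.2.2 y.2.2

theorem blk_gact (g : Fin 2 → GM α A) (h : Option (Option Q1) → GM α A) (M : Matrix (RR α) (CC Q1 α) A)
    (s : Fin 2) (b : Q0) (t : Option (Option Q1)) (b' : Q0) :
    blk (gact g h M) s b t b' = g s b * blk M s b t b' * h t b' := rfl

theorem blk_ext (M M' : Matrix (RR α) (CC Q1 α) A) (h : ∀ s b t b', blk M s b t b' = blk M' s b t b') : M = M' := by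
  ext ⟨s, b, i⟩ ⟨t, b', j⟩
  exact congrFun (congrFun (h s b t b') i) j

theorem gact_mul (g g' : Fin 2 → GM α A) (h h' : Option (Option Q1) → GM α A) (M : Matrix (RR α) (CC Q1 α) A) :
    gact (g * g') (h' * h) M = gact g h (gact g' h' M) := by
  apply blk_ext
  intro s b t b'
  simp only [blk_gact, Pi.mul_apply, Matrix.mul_assoc]

def vv (M : Matrix (RR α) (CC Q1 α) A) : VQ → A := fun v =>
  (blk M 1 (ha v.1) (some none) (ha v.1) * (blk M 0 (ha v.1) (some none) (ha v.1)).adjugate *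
    (blk M 0 (ha v.1) (some (some v.1)) (ta v.1) * (blk M 1 (ta v.1) (some (some v.1)) (ta v.1)).adjugate))
    v.2.1 v.2.2

theorem mul_adj_one {n : Type} [Fintype n] [DecidableEq n] (g : Matrix n n A) (h : g.det = 1) :
    g * g.adjugate = 1 := by rw [Matrix.mul_adjugate, h, one_smul]

theorem sandw {n k l : Type} [Fintype n] [DecidableEq n] (X : Matrix k n A) (Y : Matrix n l A)
    (h : Matrix n n A) (hh : h.det = 1) : (X * h) * (h.adjugate * Y) = X * Y := by
  rw [Matrix.mul_assoc, ← Matrix.mul_assoc h, mul_adj_one h hh, Matrix.one_mul]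

theorem vv_gact (g : Fin 2 → GM α A) (h : Option (Option Q1) → GM α A)
    (hg : ∀ s b, (g s b).det = 1) (hh : ∀ t b, (h t b).det = 1) (M : Matrix (RR α) (CC Q1 α) A) :
    vv (ta := ta) (ha := ha) (gact g h M) = cj (g 1) (vv M) := by
  funext v
  have hg0 : (g 0 (ha v.1)).adjugate * g 0 (ha v.1) = 1 := by rw [Matrix.adjugate_mul, hg, one_smul]
  show _ = (g 1 (ha v.1) * vmat (vv (ta := ta) (ha := ha) M) v.1 * (g 1 (ta v.1)).adjugate) v.2.1 v.2.2
  have e : vmat (vv (ta := ta) (ha := ha) M) v.1 =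
    (blk M 1 (ha v.1) (some none) (ha v.1) * (blk M 0 (ha v.1) (some none) (ha v.1)).adjugate *
    (blk M 0 (ha v.1) (some (some v.1)) (ta v.1) * (blk M 1 (ta v.1) (some (some v.1)) (ta v.1)).adjugate)) := rfl
  rw [e, vv]
  simp only [blk_gact, Matrix.adjugate_mul_distrib]
  rw [sandw _ _ _ (hh _ _), Matrix.mul_assoc (g 0 (ha v.1)), Matrix.mul_assoc (g 0 (ha v.1)), sandw _ _ _ (hh _ _)]
  congr 2
  simp only [Matrix.mul_assoc]
  rw [← Matrix.mul_assoc (g 0 (ha v.1)).adjugate, hg0, Matrix.one_mul]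

def mb {A : Type} [Zero A] (x : VQ → A) (a : Q1) (b b' : Q0) : Matrix (Fin (α b)) (Fin (α b')) A :=
  if h : ha a = b ∧ ta a = b' then h.1 ▸ h.2 ▸ vmat x a else 0

theorem mb_self {A : Type} [Zero A] (x : VQ → A) (a : Q1) : mb x a (ha a) (ta a) = vmat x a := by
  rw [mb, dif_pos ⟨rfl, rfl⟩]

theorem mb_cj (x : VQ → A) (g : GM α A) (a : Q1) (b b' : Q0) :
    mb (cj g x) a b b' = g b * mb x a b b' * (g b').adjugate := by
  by_cases h : ha a = b ∧ ta a = b'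
  · obtain ⟨rfl, rfl⟩ := h
    rw [mb_self, mb_self, vmat_cj]
  · rw [mb, dif_neg h, mb, dif_neg h]; simp

def ib (A : Type) [Zero A] [One A] (b b' : Q0) : Matrix (Fin (α b)) (Fin (α b')) A :=
  Matrix.of fun i j => if (⟨b, i⟩ : II α) = ⟨b', j⟩ then 1 else 0

theorem ib_self (b : Q0) : ib (α := α) A b b = 1 := by
  ext i j
  rw [ib, of_apply, Matrix.one_apply]
  by_cases h : i = j
  · subst h; simp
  · rw [if_neg h, if_neg]
    intro hh; simp at hh; exact h hh

theorem ib_conj (g : GM α A) (hg : ∀ b, (g b).det = 1) (b b' : Q0) :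
    g b * ib (α := α) A b b' * (g b').adjugate = ib (α := α) A b b' := by
  by_cases h : b = b'
  · subst h; rw [ib_self, Matrix.mul_one, mul_adj_one _ (hg b)]
  · have : ib (α := α) A b b' = 0 := by
      ext i j
      rw [ib, of_apply, if_neg]; rfl
      intro hh; exact h (Sigma.mk.inj_iff.1 hh).1
    rw [this]; simp

def mv (x : VQ → A) : Matrix (RR α) (CC Q1 α) A := Matrix.of fun r c =>
  (match r.1, c.1 with
    | _, none => (0 : Matrix (Fin (α r.2.1)) (Fin (α c.2.1)) A)
    | _, some none => ib A r.2.1 c.2.1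
    | 0, some (some a) => mb x a r.2.1 c.2.1
    | 1, some (some _) => ib A r.2.1 c.2.1) r.2.2 c.2.2

theorem vv_mv (x : VQ → A) : vv (mv x) = x := by
  funext v
  have e1 : blk (mv x) 1 (ha v.1) (some none) (ha v.1) = ib A _ _ := rfl
  have e2 : blk (mv x) 0 (ha v.1) (some none) (ha v.1) = ib A _ _ := rfl
  have e3 : blk (mv x) 1 (ta v.1) (some (some v.1)) (ta v.1) = ib A _ _ := rfl
  have e4 : blk (mv x) 0 (ha v.1) (some (some v.1)) (ta v.1) = mb x v.1 _ _ := rfl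
  rw [vv, e1, e2, e3, e4, ib_self, ib_self, mb_self]
  simp [vmat]

theorem mv_cj (x : VQ → A) (g : GM α A) (hg : ∀ b, (g b).det = 1) :
    mv (cj g x) = gact (fun _ => g) (fun t b => if t = none then 1 else (g b).adjugate) (mv x) := by
  apply blk_ext
  intro s b t b'
  rw [blk_gact]
  rcases t with _ | _ | a
  · have : ∀ y : VQ → A, blk (mv y) s b none b' = 0 := fun y => by
      fin_cases s <;> rfl
    rw [this, this]; simp
  · have : ∀ y : VQ → A, blk (mv y) s b (some none) b' = ib A b b' := fun y => by
      fin_cases s <;> rfl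
    rw [this, this, if_neg (by simp), ib_conj g hg]
  · rw [if_neg (by simp)]
    fin_cases s
    · exact mb_cj x g a b b'
    · exact (ib_conj g hg b b').symm

theorem mv_map {B : Type} [CommRing B] (φ : A →+* B) (x : VQ → A) :
    (mv x).map φ = mv (fun v => φ (x v)) := by
  have hi : ∀ b b', (ib (α := α) A b b').map φ = ib B b b' := by
    intro b b'; ext i j; simp [ib, apply_ite φ]
  apply blk_ext
  intro s b t b'
  have e : blk ((mv x).map φ) s b t b' = (blk (mv x) s b t b').map φ := rfl
  rw [e]
  rcases t with _ | _ | a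
  · fin_cases s <;> · ext i j; exact map_zero φ
  · fin_cases s <;> exact hi b b'
  · fin_cases s
    · show (mb x a b b').map φ = mb (fun v => φ (x v)) a b b'
      by_cases h : ha a = b ∧ ta a = b'
      · obtain ⟨rfl, rfl⟩ := h
        rw [mb_self, mb_self]; rfl
      · rw [mb, dif_neg h, mb, dif_neg h]; ext i j; exact map_zero φ
    · exact hi b b'

theorem vv_map {B : Type} [CommRing B] (φ : A →+* B) (M : Matrix (RR α) (CC Q1 α) A) (v : VQ) :
    φ (vv M v) = vv (M.map φ) v := by
  have e : ∀ s b t b', blk (M.map φ) s b t b' = (blk M s b t b').map φ := fun _ _ _ _ => rfl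
  have e2 : ∀ {n : Type} [Fintype n] [DecidableEq n] (X : Matrix n n A), (X.map φ).adjugate = X.adjugate.map φ :=
    fun X => (RingHom.map_adjugate φ X).symm
  rw [vv, vv]
  simp only [e, e2, ← Matrix.map_mul]
  rfl

end blocks

section positions
variable {Q0 Q1 : Type} [Fintype Q0] [Fintype Q1]

theorem exists_omega (α : Q0 → ℕ) : ∃ (n : ℕ) (ω : II α ≃ Fin n), ∀ b (i j : Fin (α b)),
    (ω ⟨b, i⟩).1 + j.1 = (ω ⟨b, j⟩).1 + i.1 := by
  classical
  let e := Fintype.equivFin Q0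
  let e1 : II α ≃ (c : Fin (Fintype.card Q0)) × Fin (α (e.symm c)) :=
    Equiv.sigmaCongrLeft' e
  refine ⟨_, e1.trans finSigmaFinEquiv, ?_⟩
  intro b i j
  have h : ∀ i : Fin (α b), e1 ⟨b, i⟩ = ⟨e b, Fin.cast (by rw [e.symm_apply_apply]) i⟩ := by
    intro i
    rw [Equiv.apply_eq_iff_eq_symm_apply]
    symm
    show (⟨e.symm (e b), _⟩ : II α) = ⟨b, i⟩
    refine Sigma.ext (e.symm_apply_apply b) ?_
    rw [Fin.heq_ext_iff (congrArg α (e.symm_apply_apply b))]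
    rfl
  rw [Equiv.trans_apply, Equiv.trans_apply, h, h, finSigmaFinEquiv_apply, finSigmaFinEquiv_apply]
  simp only [Fin.val_cast]
  omega

theorem exists_pos (Q1 : Type) [Fintype Q1] (α : Q0 → ℕ) : ∃ (m N : ℕ) (er : RR α ≃ Fin m) (ec : CC Q1 α ≃ Fin N) (δ₀ : ℤ),
    (∀ s b (i j : Fin (α b)), (er (s, ⟨b, i⟩)).1 + j.1 = (er (s, ⟨b, j⟩)).1 + i.1) ∧
    (∀ s b (i j : Fin (α b)), (ec (s, ⟨b, i⟩)).1 + j.1 = (ec (s, ⟨b, j⟩)).1 + i.1) ∧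
    (∀ v, off er ec v = δ₀ ↔ v.1.1 = 1 ∧ v.2.1 = none ∧ v.1.2 = v.2.2) := by
  classical
  obtain ⟨n, ω, hω⟩ := exists_omega α
  let e3 : Option (Option Q1) ≃ Fin (Fintype.card (Option Q1) + 1) :=
    (Equiv.optionCongr (Fintype.equivFin (Option Q1))).trans (finSuccEquiv _).symm
  have h3 : e3 none = 0 := by simp [e3]
  refine ⟨_, _, (Equiv.prodCongr (Equiv.refl _) ω).trans finProdFinEquiv,
    (Equiv.prodCongr e3 ω).trans finProdFinEquiv, -(n : ℤ), ?_, ?_, ?_⟩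
  · intro s b i j
    have := hω b i j
    simp only [Equiv.trans_apply, Equiv.prodCongr_apply, Prod.map, finProdFinEquiv_apply_val, Equiv.refl_apply]
    omega
  · intro s b i j
    have := hω b i j
    simp only [Equiv.trans_apply, Equiv.prodCongr_apply, Prod.map, finProdFinEquiv_apply_val]
    omega
  · rintro ⟨⟨s, x⟩, ⟨t, y⟩⟩
    simp only [off, Equiv.trans_apply, Equiv.prodCongr_apply, Prod.map, finProdFinEquiv_apply_val, Equiv.refl_apply]
    have b1 := (ω x).2
    have b2 := (ω y).2
    have key : (s = 1 ∧ t = none ∧ x = y) ↔ (s.1 = 1 ∧ (e3 t).1 = 0 ∧ (ω x).1 = (ω y).1) := by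
      rw [Fin.ext_iff, ← ω.injective.eq_iff (a := x), Fin.ext_iff, ← e3.injective.eq_iff, h3, Fin.ext_iff]; rfl
    rw [key]
    have hs : s.1 = 0 ∨ s.1 = 1 := by omega
    have ht : (e3 t).1 = 0 ∨ n ≤ n * (e3 t).1 := by
      rcases Nat.eq_zero_or_pos (e3 t).1 with h | h
      · exact Or.inl h
      · exact Or.inr (Nat.le_mul_of_pos_right _ h)
    have hs' : s.1 = 0 ∧ n * s.1 = 0 ∨ s.1 = 1 ∧ n * s.1 = n := by
      rcases hs with h | h <;> rw [h] <;> simp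
    have ht' : (e3 t).1 = 0 ∧ n * (e3 t).1 = 0 ∨ (e3 t).1 ≠ 0 ∧ n ≤ n * (e3 t).1 := by
      rcases Nat.eq_zero_or_pos (e3 t).1 with h | h
      · rw [h]; simp
      · exact Or.inr ⟨by omega, Nat.le_mul_of_pos_right _ h⟩
    generalize n * s.1 = u at *
    generalize n * (e3 t).1 = u' at *
    omega
end positions

section invM
variable {K : Type} [Field K] {Q0 Q1 : Type} [Fintype Q0] [Fintype Q1] [DecidableEq Q0] [DecidableEq Q1]
  {ta ha : Q1 → Q0} {α : Q0 → ℕ}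

noncomputable def iot (f : SK) : MP (RR α × CC Q1 α) K :=
  aeval (vv (Xm K (RR α) (CC Q1 α))) f

noncomputable def dz (K : Type) [Field K] (Q1 : Type) (α : Q0 → ℕ) : MP (RR α × CC Q1 α) K :=
  ∏ b, (blk (Xm K (RR α) (CC Q1 α)) 1 b none b).det

def InvG (f : MP (RR α × CC Q1 α) K) : Prop :=
  ∀ (g : Fin 2 → GM α K) (h : Option (Option Q1) → GM α K), (∀ s b, (g s b).det = 1) →
    (∀ t b, (h t b).det = 1) → h none = 1 → ∀ M : Matrix (RR α) (CC Q1 α) K, sbt (gact g h M) f = sbt M f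

def InvM (f : MP (RR α × CC Q1 α) K) : Prop :=
  (∀ s b (i j : Fin (α b)), (i.1 + 1 = j.1 ∨ j.1 + 1 = i.1) → IRow (s, ⟨b, i⟩) (s, ⟨b, j⟩) f) ∧
  (∀ s b (i j : Fin (α b)), s ≠ none → (i.1 + 1 = j.1 ∨ j.1 + 1 = i.1) → ICol (s, ⟨b, i⟩) (s, ⟨b, j⟩) f)

theorem map_Xm {B : Type} [CommRing B] [Algebra K B] {ρ γ : Type} (M : Matrix ρ γ B) :
    (Xm K ρ γ).map (sbt M) = M := by
  ext i j; exact aeval_X _ _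

theorem sbt_iot {B : Type} [CommRing B] [Algebra K B] (M : Matrix (RR α) (CC Q1 α) B)
    (f : SK) : sbt M (iot f) = aeval (vv M) f := by
  rw [iot, ← AlgHom.comp_apply, comp_aeval]
  congr 2
  funext v
  refine (vv_map (sbt M).toRingHom (Xm K (RR α) (CC Q1 α)) v).trans ?_
  exact congrArg (fun M' => vv M' v) (map_Xm M)

theorem sbt_dz {B : Type} [CommRing B] [Algebra K B] (M : Matrix (RR α) (CC Q1 α) B) :
    sbt M (dz K Q1 α) = ∏ b, (blk M 1 b none b).det := by
  rw [dz, map_prod]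
  refine prod_congr rfl fun b _ => ?_
  refine (RingHom.map_det (sbt M).toRingHom _).trans ?_
  congr 1
  ext i j; exact aeval_X _ _

theorem InvG_iot [Infinite K] (f : SK) (hf : f ∈ QS) :
    InvG (iot f) := by
  intro g h hg hh _ M
  rw [sbt_iot, sbt_iot, vv_gact g h hg hh]
  rw [mem_SL] at hf
  have := aeval_act (g 1) (vv (ta := ta) (ha := ha) M) f
  rw [hf (g 1) (hg 1)] at this
  exact this.symm

theorem InvG_dz : InvG (dz K Q1 α) := by
  intro g h hg hh h1 M
  rw [sbt_dz, sbt_dz]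
  refine prod_congr rfl fun b _ => ?_
  rw [blk_gact, det_mul, det_mul, hg, hh, one_mul, mul_one]

theorem InvG.mul {f f' : MP (RR α × CC Q1 α) K} (h : InvG f) (h' : InvG f') : InvG (f * f') := by
  intro g k hg hk h1 M
  rw [map_mul, map_mul, h g k hg hk h1, h' g k hg hk h1]

theorem InvG.pow {f : MP (RR α × CC Q1 α) K} (h : InvG f) (n : ℕ) : InvG (f ^ n) := by
  intro g k hg hk h1 M
  rw [map_pow, map_pow, h g k hg hk h1]

theorem rop_eq (s : Fin 2) (b : Q0) (i j : Fin (α b)) (c : K) (M : Matrix (RR α) (CC Q1 α) K) :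
    rop (s, ⟨b, i⟩) (s, ⟨b, j⟩) c M = gact (Function.update 1 s (el b i j c)) 1 M := by
  apply blk_ext
  intro s' b' t b''
  rw [blk_gact]
  rw [show (1 : Option (Option Q1) → GM α K) t b'' = 1 from rfl, Matrix.mul_one]
  by_cases hs : s' = s
  · subst hs
    rw [Function.update_self, el]
    by_cases hb : b' = b
    · subst hb
      rw [Function.update_self]
      ext x y
      rw [trm, blk, of_apply, rop, of_apply]
      by_cases hx : x = i
      · subst hx; rw [if_pos rfl, if_pos rfl]; rfl
      · rw [if_neg hx, if_neg]; rfl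
        intro hh; simp at hh; exact hx hh
    · rw [Function.update_of_ne hb]
      rw [show (1 : GM α K) b' = 1 from rfl, Matrix.one_mul]
      ext x y
      rw [blk, of_apply, rop, of_apply, if_neg, add_zero]; rfl
      intro hh; simp at hh; exact hb hh.1
  · rw [Function.update_of_ne hs]
    rw [show (1 : Fin 2 → GM α K) s' b' = 1 from rfl, Matrix.one_mul]
    ext x y
    rw [blk, of_apply, rop, of_apply, if_neg, add_zero]; rfl
    intro hh; simp at hh; exact hs hh.1

theorem mtr {n m : Type} [Fintype n] [DecidableEq n] {A : Type} [CommRing A] (i j : n) (c : A)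
    (M : Matrix m n A) (a : m) (b : n) :
    (M * transvection i j c) a b = M a b + if b = j then c * M a i else 0 := by
  by_cases h : b = j
  · subst h; rw [mul_transvection_apply_same, if_pos rfl]
  · rw [mul_transvection_apply_of_ne _ _ _ _ h, if_neg h, add_zero]

theorem cop_eq (s : Option (Option Q1)) (b : Q0) (i j : Fin (α b)) (c : K) (M : Matrix (RR α) (CC Q1 α) K) :
    cop (s, ⟨b, i⟩) (s, ⟨b, j⟩) c M = gact 1 (Function.update 1 s (el b j i c)) M := by
  apply blk_ext
  intro t b'' s' b'
  rw [blk_gact]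
  rw [show (1 : Fin 2 → GM α K) t b'' = 1 from rfl, Matrix.one_mul]
  by_cases hs : s' = s
  · subst hs
    rw [Function.update_self, el]
    by_cases hb : b' = b
    · subst hb
      rw [Function.update_self]
      ext x y
      rw [mtr, blk, of_apply, cop, of_apply]
      by_cases hx : y = i
      · subst hx; rw [if_pos rfl, if_pos rfl]; rfl
      · rw [if_neg hx, if_neg]; rfl
        intro hh; simp at hh; exact hx hh
    · rw [Function.update_of_ne hb]
      rw [show (1 : GM α K) b' = 1 from rfl, Matrix.mul_one]
      ext x y
      rw [blk, of_apply, cop, of_apply, if_neg, add_zero]; rfl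
      intro hh; simp at hh; exact hb hh.1
  · rw [Function.update_of_ne hs]
    rw [show (1 : Option (Option Q1) → GM α K) s' b' = 1 from rfl, Matrix.mul_one]
    ext x y
    rw [blk, of_apply, cop, of_apply, if_neg, add_zero]; rfl
    intro hh; simp at hh; exact hs hh.1

theorem det_el (b : Q0) (i j : Fin (α b)) (c : K) (h : i ≠ j) (b' : Q0) : (el b i j c b').det = 1 := by
  rw [el]
  by_cases hb : b' = b
  · subst hb; rw [Function.update_self, det_transvection_of_ne _ _ h]
  · rw [Function.update_of_ne hb]; exact det_one

theorem det_upd {ι : Type} [DecidableEq ι] (s : ι) (x : GM α K) (hx : ∀ b, (x b).det = 1) (s' : ι) (b : Q0) :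
    ((Function.update 1 s x : ι → GM α K) s' b).det = 1 := by
  by_cases hs : s' = s
  · subst hs; rw [Function.update_self, hx]
  · rw [Function.update_of_ne hs]; exact det_one

theorem InvG.invM {f : MP (RR α × CC Q1 α) K} (h : InvG f) : InvM f := by
  constructor
  · intro s b i j hij t M
    have hne : i ≠ j := by rintro rfl; omega
    rw [rop_eq]
    exact h _ _ (det_upd s _ (det_el b i j t hne)) (fun _ _ => det_one) rfl M
  · intro s b i j hs hij t M
    have hne : j ≠ i := by rintro rfl; omega
    rw [cop_eq]
    exact h _ _ (fun _ _ => det_one) (det_upd s _ (det_el b j i t hne)) (Function.update_of_ne hs.symm _ _) M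

theorem adj_el (b : Q0) (i j : Fin (α b)) (c : K) (h : i ≠ j) (b' : Q0) :
    (el b i j c b').adjugate = el b i j (-c) b' := by
  have h1 : el b i j c b' * el b i j (-c) b' = 1 := by
    rw [el, el]
    by_cases hb : b' = b
    · subst hb
      rw [Function.update_self, Function.update_self, transvection_mul_transvection_same _ _ h]; simp
    · rw [Function.update_of_ne hb, Function.update_of_ne hb]; exact mul_one _
  calc (el b i j c b').adjugate = (el b i j c b').adjugate * (el b i j c b' * el b i j (-c) b') := by
        rw [h1, Matrix.mul_one]
    _ = _ := by rw [← Matrix.mul_assoc, Matrix.adjugate_mul, det_el b i j c h, one_smul, Matrix.one_mul]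

noncomputable def pii (f : MP (RR α × CC Q1 α) K) : SK :=
  sbt (mv X) f

theorem pii_iot (f : SK) : pii (iot f) = f := by
  rw [pii, sbt_iot, vv_mv]
  exact congrArg (fun g => g f) aeval_X_left

theorem gact_one (M : Matrix (RR α) (CC Q1 α) K) : gact 1 1 M = M := by
  apply blk_ext
  intro s b t b'
  rw [blk_gact]
  show (1 : Matrix (Fin (α b)) (Fin (α b)) K) * _ * (1 : Matrix (Fin (α b')) (Fin (α b')) K) = _
  rw [Matrix.one_mul, Matrix.mul_one]

theorem pii_mem [Infinite K] (f : MP (RR α × CC Q1 α) K) (hf : InvM f) :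
    (pii f : SK) ∈ QS := by
  apply mem_SL_of_el
  intro b i j c hij
  have hne : i ≠ j := by rintro rfl; omega
  apply MvPolynomial.funext
  intro x
  have hx : ∀ x : VQ → K, aeval x (pii f : SK) = sbt (mv x) f := by
    intro x
    rw [pii, sbt_map]
    congr 1
    congr 1
    refine (mv_map (aeval x : SK →ₐ[K] K).toRingHom X).trans ?_
    congr 1
    funext v
    exact aeval_X _ _
  show aeval x (act (el b i j c) (pii f)) = aeval x (pii f : SK)
  rw [aeval_act, hx, hx]
  have e0 : gmap (algebraMap K K) (el b i j c) = el b i j c := by funext b; ext x y; rfl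
  rw [e0, mv_cj _ _ (det_el b i j c hne)]
  have hrow : ∀ (T : Finset (Fin 2)) M, sbt (gact (fun s => if s ∈ T then el b i j c else 1) 1 M) f = sbt M f := by
    intro T
    induction T using Finset.induction_on with
    | empty => intro M; simp only [Finset.notMem_empty, if_false]; rw [show gact (fun _ => 1) 1 M = M from gact_one M]
    | insert s T hs ih =>
      intro M
      have e : (fun s' => if s' ∈ insert s T then el b i j c else 1 : Fin 2 → GM α K) =
          (Function.update 1 s (el b i j c) : Fin 2 → GM α K) * (fun s => if s ∈ T then el b i j c else 1) := by
        funext s'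
        rw [Pi.mul_apply]
        by_cases hb' : s' = s
        · subst hb'; simp [hs]
        · simp [hb']
      rw [e, show (1 : Option (Option Q1) → GM α K) = 1 * 1 from (mul_one _).symm, gact_mul, ← rop_eq,
        hf.1 s b i j hij, ih]
  have hcol : ∀ (T : Finset (Option (Option Q1))) M, none ∉ T →
      sbt (gact 1 (fun s => if s ∈ T then el b i j (-c) else 1) M) f = sbt M f := by
    intro T
    induction T using Finset.induction_on with
    | empty => intro M _; simp only [Finset.notMem_empty, if_false]; rw [show gact 1 (fun _ => 1) M = M from gact_one M]
    | insert s T hs ih =>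
      intro M hn
      have e : (fun s' => if s' ∈ insert s T then el b i j (-c) else 1 : Option (Option Q1) → GM α K) =
          (fun s => if s ∈ T then el b i j (-c) else 1) * (Function.update 1 s (el b i j (-c)) : Option (Option Q1) → GM α K) := by
        funext s'
        rw [Pi.mul_apply]
        by_cases hb' : s' = s
        · subst hb'; simp [hs]
        · simp [hb']
      have hn1 : s ≠ none := fun h => hn (h ▸ Finset.mem_insert_self s T)
      rw [e, show (1 : Fin 2 → GM α K) = 1 * 1 from (mul_one _).symm, gact_mul, ← cop_eq,
        hf.2 s b j i hn1 hij.symm, ih _ (fun h => hn (Finset.mem_insert_of_mem h))]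
  have e1 : gact (fun _ => el b i j c) (fun t b' => if t = none then 1 else (el b i j c b').adjugate) (mv x) =
      gact (fun s => if s ∈ (univ : Finset (Fin 2)) then el b i j c else 1) 1
        (gact 1 (fun s => if s ∈ (univ.erase none : Finset (Option (Option Q1))) then el b i j (-c) else 1) (mv x)) := by
    rw [← gact_mul, mul_one, mul_one]
    congr 1
    · simp
    · funext t b'
      by_cases ht : t = none
      · simp [ht]
      · simp only [ht, if_false, Finset.mem_erase, mem_univ, and_true, ne_eq, not_false_eq_true, if_true]
        exact adj_el b i j c hne b'
  rw [e1, hrow, hcol _ _ (by simp)]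

end invM

section rt
variable {K : Type} [Field K] {Q0 Q1 : Type} [Fintype Q0] [Fintype Q1] [DecidableEq Q0] [DecidableEq Q1]
  {ta ha : Q1 → Q0} {α : Q0 → ℕ}

theorem Lead_dz {m N : ℕ} (er : RR α ≃ Fin m) (ec : CC Q1 α ≃ Fin N) (δ₀ : ℤ)
    (h : ∀ v, off er ec v = δ₀ ↔ v.1.1 = 1 ∧ v.2.1 = none ∧ v.1.2 = v.2.2) :
    Lead (wof er ec) (dz K Q1 α * Fp er ec δ₀ (Xm K (RR α) (CC Q1 α))) (topE (RR α × CC Q1 α) 1) := by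
  refine Lead_Fp er ec δ₀ _ (∑ b : Q0, ∑ i : Fin (α b), Finsupp.single
    (((1 : Fin 2), (⟨b, i⟩ : II α)), ((none : Option (Option Q1)), (⟨b, i⟩ : II α))) 1) ?_ ?_
  · rw [dz]
    refine Lead.prod _ univ _ _ fun b _ => ?_
    refine Lead_det er ec (fun i => ((1 : Fin 2), (⟨b, i⟩ : II α)))
      (fun i => ((none : Option (Option Q1)), (⟨b, i⟩ : II α))) δ₀ ?_ ?_
    · intro i j hij
      simpa using hij
    · intro i; rw [h]; exact ⟨rfl, rfl, rfl⟩
  · rintro ⟨⟨s, x⟩, ⟨t, y⟩⟩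
    rw [← Fintype.sum_sigma' (f := fun (b : Q0) (i : Fin (α b)) => (Finsupp.single
      (((1 : Fin 2), (⟨b, i⟩ : II α)), ((none : Option (Option Q1)), (⟨b, i⟩ : II α))) 1 : RR α × CC Q1 α →₀ ℕ)),
      Finsupp.finset_sum_apply]
    by_cases hh : s = 1 ∧ t = none ∧ x = y
    · rw [if_pos ((h _).2 hh)]
      obtain ⟨rfl, rfl, rfl⟩ := hh
      rw [sum_eq_single x]
      · exact Finsupp.single_eq_same
      · intro z _ hz
        rw [Finsupp.single_apply, if_neg]
        intro he; apply hz; simpa using he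
      · intro hx; exact absurd (mem_univ _) hx
    · rw [if_neg (fun h' => hh ((h _).1 h'))]
      refine sum_eq_zero fun z _ => ?_
      rw [Finsupp.single_apply, if_neg]
      intro he
      apply hh
      simp only [Prod.mk.injEq] at he
      exact ⟨he.1.1.symm, he.2.1.symm, he.1.2.symm.trans he.2.2⟩

theorem InvM_trq [Infinite K] (p : ℕ) [Fact p.Prime] [CharP K p] [PerfectRing K p] (n : ℕ)
    {m N : ℕ} (er : RR α ≃ Fin m) (ec : CC Q1 α ≃ Fin N) (δ₀ : ℤ)
    (h1 : ∀ s b (i j : Fin (α b)), (er (s, ⟨b, i⟩)).1 + j.1 = (er (s, ⟨b, j⟩)).1 + i.1)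
    (h2 : ∀ s b (i j : Fin (α b)), (ec (s, ⟨b, i⟩)).1 + j.1 = (ec (s, ⟨b, j⟩)).1 + i.1)
    (a : MP (RR α × CC Q1 α) K) (ha : InvG a) :
    InvM (trq p n (a * Fp er ec δ₀ (Xm K (RR α) (CC Q1 α)) ^ (p ^ n - 1))) := by
  have hM := ha.invM
  constructor
  · intro s b i j hij
    refine tr_IRow er ec p n δ₀ _ _ ?_ a (hM.1 s b i j hij)
    have := h1 s b i j
    omega
  · intro s b i j hs hij
    refine tr_ICol er ec p n δ₀ _ _ ?_ a (hM.2 s b i j hs hij)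
    have := h2 s b i j
    omega

noncomputable def Rt (K : Type) [Field K] (Q1 : Type) [Fintype Q1] [DecidableEq Q1] (α : Q0 → ℕ) :
    Subalgebra K (Matrix (RR α) (CC Q1 α) K → K) where
  carrier := {φ | ∃ (k : ℕ) (f : MP (RR α × CC Q1 α) K), ∀ M, sbt M f = sbt M (dz K Q1 α) ^ k * φ M}
  mul_mem' := by
    rintro φ ψ ⟨k, f, hf⟩ ⟨l, g, hg⟩
    refine ⟨k + l, f * g, fun M => ?_⟩
    rw [map_mul, hf, hg, Pi.mul_apply]; ring
  add_mem' := by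
    rintro φ ψ ⟨k, f, hf⟩ ⟨l, g, hg⟩
    refine ⟨k + l, dz K Q1 α ^ l * f + dz K Q1 α ^ k * g, fun M => ?_⟩
    rw [map_add, map_mul, map_mul, map_pow, map_pow, hf, hg, Pi.add_apply]; ring
  algebraMap_mem' := by
    intro a
    refine ⟨0, C a, fun M => ?_⟩
    rw [pow_zero, one_mul]; exact aeval_C _ _

noncomputable def evR (M : Matrix (RR α) (CC Q1 α) K) : Rt K Q1 α →ₐ[K] K :=
  (Pi.evalAlgHom K (fun _ => K) M).comp (Rt K Q1 α).val

noncomputable def Mu (K : Type) [Field K] (Q1 : Type) [Fintype Q1] [DecidableEq Q1] (α : Q0 → ℕ) :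
    Matrix (RR α) (CC Q1 α) (Rt K Q1 α) := Matrix.of fun r c => ⟨fun M => M r c, 0, X (r, c), fun M => by
      rw [pow_zero, one_mul]; exact aeval_X _ _⟩

noncomputable def idet (K : Type) [Field K] (Q1 : Type) [Fintype Q1] [DecidableEq Q1] (α : Q0 → ℕ) (b : Q0) :
    Rt K Q1 α := ⟨fun M => (blk M 1 b none b).det⁻¹, 2, dz K Q1 α *
      ∏ b' ∈ univ.erase b, (blk (Xm K (RR α) (CC Q1 α)) 1 b' none b').det, fun M => by
      have h : ∀ b', sbt M (blk (Xm K (RR α) (CC Q1 α)) 1 b' none b').det = (blk M 1 b' none b').det := by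
        intro b'
        refine (RingHom.map_det (sbt M).toRingHom _).trans ?_
        congr 1
        ext i j; exact aeval_X _ _
      rw [map_mul, map_prod, sbt_dz, prod_congr rfl (fun b' _ => h b'),
        ← mul_prod_erase univ _ (mem_univ b)]
      by_cases h0 : (blk M 1 b none b).det = 0
      · rw [h0]; simp
      · field_simp⟩

noncomputable def Ph (K : Type) [Field K] (Q1 : Type) [Fintype Q1] [DecidableEq Q1] (α : Q0 → ℕ) :
    GM α (Rt K Q1 α) := fun b => blk (Mu K Q1 α) 1 b none b *
      diagonal (fun i : Fin (α b) => if i.1 = 0 then idet K Q1 α b else 1)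

noncomputable def kap (K : Type) [Field K] {Q1 : Type} [Fintype Q1] [DecidableEq Q1] (ta ha : Q1 → Q0) (α : Q0 → ℕ) :
    VQ → Rt K Q1 α := cj (fun b => (Ph K Q1 α b).adjugate) (vv (Mu K Q1 α))

noncomputable def Ph0 (M : Matrix (RR α) (CC Q1 α) K) : GM α K := fun b => blk M 1 b none b *
      diagonal (fun i : Fin (α b) => if i.1 = 0 then (blk M 1 b none b).det⁻¹ else 1)

theorem gmap_Ph (M : Matrix (RR α) (CC Q1 α) K) : gmap (evR M).toRingHom (Ph K Q1 α) = Ph0 M := by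
  funext b
  rw [gmap, Ph, Matrix.map_mul, Ph0]
  congr 1
  rw [diagonal_map (map_zero _)]
  congr 1
  funext i
  by_cases hi : i.1 = 0
  · simp only [hi, if_true]; rfl
  · simp only [hi, if_false]; exact map_one _

theorem det_Ph0 (M : Matrix (RR α) (CC Q1 α) K) (hM : sbt M (dz K Q1 α) ≠ 0) (b : Q0) : (Ph0 M b).det = 1 := by
  have hb : (blk M 1 b none b).det ≠ 0 := by
    rw [sbt_dz, prod_ne_zero_iff] at hM
    exact hM b (mem_univ _)
  rw [Ph0, det_mul, det_diagonal]
  rcases Nat.eq_zero_or_pos (α b) with h | h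
  · haveI : IsEmpty (Fin (α b)) := by rw [h]; infer_instance
    rw [det_isEmpty, Finset.univ_eq_empty, Finset.prod_empty, one_mul]
  · rw [prod_eq_single ⟨0, h⟩]
    · simp [hb]
    · intro i _ hi
      rw [if_neg]
      intro h'; exact hi (Fin.ext h')
    · intro h'; exact absurd (mem_univ _) h'

theorem ev_kap (M : Matrix (RR α) (CC Q1 α) K) :
    (fun v => evR M (kap K ta ha α v)) = cj (fun b => (Ph0 M b).adjugate) (vv M) := by
  refine (map_cj (evR M).toRingHom _ _).trans ?_
  congr 1
  · funext b
    show ((Ph K Q1 α b).adjugate).map (evR M).toRingHom = _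
    refine ((evR M).toRingHom.map_adjugate _).trans ?_
    exact congrArg (fun g => (g b).adjugate) (gmap_Ph M)
  · funext v
    exact vv_map _ _ _

theorem kap_inv (M : Matrix (RR α) (CC Q1 α) K) (g : Fin 2 → GM α K) (h : Option (Option Q1) → GM α K)
    (hg : ∀ s b, (g s b).det = 1) (hh : ∀ t b, (h t b).det = 1) (h1 : h none = 1) :
    (fun v => evR (gact g h M) (kap K ta ha α v)) = fun v => evR M (kap K ta ha α v) := by
  rw [ev_kap, ev_kap, vv_gact g h hg hh, ← cj_mul]
  congr 1
  funext b
  have e : Ph0 (gact g h M) b = g 1 b * Ph0 M b := by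
    rw [Ph0, Ph0, blk_gact, det_mul, det_mul, hg, hh, one_mul, mul_one, h1,
      show (1 : GM α K) b = 1 from rfl, Matrix.mul_one, Matrix.mul_assoc]
  rw [Pi.mul_apply, e, adjugate_mul_distrib, Matrix.mul_assoc, adjugate_mul, hg, one_smul, Matrix.mul_one]

theorem kap_eval [Infinite K] (M : Matrix (RR α) (CC Q1 α) K) (hM : sbt M (dz K Q1 α) ≠ 0)
    (f : SK) (hf : f ∈ QS) :
    aeval (fun v => evR M (kap K ta ha α v)) f = aeval (vv (ta := ta) (ha := ha) M) f := by
  rw [mem_SL] at hf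
  rw [ev_kap]
  have hd : ∀ b, ((Ph0 M b).adjugate).det = 1 := fun b => by rw [det_adjugate, det_Ph0 M hM, one_pow]
  have := aeval_act (fun b => (Ph0 M b).adjugate) (vv (ta := ta) (ha := ha) M) f
  rw [hf _ hd] at this
  exact this.symm

theorem exists_bt (b : SK) : ∃ k, 0 < k ∧ ∀ k' ≥ k, ∃ f : MP (RR α × CC Q1 α) K,
    InvG f ∧ ∀ M, sbt M f = sbt M (dz K Q1 α) ^ k' * aeval (fun v => evR M (kap K ta ha α v)) b := by
  obtain ⟨k, f, hf⟩ := (aeval (kap K ta ha α) b : Rt K Q1 α).2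
  have hf' : ∀ M, sbt M f = sbt M (dz K Q1 α) ^ k * aeval (fun v => evR M (kap K ta ha α v)) b := by
    intro M
    rw [hf]
    congr 1
    have : evR M (aeval (kap K ta ha α) b) = aeval (fun v => evR M (kap K ta ha α v)) b := by
      rw [← AlgHom.comp_apply, comp_aeval]
    exact this
  refine ⟨k + 1, by omega, fun k' hk => ?_⟩
  have h2 : ∀ M, sbt M (dz K Q1 α ^ (k' - k) * f) = sbt M (dz K Q1 α) ^ k' *
      aeval (fun v => evR M (kap K ta ha α v)) b := by
    intro M
    rw [map_mul, hf', map_pow, ← mul_assoc, ← pow_add]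
    congr 2; omega
  refine ⟨_, ?_, h2⟩
  intro g h hg hh h1 M
  rw [h2, h2, kap_inv M g h hg hh h1, InvG_dz g h hg hh h1]

end rt

theorem fin_hom {A B : Type} [CommRing A] [CommRing B] (φ : A →+* B) (h : φ.Finite) :
    ∃ (k : ℕ) (m : Fin k → B), ∀ a : B, ∃ x : Fin k → A, a = ∑ l, φ (x l) * m l := by
  letI := φ.toAlgebra
  have h4 : Module.Finite A B := h
  obtain ⟨k, m, hm⟩ := Module.Finite.exists_fin (R := A) (M := B)
  refine ⟨k, m, fun a => ?_⟩
  have ha : a ∈ Submodule.span A (Set.range m) := by rw [hm]; trivial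
  rw [Submodule.mem_span_range_iff_exists_fun] at ha
  obtain ⟨x, hx⟩ := ha
  exact ⟨x, by rw [← hx]; exact sum_congr rfl fun l _ => Algebra.smul_def _ _⟩

theorem frob_fin {K : Type} [Field K] {p : ℕ} [Fact p.Prime] [CharP K p] [PerfectRing K p]
    {R : Type} [CommRing R] [Algebra K R] [CharP R p] (hfg : Algebra.FiniteType K R) (e : ℕ) :
    ∃ (k : ℕ) (m : Fin k → R), ∀ a : R, ∃ x : Fin k → R, a = ∑ l, x l ^ p ^ e * m l := by
  classical
  let φ : R →+* R := iterateFrobenius R p e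
  have hφ : ∀ x, φ x = x ^ p ^ e := fun x => iterateFrobenius_def p e x
  obtain ⟨t, ht⟩ := hfg.out
  have h1 : φ.IsIntegral := by
    intro x
    refine ⟨Polynomial.X ^ p ^ e - Polynomial.C x, ?_, ?_⟩
    · exact Polynomial.monic_X_pow_sub_C _ (pow_ne_zero _ (Fact.out : p.Prime).ne_zero)
    · simp [hφ]
  have h2 : φ.FiniteType := by
    letI := φ.toAlgebra
    refine ⟨⟨t, ?_⟩⟩
    rw [eq_top_iff]
    rintro x -
    have hx : x ∈ Algebra.adjoin K (t : Set R) := by rw [ht]; trivial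
    induction hx using Algebra.adjoin_induction with
    | mem x hx => exact Algebra.subset_adjoin hx
    | algebraMap a =>
      have : algebraMap K R a = φ (algebraMap K R (qroot p e a)) := by
        rw [hφ, ← map_pow, pow_qroot]
      rw [this]
      exact Subalgebra.algebraMap_mem _ _
    | add x y _ _ hx hy => exact add_mem hx hy
    | mul x y _ _ hx hy => exact mul_mem hx hy
  have h3 : φ.Finite := RingHom.IsIntegral.to_finite h1 h2
  obtain ⟨k, m, hm⟩ := fin_hom φ h3
  refine ⟨k, m, fun a => ?_⟩
  obtain ⟨x, hx⟩ := hm a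
  exact ⟨x, by rw [hx]; exact sum_congr rfl fun l _ => by rw [← hφ]⟩

theorem trq_unit {K : Type} [Field K] (p : ℕ) [Fact p.Prime] [CharP K p] [PerfectRing K p]
    {τ : Type} [Fintype τ] [DecidableEq τ] (c : MP τ K) (hc : c ≠ 0) :
    ∃ (e : ℕ) (s : MP τ K) (u : K), u ≠ 0 ∧ trq p e (c * s) = C u := by
  obtain ⟨e, he⟩ : ∃ e, c.totalDegree < p ^ e := ⟨_, Nat.lt_pow_self (Fact.out : p.Prime).one_lt⟩
  obtain ⟨m, hm⟩ := Finset.nonempty_of_ne_empty (mt support_eq_empty.1 hc)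
  have hle : ∀ m ∈ c.support, ∀ v, m v < p ^ e := fun m hm v =>
    lt_of_le_of_lt ((Finsupp.le_degree v m).trans (le_totalDegree hm)) he
  refine ⟨e, monomial (topE τ (p ^ e - 1) - m) 1, qroot p e (coeff m c), ?_, ?_⟩
  · intro h
    have := pow_qroot p e (coeff m c)
    rw [h, zero_pow (pow_ne_zero _ (Fact.out : p.Prime).ne_zero)] at this
    exact (mem_support_iff.1 hm) this.symm
  · ext b
    rw [coeff_trq, coeff_mul_monomial', coeff_C]
    have hmt : ∀ v, m v ≤ p ^ e - 1 := fun v => by have := hle m hm v; omega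
    have hle2 : topE τ (p ^ e - 1) - m ≤ p ^ e • b + topE τ (p ^ e - 1) := by
      intro v
      simp only [Finsupp.coe_add, Finsupp.coe_tsub, Pi.add_apply, Pi.sub_apply, Finsupp.smul_apply]
      omega
    have heq : p ^ e • b + topE τ (p ^ e - 1) - (topE τ (p ^ e - 1) - m) = p ^ e • b + m := by
      ext v
      simp only [Finsupp.coe_add, Finsupp.coe_tsub, Pi.add_apply, Pi.sub_apply, Finsupp.smul_apply, topE_apply]
      have := hmt v
      omega
    rw [if_pos hle2, heq, mul_one]
    by_cases hb : 0 = b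
    · rw [if_pos hb, ← hb, smul_zero, zero_add]
    · rw [if_neg hb]
      have : coeff (p ^ e • b + m) c = 0 := by
        by_contra h
        obtain ⟨v, hv⟩ : ∃ v, b v ≠ 0 := by
          by_contra h'; push Not at h'; exact hb (Finsupp.ext fun v => (h' v).symm)
        have := hle _ (mem_support_iff.2 h) v
        simp only [Finsupp.coe_add, Pi.add_apply, Finsupp.smul_apply, smul_eq_mul] at this
        have : p ^ e * 1 ≤ p ^ e * b v := Nat.mul_le_mul_left _ (by omega)
        omega
      rw [this, qroot_zero]

section tcb
variable {K : Type} [Field K] [Infinite K] {Q0 Q1 : Type} [Fintype Q0] [Fintype Q1] [DecidableEq Q0] [DecidableEq Q1]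
  {ta ha : Q1 → Q0} {α : Q0 → ℕ} (p : ℕ) [Fact p.Prime] [CharP K p] [PerfectRing K p]

theorem tcb1 {ι : Type} (R : Subalgebra K SK) (hfg : R.FG) (r c : R) (hc : c ≠ 0) (J : Finset ι) (θ : ι → R)
    (h : ∀ n, c * r ^ p ^ n ∈ Ideal.span ((fun j => θ j ^ p ^ n) '' (J : Set ι))) :
    ∃ (k : ℕ) (b : Fin k → SK), ∀ n, ∃ x : ι → Fin k → R,
      (r.1 : SK) ^ p ^ n = ∑ j ∈ J, ∑ l, (x j l).1 * b l * (θ j).1 ^ p ^ n := by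
  haveI : CharP R p := charP_of_injective_algebraMap (algebraMap K R).injective p
  obtain ⟨e, s, u, hu, hs⟩ := trq_unit p c.1 (fun h => hc (Subtype.ext h))
  obtain ⟨k, m, hm⟩ := frob_fin (K := K) (p := p) (R := R) (R.fg_iff_finiteType.1 hfg) e
  refine ⟨k, fun l => C u⁻¹ * trq p e ((m l).1 * s), fun n => ?_⟩
  obtain ⟨z, hz⟩ := mem_span_image_fs J _ _ (h (n + e))
  choose x hx using fun j => hm (z j)
  refine ⟨x, ?_⟩
  have e1 : (r.1 ^ p ^ n) ^ p ^ e * (c.1 * s) = ∑ j ∈ J, ∑ l, ((x j l).1 * (θ j).1 ^ p ^ n) ^ p ^ e * ((m l).1 * s) := by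
    have := congrArg (fun y : R => y.1 * s) hz
    simp only [hx] at this
    push_cast at this
    rw [← pow_mul, ← pow_add]
    calc r.1 ^ p ^ (n + e) * (c.1 * s) = c.1 * r.1 ^ p ^ (n + e) * s := by ring
      _ = _ := by
        refine this.symm.trans ?_
        rw [Finset.sum_mul]
        refine sum_congr rfl fun j _ => ?_
        rw [Finset.sum_mul, Finset.sum_mul]
        refine sum_congr rfl fun l _ => ?_
        rw [mul_pow, ← pow_mul, ← pow_add]
        ring
  have e2 := congrArg (trq p e) e1
  rw [trq_pow_mul, hs, trq_sum] at e2
  have e3 : r.1 ^ p ^ n = r.1 ^ p ^ n * C u * C u⁻¹ := by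
    rw [mul_assoc, ← C_mul, mul_inv_cancel₀ hu, C_1, mul_one]
  rw [e3, e2, Finset.sum_mul]
  refine sum_congr rfl fun j _ => ?_
  rw [trq_sum, Finset.sum_mul]
  refine sum_congr rfl fun l _ => ?_
  rw [trq_pow_mul]; ring

theorem TCbig (ta ha : Q1 → Q0) (α : Q0 → ℕ) {ι : Type} (r c : QS) (hc : c ≠ 0) (J : Finset ι)
    (θ : ι → QS)
    (h : ∀ n, c * r ^ p ^ n ∈ Ideal.span ((fun j => θ j ^ p ^ n) '' (J : Set ι))) :
    r ∈ Ideal.span (θ '' (J : Set ι)) := by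
  obtain ⟨k, b, hb⟩ := tcb1 p _ (SL_fg_charp (ta := ta) (ha := ha) (α := α) p) r c hc J θ h
  choose κ hκ0 hκ using fun l => exists_bt (b l)
  let k0 := ∑ l, κ l + 1
  have hk0 : ∀ l, κ l ≤ k0 := fun l =>
    (Finset.single_le_sum (f := κ) (fun _ _ => Nat.zero_le _) (mem_univ l)).trans (Nat.le_succ _)
  choose bt hbt hbt' using fun l => hκ l k0 (hk0 l)
  obtain ⟨n, hn⟩ : ∃ n, k0 < p ^ n := ⟨_, Nat.lt_pow_self (Fact.out : p.Prime).one_lt⟩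
  obtain ⟨x, hx⟩ := hb n
  obtain ⟨m, N, er, ec, δ₀, h1, h2, h3⟩ := exists_pos Q1 α
  have e1 : dz K Q1 α ^ k0 * iot r.1 ^ p ^ n = ∑ j ∈ J, ∑ l, iot (x j l).1 * bt l * iot (θ j).1 ^ p ^ n := by
    apply MvPolynomial.funext
    intro y
    have hy : ∀ f : MP (RR α × CC Q1 α) K, eval y f = sbt (Matrix.of fun r c => y (r, c)) f := fun f => rfl
    rw [hy, hy]
    generalize (Matrix.of fun r c => y (r, c)) = M
    simp only [map_mul, map_pow, map_sum, hbt', sbt_iot]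
    by_cases hd : sbt M (dz K Q1 α) = 0
    · rw [hd, zero_pow (by omega), zero_mul]
      symm
      refine sum_eq_zero fun j _ => sum_eq_zero fun l _ => ?_
      ring
    · have := congrArg (aeval (fun v => evR M (kap K ta ha α v))) hx
      simp only [map_mul, map_pow, map_sum, kap_eval M hd _ (Subtype.prop _)] at this
      rw [this, Finset.mul_sum]
      refine sum_congr rfl fun j _ => ?_
      rw [Finset.mul_sum]
      refine sum_congr rfl fun l _ => ?_
      ring
  set F := Fp er ec δ₀ (Xm K (RR α) (CC Q1 α)) with hF
  let A : ι → Fin k → MP (RR α × CC Q1 α) K := fun j l => iot (x j l).1 * bt l * dz K Q1 α ^ (p ^ n - 1 - k0)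
  have e2 : iot r.1 ^ p ^ n * (dz K Q1 α * F) ^ (p ^ n - 1) =
      ∑ j ∈ J, ∑ l, iot (θ j).1 ^ p ^ n * (A j l * F ^ (p ^ n - 1)) := by
    have : iot r.1 ^ p ^ n * (dz K Q1 α * F) ^ (p ^ n - 1) =
      (dz K Q1 α ^ k0 * iot r.1 ^ p ^ n) * (dz K Q1 α ^ (p ^ n - 1 - k0) * F ^ (p ^ n - 1)) := by
      rw [mul_pow, show dz K Q1 α ^ (p ^ n - 1) = dz K Q1 α ^ k0 * dz K Q1 α ^ (p ^ n - 1 - k0) by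
        rw [← pow_add]; congr 1; omega]
      ring
    rw [this, e1, Finset.sum_mul]
    refine sum_congr rfl fun j _ => ?_
    rw [Finset.sum_mul]
    refine sum_congr rfl fun l _ => ?_
    show _ = _ * ((_ * _ * _) * _)
    ring
  have e3 := congrArg (trq p n) e2
  rw [trq_pow_mul, trq_one p n _ _ (Lead_dz er ec δ₀ h3), mul_one, trq_sum] at e3
  have e4 := congrArg (sbt (mv (X : VQ → SK))) e3
  rw [show sbt (mv (X : VQ → SK)) (iot r.1) = r.1 from pii_iot _, map_sum] at e4
  let y : ι → Fin k → QS := fun j l =>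
    ⟨pii (trq p n (A j l * F ^ (p ^ n - 1))), pii_mem _ (InvM_trq p n er ec δ₀ h1 h2 _
      (((InvG_iot _ (x j l).2).mul (hbt l)).mul (InvG_dz.pow _)))⟩
  have e5 : r = ∑ j ∈ J, (∑ l, y j l) * θ j := by
    apply Subtype.ext
    rw [e4]
    push_cast
    refine sum_congr rfl fun j _ => ?_
    rw [trq_sum, map_sum, Finset.sum_mul]
    refine sum_congr rfl fun l _ => ?_
    rw [trq_pow_mul, map_mul, mul_comm]
    congr 1
    exact pii_iot _
  rw [e5]
  exact Ideal.sum_mem _ fun j hj => Ideal.mul_mem_left _ _ (Ideal.subset_span ⟨j, hj, rfl⟩)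
end tcb

section pairing
variable {K : Type} [Field K] {B : Type} [CommRing B] [Algebra K B] {τ : Type} [Fintype τ] [DecidableEq τ]

def fct (a : τ →₀ ℕ) : ℕ := ∏ v, (a v).factorial

theorem fct_zero : fct (0 : τ →₀ ℕ) = 1 := by simp [fct]

theorem fct_sub (a : τ →₀ ℕ) (v : τ) (h : a v ≠ 0) : fct a = a v * fct (a - Finsupp.single v 1) := by
  have h1 := mul_prod_erase univ (fun w => (a w).factorial) (mem_univ v)
  have h2 := mul_prod_erase univ
    (fun w => ((a - Finsupp.single v 1 : τ →₀ ℕ) w).factorial) (mem_univ v)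
  unfold fct
  rw [← h1, ← h2, ← mul_assoc]
  congr 1
  · simp only [Finsupp.coe_tsub, Pi.sub_apply, Finsupp.single_eq_same]
    exact (Nat.mul_factorial_pred h).symm
  · refine prod_congr rfl fun w hw => ?_
    rw [Finsupp.tsub_apply, Finsupp.single_eq_of_ne (Finset.ne_of_mem_erase hw), Nat.sub_zero]

noncomputable def pr (h : MP τ B) : MP τ K →ₗ[K] B :=
  (basisMonomials τ K).constr K (fun a => (fct a : B) * coeff a h)

theorem pr_mon (h : MP τ B) (a : τ →₀ ℕ) (c : K) :
    pr h (monomial a c) = algebraMap K B c * ((fct a : B) * coeff a h) := by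
  rw [show monomial a c = c • (basisMonomials τ K a) by rw [coe_basisMonomials, smul_monomial, smul_eq_mul, mul_one],
    map_smul, pr, Module.Basis.constr_basis, Algebra.smul_def]

theorem pr_sum (h : MP τ B) (f : MP τ K) :
    pr h f = ∑ a ∈ f.support, algebraMap K B (coeff a f) * ((fct a : B) * coeff a h) := by
  conv_lhs => rw [f.as_sum, map_sum]
  exact sum_congr rfl fun a _ => pr_mon _ _ _

theorem pr_add (h h' : MP τ B) (f : MP τ K) : pr (h + h') f = pr h f + pr h' f := by
  simp only [pr_sum, coeff_add, mul_add, sum_add_distrib]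

theorem pr_C_mul (b : B) (h : MP τ B) (f : MP τ K) : pr (C b * h) f = b * pr h f := by
  simp only [pr_sum, coeff_C_mul, Finset.mul_sum]
  exact sum_congr rfl fun a _ => by ring

theorem pr_sub (h h' : MP τ B) (f : MP τ K) : pr (h - h') f = pr h f - pr h' f := by
  simp only [pr_sum, coeff_sub, mul_sub, sum_sub_distrib]

theorem pr_fsum {ι : Type} (s : Finset ι) (h : ι → MP τ B) (f : MP τ K) :
    pr (∑ i ∈ s, h i) f = ∑ i ∈ s, pr (h i) f := by
  classical
  induction s using Finset.induction_on with
  | empty => simp [pr_sum]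
  | insert i s hi ih => rw [sum_insert hi, sum_insert hi, pr_add, ih]

theorem pr_map {B' : Type} [CommRing B'] [Algebra K B'] (φ : B →ₐ[K] B') (h : MP τ B) (f : MP τ K) :
    φ (pr h f) = pr (MvPolynomial.map φ.toRingHom h) f := by
  simp only [pr_sum, map_sum, map_mul, coeff_map, AlgHom.commutes, map_natCast]; rfl

theorem pr_C (b : B) (f : MP τ K) : pr (C b) f = b * algebraMap K B (constantCoeff f) := by
  induction f using MvPolynomial.induction_on' with
  | monomial a c =>
    rw [pr_mon, coeff_C]
    by_cases h : a = 0
    · subst h; rw [if_pos rfl, fct_zero]; simp [mul_comm]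
    · rw [if_neg (Ne.symm h), constantCoeff_eq, coeff_monomial, if_neg h]; simp
  | add p q hp hq => rw [map_add, hp, hq, map_add, map_add, mul_add]

theorem pr_X_mul (v : τ) (h : MP τ B) (f : MP τ K) : pr (h * X v) f = pr h (pderiv v f) := by
  induction f using MvPolynomial.induction_on' with
  | monomial a c =>
    rw [pderiv_monomial, pr_mon, pr_mon, mul_comm h, coeff_X_mul']
    by_cases hv : a v = 0
    · rw [if_neg (by simpa using hv), hv]; simp
    · rw [if_pos (by simpa using hv), fct_sub a v hv]; rw [Nat.cast_mul, map_mul, map_natCast]; ring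
  | add p q hp hq => rw [map_add, hp, hq, map_add, map_add]

theorem pderiv_lsub (A : Matrix τ τ K) (v : τ) (f : MP τ K) :
    pderiv v (lsub K A f) = ∑ w, C (A w v) * lsub K A (pderiv w f) := by
  induction f using MvPolynomial.induction_on with
  | C a => simp [lsub]
  | add p q hp hq => simp only [map_add, hp, hq, mul_add, sum_add_distrib]
  | mul_X p u hp =>
    have h1 : pderiv v (lsub K A (X u)) = C (A u v) := by
      rw [lsub_X, map_sum, sum_eq_single v]
      · simp
      · intro w _ hw; simp [pderiv_X, Pi.single_apply, hw]
      · intro h; exact absurd (mem_univ _) h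
    have h2 : ∀ w, lsub K A (pderiv w (p * X u)) = lsub K A (pderiv w p) * lsub K A (X u)
        + lsub K A p * (if w = u then 1 else 0) := by
      intro w
      rw [pderiv_mul, map_add, map_mul, map_mul, pderiv_X, Pi.single_apply]
      by_cases h : u = w
      · rw [if_pos h, if_pos h.symm, map_one]
      · rw [if_neg h, if_neg (Ne.symm h), map_zero]
    have h3 : ∑ w, C (A w v) * lsub K A (pderiv w (p * X u)) = ∑ w, (C (A w v) * (lsub K A (pderiv w p) * lsub K A (X u))
        + C (A w v) * (lsub K A p * (if w = u then 1 else 0))) :=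
      sum_congr rfl fun w _ => by rw [h2 w, mul_add]
    rw [map_mul, pderiv_mul, hp, h1, h3, sum_add_distrib, Finset.sum_mul]
    refine congrArg₂ (· + ·) ?_ ?_
    · exact sum_congr rfl fun w _ => by ring
    · rw [sum_eq_single u]
      · rw [if_pos rfl, mul_one, mul_comm]
      · intro w _ hw; rw [if_neg hw, mul_zero, mul_zero]
      · intro h; exact absurd (mem_univ _) h

theorem pr_adj (A : Matrix τ τ K) (h : MP τ B) : ∀ f : MP τ K,
    pr (lsub B A h) f = pr h (lsub K Aᵀ f) := by
  induction h using MvPolynomial.induction_on with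
  | C b =>
    intro f
    have h1 : lsub B A (C b) = C b := AlgHom.commutes _ _
    have h2 : constantCoeff (lsub K Aᵀ f) = constantCoeff f := by
      induction f using MvPolynomial.induction_on with
      | C a => simp [lsub]
      | add p q hp hq => rw [map_add, map_add, map_add, hp, hq]
      | mul_X p u hp => rw [map_mul, map_mul, lsub_X, map_sum]; simp
    rw [h1, pr_C, pr_C, h2]
  | add p q hp hq => intro f; rw [map_add, pr_add, hp, hq, pr_add]
  | mul_X p u hp =>
    intro f
    rw [map_mul, lsub_X, Finset.mul_sum, pr_fsum, pr_X_mul, pderiv_lsub, map_sum]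
    refine sum_congr rfl fun w _ => ?_
    rw [show lsub B A p * (C (algebraMap K B (A u w)) * X w) = C (algebraMap K B (A u w)) * (lsub B A p * X w) by ring,
      pr_C_mul, pr_X_mul, hp, ← smul_eq_C_mul, map_smul, Algebra.smul_def, transpose_apply]

theorem pr_zero_of (h : MP τ B) (f : MP τ K) (w : τ → ℕ) (n : ℕ)
    (hf : IsWeightedHomogeneous w f n) (hh : ∀ a ∈ h.support, Finsupp.weight w a ≠ n) : pr h f = 0 := by
  rw [pr_sum]
  refine sum_eq_zero fun a ha => ?_
  have h1 := hf (mem_support_iff.1 ha)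
  have : coeff a h = 0 := by
    by_contra h2
    exact hh a (mem_support_iff.2 h2) h1
  rw [this, mul_zero, mul_zero]

end pairing

section contraction
variable {K : Type} [Field K] {Q0 Q1 : Type} {ta ha : Q1 → Q0} {α : Q0 → ℕ}
  [Fintype Q0] [DecidableEq Q0]

noncomputable def dX (B : Type) [CommRing B] (α : Q0 → ℕ) (b : Q0) : MP (XX α α) B := (Xi B α b).det

def wX (α : Q0 → ℕ) (b : Q0) : XX α α → ℕ := fun x => if x.1 = b then 1 else 0

noncomputable def dM (B : Type) [CommRing B] (α : Q0 → ℕ) (p : Q0 → ℕ) : MP (XX α α) B :=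
  ∏ b, dX B α b ^ p b

theorem hom_dX (B : Type) [CommRing B] (b b' : Q0) :
    IsWeightedHomogeneous (wX α b') (dX B α b) (if b = b' then α b else 0) := by
  rw [← mem_weightedHomogeneousSubmodule, dX, det_apply]
  refine Submodule.sum_mem _ fun σ _ => ?_
  rw [Units.smul_def]
  refine zsmul_mem ?_ _
  rw [mem_weightedHomogeneousSubmodule]
  have := IsWeightedHomogeneous.prod (w := wX α b') (R := B) (univ : Finset (Fin (α b)))
    (fun i => Xi B α b (σ i) i) (fun _ => if b = b' then 1 else 0) (fun i _ => isWeightedHomogeneous_X B _ _)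
  by_cases h : b = b'
  · rw [if_pos h]; simpa [h] using this
  · rw [if_neg h]; simpa [h] using this

theorem dX_one (B : Type) [CommRing B] (b : Q0) (h : α b = 0) : dX B α b = 1 := by
  rw [dX]
  haveI : IsEmpty (Fin (α b)) := by rw [h]; infer_instance
  exact det_isEmpty

theorem hom_dM (B : Type) [CommRing B] (p : Q0 → ℕ) (b' : Q0) :
    IsWeightedHomogeneous (wX α b') (dM B α p) (p b' * α b') := by
  have := IsWeightedHomogeneous.prod (w := wX α b') (R := B) (univ : Finset Q0)
    (fun b => dX B α b ^ p b) (fun b => p b • (if b = b' then α b else 0)) (fun b _ => (hom_dX B b b').pow _)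
  have e : ∑ b, p b • (if b = b' then α b else 0) = p b' * α b' := by simp
  rw [e] at this; exact this

theorem eval_dX {B : Type} [CommRing B] [Algebra K B] (g : GM α K) (b : Q0) :
    eval (fun i => algebraMap K B (gpt g i)) (dX B α b) = algebraMap K B (g b).det := by
  rw [dX, RingHom.map_det, RingHom.map_det]
  congr 1
  ext i j
  simp [Xi, gpt]

theorem dX_map (B B' : Type) [CommRing B] [CommRing B'] (φ : B →+* B') (b : Q0) :
    MvPolynomial.map φ (dX B α b) = dX B' α b := by
  rw [dX, RingHom.map_det, dX]
  congr 1
  ext1 i j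
  simp [Xi]

theorem dM_map (B B' : Type) [CommRing B] [CommRing B'] (φ : B →+* B') (p : Q0 → ℕ) :
    MvPolynomial.map φ (dM B α p) = dM B' α p := by
  rw [dM, map_prod, dM]
  exact prod_congr rfl fun b _ => by rw [map_pow, dX_map]

theorem lsub_dX {B : Type} [CommRing B] [Algebra K B] (g : GM α K) (hg : IsSL g) (b : Q0) :
    lsub B (rmat α g) (dX B α b) = dX B α b := by
  have h1 : lsub B (rmat α g) (dX B α b) = (Xi B α b * (g b).map (fun c => C (algebraMap K B c))).det := by
    rw [dX]
    refine (RingHom.map_det (lsub B (rmat α g)).toRingHom _).trans ?_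
    congr 1
    ext1 i j
    exact lsub_rmat α g b i j
  have h2 : ((g b).map (fun c => (C (algebraMap K B c) : MP (XX α α) B))).det = 1 := by
    have := RingHom.map_det ((C : B →+* MP (XX α α) B).comp (algebraMap K B)) (g b)
    rw [hg b, map_one] at this
    exact this.symm
  rw [h1, det_mul, h2, mul_one, dX]

theorem rmat_tr (g : GM α K) : (rmat α g)ᵀ = rmat α (fun b => (g b)ᵀ) := by
  rw [rmat, rmat, blockDiagonal'_transpose]
  congr 1; funext b
  rw [← kroneckerMap_transpose, transpose_one]

theorem dM_ne (p : Q0 → ℕ) : dM K α p ≠ 0 := by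
  intro h
  have h1 := congrArg (eval (fun i => algebraMap K K (gpt (1 : GM α K) i))) h
  rw [dM, map_prod, map_zero] at h1
  have : ∀ b, eval (fun i => algebraMap K K (gpt (1 : GM α K) i)) (dX K α b ^ p b) = 1 := by
    intro b; rw [map_pow, eval_dX]; simp
  rw [prod_congr rfl fun b _ => this b, Finset.prod_const_one] at h1
  exact one_ne_zero h1

theorem dM_sq [CharZero K] (p : Q0 → ℕ) : pr (dM K α p) (dM K α p) ≠ 0 := by
  have hz : ∀ a, coeff a (dM K α p) = ((coeff a (dM ℤ α p) : ℤ) : K) := by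
    intro a; rw [← dM_map ℤ K (Int.castRingHom K), coeff_map]; rfl
  rw [pr_sum]
  have e : ∑ a ∈ (dM K α p).support, algebraMap K K (coeff a (dM K α p)) * ((fct a : K) * coeff a (dM K α p))
      = ((∑ a ∈ (dM K α p).support, coeff a (dM ℤ α p) * ((fct a : ℤ) * coeff a (dM ℤ α p)) : ℤ) : K) := by
    rw [Int.cast_sum]
    refine sum_congr rfl fun a _ => ?_
    rw [hz]; push_cast; rfl
  rw [e, Int.cast_ne_zero]
  refine ne_of_gt (Finset.sum_pos (fun a ha => ?_) (support_nonempty.2 (dM_ne p)))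
  have h1 : coeff a (dM ℤ α p) ≠ 0 := by
    intro h; have := hz a; rw [h, Int.cast_zero] at this; exact mem_support_iff.1 ha this
  have h2 : 0 < (fct a : ℤ) := by
    exact_mod_cast Finset.prod_pos fun v _ => Nat.factorial_pos _
  have h3 : 0 < coeff a (dM ℤ α p) ^ 2 := by positivity
  nlinarith [mul_pos h2 h3]

noncomputable def GX (B : Type) [CommRing B] (α : Q0 → ℕ) (M : ℕ) (b : Q0) : MP (XX α α) B :=
  ∑ k ∈ Finset.range (M + 1), dX B α b ^ k

noncomputable def kp {B : Type} [CommRing B] [Algebra K B] (M : ℕ) (φ : MP (XX α α) B) : B :=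
  pr (φ * ∏ b, GX B α M b) (dM K α fun _ => M)

theorem hom_GX (B : Type) [CommRing B] (M : ℕ) (b b' : Q0) (h : b ≠ b') :
    IsWeightedHomogeneous (wX α b') (GX B α M b) 0 := by
  refine IsWeightedHomogeneous.sum _ _ _ fun k _ => ?_
  have := (hom_dX B (α := α) b b').pow k
  rw [if_neg h, smul_zero] at this
  exact this

theorem wX_le (b : Q0) (u : XX α α →₀ ℕ) : Finsupp.weight (wX α b) u ≤ u.degree := by
  rw [Finsupp.weight_apply, Finsupp.sum, Finsupp.degree]
  refine Finset.sum_le_sum fun x _ => ?_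
  rw [wX]; split_ifs <;> simp

theorem kp_dX {B : Type} [CommRing B] [Algebra K B] (M : ℕ) (b : Q0) (φ : MP (XX α α) B)
    (h : φ.totalDegree < M) : kp (K := K) M (dX B α b * φ) = kp (K := K) M φ := by
  classical
  by_cases hb : α b = 0
  · rw [dX_one B b hb, one_mul]
  rw [kp, kp, ← sub_eq_zero, ← pr_sub]
  set Z := ∏ b' ∈ univ.erase b, GX B α M b' with hZ
  have e1 : ∏ b, GX B α M b = GX B α M b * Z := (mul_prod_erase _ _ (mem_univ b)).symm
  have e2 : dX B α b * φ * ∏ b, GX B α M b - φ * ∏ b, GX B α M b = φ * Z * dX B α b ^ (M + 1) - φ * Z := by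
    have := mul_geom_sum (dX B α b) (M + 1)
    rw [e1, GX]
    linear_combination (φ * Z) * this
  have hw : IsWeightedHomogeneous (wX α b) Z 0 := by
    have := IsWeightedHomogeneous.prod (w := wX α b) (R := B) (univ.erase b)
      (fun b' => GX B α M b') (fun _ => 0) (fun b' hb' => hom_GX B M b' b (Finset.ne_of_mem_erase hb'))
    simpa using this
  have hd := hom_dM (α := α) K (fun _ => M) b
  rw [e2, pr_sub, pr_zero_of _ _ _ _ hd, pr_zero_of _ _ _ _ hd, sub_zero]
  · intro a ha
    obtain ⟨u, hu, v, hv, rfl⟩ := Finset.mem_add.1 (support_mul _ _ ha)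
    rw [map_add, hw (mem_support_iff.1 hv)]
    have h1 := wX_le b u
    have h2 : u.degree ≤ φ.totalDegree := le_totalDegree hu
    have h3 : M * 1 ≤ M * α b := Nat.mul_le_mul_left _ (Nat.one_le_iff_ne_zero.2 hb)
    omega
  · intro a ha
    obtain ⟨u, hu, v, hv, rfl⟩ := Finset.mem_add.1 (support_mul _ _ ha)
    have h1 := (hom_dX B (α := α) b b).pow (M + 1) (mem_support_iff.1 hv)
    rw [if_pos rfl] at h1
    rw [map_add, h1, smul_eq_mul, add_mul, one_mul]
    have : 0 < α b := Nat.pos_of_ne_zero hb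
    omega

def Gd (K : Type) [Field K] {B : Type} [CommRing B] [Algebra K B] (ψ : MP (XX α α) B) : Prop :=
  ∀ φ, ∃ M0, ∀ M, M0 ≤ M → kp (K := K) M (ψ * φ) = kp (K := K) M φ

theorem Gd.mul {B : Type} [CommRing B] [Algebra K B] {ψ ψ' : MP (XX α α) B} (h : Gd K ψ) (h' : Gd K ψ') :
    Gd K (ψ * ψ') := by
  intro φ
  obtain ⟨a, ha⟩ := h (ψ' * φ)
  obtain ⟨b, hb⟩ := h' φ
  exact ⟨a + b, fun M hM => by rw [mul_assoc, ha M (by omega), hb M (by omega)]⟩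

theorem Gd_dM {B : Type} [CommRing B] [Algebra K B] (p : Q0 → ℕ) : Gd K (dM B α p) := by
  have h1 : Gd K (1 : MP (XX α α) B) := fun φ => ⟨0, fun M _ => by rw [one_mul]⟩
  have hd : ∀ b, Gd K (dX B α b) := fun b φ => ⟨φ.totalDegree + 1, fun M hM => kp_dX M b φ (by omega)⟩
  rw [dM]
  refine Finset.prod_induction _ (Gd K) (fun _ _ h h' => h.mul h') h1 fun b _ => ?_
  induction p b with
  | zero => rw [pow_zero]; exact h1
  | succ n ih => rw [pow_succ]; exact ih.mul (hd b)

theorem jok_bot : Jok (⊥ : Ideal SK) :=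
  ⟨fun g _ s hs => by rw [Ideal.mem_bot] at hs ⊢; rw [hs, map_zero],
   fun s hs d => by rw [Ideal.mem_bot] at hs ⊢; rw [hs, map_zero]⟩

theorem rhat_bot [Infinite K] (s : SK) :
    s ∈ Rhat (⊥ : Ideal SK) ↔ s ∈ QS := by
  rw [mem_Rhat, mem_SL]
  simp only [Ideal.mem_bot, sub_eq_zero]; rfl

theorem del_semi [Infinite K] (j : Q0 →₀ ℕ) (r : SK) (h : SemiInv ⊥ j r) :
    del r = C r * dM _ α j := by
  rw [← sub_eq_zero]
  ext1 m
  rw [coeff_zero]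
  have := density (⊥ : Submodule K SK) (del r - C r * dM _ α j)
    (dM K α fun _ => 1) (dM_ne _) ?_ m
  · exact this
  intro x hx
  let g : GM α K := fun b i k => x ⟨b, (i, k)⟩
  have hxg : x = gpt g := rfl
  have hg : IsGL g := by
    intro b hb
    apply hx
    rw [dM, map_prod]
    refine Finset.prod_eq_zero (mem_univ b) ?_
    have := eval_dX (B := K) g b
    rw [hb, map_zero] at this
    rw [pow_one]; exact this
  have h1 := h g hg
  rw [Ideal.mem_bot, sub_eq_zero] at h1
  rw [Submodule.mem_bot, map_sub, map_mul, eval_C, hxg, eval_del, h1, dM, map_prod, delt, sub_eq_zero, mul_comm, map_prod]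
  congr 1
  refine prod_congr rfl fun b _ => ?_
  rw [map_pow, map_pow, eval_dX]; rfl

theorem kp_C {B : Type} [CommRing B] [Algebra K B] (M : ℕ) (r : B) (φ : MP (XX α α) B) :
    kp (K := K) M (C r * φ) = r * kp (K := K) M φ := by
  rw [kp, mul_assoc, pr_C_mul, kp]

theorem kp_sum {B : Type} [CommRing B] [Algebra K B] {ι : Type} (s : Finset ι) (M : ℕ) (φ : ι → MP (XX α α) B) :
    kp (K := K) M (∑ i ∈ s, φ i) = ∑ i ∈ s, kp (K := K) M (φ i) := by
  rw [kp, Finset.sum_mul, pr_fsum]; rfl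

theorem del_mul (r s : SK) : del (r * s) = del r * del s := map_mul _ _ _

theorem bnd {ι : Type} (s : Finset ι) (P : ι → ℕ → Prop) (h : ∀ i, ∃ M0, ∀ M, M0 ≤ M → P i M) :
    ∃ M0, ∀ M, M0 ≤ M → ∀ i ∈ s, P i M := by
  choose f hf using h
  exact ⟨s.sup f, fun M hM i hi => hf i M ((Finset.le_sup hi).trans hM)⟩

theorem kp_lin [Infinite K] (r s : SK) (hr : r ∈ QS) :
    ∃ M0, ∀ M, M0 ≤ M → kp (K := K) M (del (r * s)) = r * kp (K := K) M (del s) := by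
  have hs := (rhat_bot r).2 hr
  obtain ⟨M0, h0⟩ := bnd (FF r).support (fun j M => kp (K := K) M (del (coeff j (FF r) * s))
      = coeff j (FF r) * kp (K := K) M (del s)) (fun j => by
    obtain ⟨M0, h⟩ := Gd_dM (K := K) (j : Q0 → ℕ) (del s)
    refine ⟨M0, fun M hM => ?_⟩
    rw [del_mul, del_semi j _ (semi_FF jok_bot hs j), mul_assoc, kp_C, h M hM])
  refine ⟨M0, fun M hM => ?_⟩
  have e := sum_FF r
  have e2 : del (r * s) = ∑ j ∈ (FF r).support, del (coeff j (FF r) * s) := by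
    conv_lhs => rw [e, Finset.sum_mul]
    exact map_sum (aeval _) _ _
  rw [e2, kp_sum, sum_congr rfl (h0 M hM), ← Finset.sum_mul, ← e]

theorem kp_mem [Infinite K] (M : ℕ) (s : SK) :
    kp (K := K) M (del s) ∈ QS := by
  rw [mem_SL]
  intro g hg
  set S := SK
  have h1 : MvPolynomial.map (act g : S →ₐ[K] S).toRingHom (∏ b, GX S α M b) = ∏ b, GX S α M b := by
    rw [map_prod]
    refine prod_congr rfl fun b _ => ?_
    rw [GX, map_sum]
    exact sum_congr rfl fun k _ => by rw [map_pow, dX_map]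
  have h2 : lsub S (rmat α g) (∏ b, GX S α M b) = ∏ b, GX S α M b := by
    rw [map_prod]
    refine prod_congr rfl fun b _ => ?_
    rw [GX, map_sum]
    exact sum_congr rfl fun k _ => by rw [map_pow, lsub_dX g hg]
  have h3 : lsub K (rmat α g)ᵀ (dM K α fun _ => M) = dM K α fun _ => M := by
    rw [rmat_tr, dM, map_prod]
    refine prod_congr rfl fun b _ => ?_
    rw [map_pow, lsub_dX]
    intro b; rw [det_transpose]; exact hg b
  rw [kp, pr_map, map_mul, map_act_del, h1]
  conv_lhs => rw [← h2]
  rw [← map_mul, pr_adj, h3]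

theorem kp_one [CharZero K] (M : ℕ) : ∃ u : K, u ≠ 0 ∧
    kp (K := K) M (1 : MP (XX α α) SK) = C u := by
  classical
  refine ⟨pr (∏ b, GX K α M b) (dM K α fun _ => M), ?_, ?_⟩
  · have e : ∏ b, GX K α M b = ∑ p ∈ Fintype.piFinset (fun _ : Q0 => Finset.range (M + 1)), dM K α p :=
      Finset.prod_univ_sum _ _
    rw [e, pr_fsum]
    have key : ∀ p : Q0 → ℕ, pr (dM K α p) (dM K α fun _ => M) =
        if ∀ b, p b * α b = M * α b then pr (dM K α fun _ => M) (dM K α fun _ => M) else 0 := by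
      intro p
      by_cases h : ∀ b, p b * α b = M * α b
      · rw [if_pos h]
        have : dM K α p = dM K α fun _ => M := by
          refine prod_congr rfl fun b _ => ?_
          by_cases hb : α b = 0
          · rw [dX_one K b hb, one_pow, one_pow]
          · rw [Nat.eq_of_mul_eq_mul_right (Nat.pos_of_ne_zero hb) (h b)]
        rw [this]
      · rw [if_neg h]
        push Not at h
        obtain ⟨b, hb⟩ := h
        refine pr_zero_of _ _ (wX α b) _ (hom_dM K _ b) fun a ha => ?_
        rw [hom_dM K p b (mem_support_iff.1 ha)]; exact hb
    rw [sum_congr rfl fun p _ => key p, ← Finset.sum_filter, Finset.sum_const, nsmul_eq_mul]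
    refine mul_ne_zero ?_ (dM_sq _)
    rw [Nat.cast_ne_zero, ← Nat.pos_iff_ne_zero, Finset.card_pos]
    exact ⟨fun _ => M, by simp⟩
  · rw [kp, one_mul]
    have h := pr_map (Algebra.ofId K SK) (∏ b, GX K α M b) (dM K α fun _ => M)
    refine Eq.trans ?_ h.symm
    refine congrArg (fun z => pr z (dM K α fun _ => M)) ?_
    refine Eq.trans ?_ (map_prod (MvPolynomial.map (Algebra.ofId K SK).toRingHom) _ _).symm
    refine prod_congr rfl fun b _ => ?_
    rw [GX, GX, map_sum]
    exact sum_congr rfl fun k _ => by rw [map_pow, dX_map]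

theorem contr [CharZero K] {ι : Type} (J : Finset ι) (θ : ι → QS)
    (r : QS) (s : ι → SK)
    (h : (r : SK) = ∑ j ∈ J, θ j * s j) : r ∈ Ideal.span (θ '' (J : Set ι)) := by
  obtain ⟨M1, h1⟩ := kp_lin (r : SK) 1 r.2
  obtain ⟨M2, h2⟩ := bnd J (fun j M => kp (K := K) M (del ((θ j : SK) * s j))
      = θ j * kp (K := K) M (del (s j))) (fun j => kp_lin _ _ (θ j).2)
  have h1 := h1 (M1 + M2) (by omega)
  have h2 := h2 (M1 + M2) (by omega)
  set M := M1 + M2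
  obtain ⟨u, hu, hk⟩ := kp_one (K := K) (ta := ta) (ha := ha) (α := α) M
  have e2 : del (r : SK) = ∑ j ∈ J, del ((θ j : SK) * s j) := by
    rw [h]; exact map_sum (aeval _) _ _
  have e1 : del (1 : SK) = 1 := map_one (aeval _)
  rw [mul_one, e2, kp_sum, sum_congr rfl h2, e1, hk] at h1
  have e3 : r = ∑ j ∈ J, (algebraMap K _ u⁻¹ * ⟨_, kp_mem M (s j)⟩ : QS) * θ j := by
    apply Subtype.ext
    rw [AddSubmonoidClass.coe_finset_sum]
    have : ∀ j, (((algebraMap K _ u⁻¹ * ⟨_, kp_mem M (s j)⟩ : QS) * θ j :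
        QS) : SK)
        = C u⁻¹ * ((θ j : SK) * kp (K := K) M (del (s j))) := by
      intro j
      change C u⁻¹ * kp (K := K) M (del (s j)) * (θ j : SK) = _
      ring
    rw [sum_congr rfl fun j _ => this j, ← Finset.mul_sum, h1, mul_comm, mul_assoc, ← C_mul, mul_inv_cancel₀ hu,
      C_1, mul_one]
  rw [e3]
  exact Ideal.sum_mem _ fun j hj => Ideal.mul_mem_left _ _ (Ideal.subset_span ⟨j, hj, rfl⟩)

end contraction

section proj
variable {K : Type} [Field K] {Q0 Q1 : Type} {ta ha : Q1 → Q0} {α : Q0 → ℕ}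
  [Fintype Q0] [DecidableEq Q0]

def chi (t : Q0 → Kˣ) (w : Q0 → ℤ) : Kˣ := ∏ b, t b ^ w b

theorem chi_zero (t : Q0 → Kˣ) : chi t 0 = 1 := by simp [chi]
theorem chi_add (t : Q0 → Kˣ) (w w' : Q0 → ℤ) : chi t (w + w') = chi t w * chi t w' := by
  simp [chi, _root_.zpow_add, prod_mul_distrib]
theorem chi_sub (t : Q0 → Kˣ) (w w' : Q0 → ℤ) : chi t (w - w') = chi t w * (chi t w')⁻¹ := by
  simp [chi, _root_.zpow_sub, prod_mul_distrib]
theorem chi_single (t : Q0 → Kˣ) (b : Q0) : chi t (Pi.single b 1) = t b := by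
  rw [chi, prod_eq_single b]
  · simp
  · intro c _ hc; simp [hc]
  · simp

def wtv (v : VQ) : Q0 → ℤ :=
  (if v.2.1.val = 0 then Pi.single (ha v.1) 1 else 0) - (if v.2.2.val = 0 then Pi.single (ta v.1) 1 else 0)

noncomputable def tor (t : Q0 → Kˣ) : SK →ₐ[K] SK :=
  aeval fun v => C ((chi t (wtv v) : Kˣ) : K) * X v

theorem tor_mon (t : Q0 → Kˣ) (m : VQ →₀ ℕ) (c : K) :
    tor t (monomial m c) = C ((chi t (Finsupp.weight wtv m) : Kˣ) : K) * monomial m c := by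
  induction m using Finsupp.induction_linear generalizing c with
  | zero => rw [map_zero, chi_zero, Units.val_one, C_1, one_mul]; exact AlgHom.commutes _ _
  | add f g hf hg =>
    rw [map_add, chi_add, show monomial (f + g) c = monomial f c * monomial g (1 : K) by rw [monomial_mul, mul_one],
      map_mul, hf, hg, Units.val_mul, C_mul]
    ring
  | single v n =>
    induction n generalizing c with
    | zero => rw [Finsupp.single_zero, map_zero, chi_zero, Units.val_one, C_1, one_mul]; exact AlgHom.commutes _ _
    | succ n ih =>
      have hw : Finsupp.weight wtv (Finsupp.single v 1) = wtv v := by rw [Finsupp.weight_single, one_smul]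
      rw [Finsupp.single_add, map_add, chi_add, show monomial (Finsupp.single v n + Finsupp.single v 1) c
        = monomial (Finsupp.single v n) c * X v by rw [X, monomial_mul, mul_one], map_mul, ih, tor, aeval_X,
        hw, Units.val_mul, C_mul]
      ring

theorem tor_coeff (t : Q0 → Kˣ) (m : VQ →₀ ℕ) (s : SK) :
    coeff m (tor t s) = (chi t (Finsupp.weight wtv m) : Kˣ) * coeff m s := by
  classical
  induction s using MvPolynomial.induction_on' with
  | monomial u c =>
    rw [tor_mon, coeff_C_mul, coeff_monomial]
    by_cases h : u = m
    · rw [h]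
    · rw [if_neg h, mul_zero, mul_zero]
  | add p q hp hq => rw [map_add, coeff_add, hp, hq, coeff_add, mul_add]

abbrev RepV (K : Type) (ta ha : Q1 → Q0) (α : Q0 → ℕ) := (a : Q1) → Matrix (Fin (α (ha a))) (Fin (α (ta a))) K
abbrev GLa (K : Type) [Field K] (α : Q0 → ℕ) := (i : Q0) → GeneralLinearGroup (Fin (α i)) K

def ac (A : GLa K α) (v : RepV K ta ha α) : RepV K ta ha α :=
  fun a => (A (ha a)).val * v a * ((A (ta a))⁻¹).val

theorem ac_mul (A A' : GLa K α) (v : RepV K ta ha α) : ac (A * A') v = ac A (ac A' v) := by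
  funext a
  simp only [ac, Pi.mul_apply, _root_.mul_inv_rev, Units.val_mul, Matrix.mul_assoc]

theorem mem_GL' (s : SK) : s ∈ QI ↔
    ∀ (A : GLa K α) (v : RepV K ta ha α), aeval (repCoords (ac A v)) s = aeval (repCoords v) s := by
  rw [quiverInvariants]
  simp only [Algebra.mem_iInf, AlgHom.mem_equalizer]; rfl

theorem mem_SL' (s : SK) : s ∈ QS ↔
    ∀ (A : GLa K α), (∀ b, (A b).val.det = 1) → ∀ (v : RepV K ta ha α),
      aeval (repCoords (ac A v)) s = aeval (repCoords v) s := by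
  rw [quiverSemiInvariants]
  simp only [Algebra.mem_iInf, AlgHom.mem_equalizer]
  have hi : ∀ {n : ℕ} (A : GeneralLinearGroup (Fin n) K) (B : SpecialLinearGroup (Fin n) K), A.val = B.val →
      (A⁻¹).val = (B⁻¹).val := by
    intro n A B h
    have h1 : B.val * (B⁻¹).val = 1 := congrArg Subtype.val (mul_inv_cancel B)
    calc (A⁻¹).val = (A⁻¹).val * (A.val * (B⁻¹).val) := by rw [h, h1, mul_one]
      _ = (B⁻¹).val := by rw [← mul_assoc, Units.inv_mul, one_mul]
  constructor
  · intro h A hA v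
    have := h (fun b => ⟨(A b).val, hA b⟩) v
    have e : ac A v = (fun a => (A (ha a)).val * v a * (Inv.inv (α := SpecialLinearGroup (Fin (α (ta a))) K)
        ⟨(A (ta a)).val, hA (ta a)⟩).val) := by
      funext a
      exact congrArg (fun z => (A (ha a)).val * v a * z) (hi (A (ta a)) ⟨(A (ta a)).val, hA (ta a)⟩ rfl)
    rw [e]; exact this
  · intro h A v
    have := h (fun b => (A b).toGL) (fun b => (A b).2) v
    have e : ac (fun b => (A b).toGL) v = (fun a => (A (ha a)).val * v a * ((A (ta a))⁻¹).val) := by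
      funext a
      exact congrArg (fun z => (A (ha a)).val * v a * z) (hi (A (ta a)).toGL (A (ta a)) rfl)
    rw [← e]; exact this

def dgl (t : Q0 → Kˣ) : GLa K α := fun b =>
  { val := diagonal fun i => if i.val = 0 then (t b : K) else 1
    inv := diagonal fun i => if i.val = 0 then (((t b)⁻¹ : Kˣ) : K) else 1
    val_inv := by
      rw [diagonal_mul_diagonal, ← diagonal_one]; congr 1; funext i
      split_ifs <;> simp
    inv_val := by
      rw [diagonal_mul_diagonal, ← diagonal_one]; congr 1; funext i
      split_ifs <;> simp }

theorem det_dgl (t : Q0 → Kˣ) (b : Q0) (h : 0 < α b) : (dgl (α := α) t b).val.det = t b := by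
  change (diagonal _).det = _
  rw [det_diagonal, prod_eq_single (⟨0, h⟩ : Fin (α b))]
  · simp
  · intro i _ hi
    rw [if_neg]; intro h0; exact hi (Fin.ext h0)
  · simp

theorem ev_tor (t : Q0 → Kˣ) (v : RepV K ta ha α) (s : SK) :
    aeval (repCoords v) (tor t s) = aeval (repCoords (ac (dgl t) v)) s := by
  have : (aeval (repCoords v)).comp (tor t) = (aeval (repCoords (ac (dgl t) v)) : SK →ₐ[K] K) := by
    ext x : 1
    rw [AlgHom.comp_apply, tor, aeval_X, map_mul, aeval_X, aeval_X, aeval_C]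
    let D1 : Matrix (Fin (α (ha x.1))) (Fin (α (ha x.1))) K := diagonal fun i => if i.val = 0 then (t (ha x.1) : K) else 1
    let D2 : Matrix (Fin (α (ta x.1))) (Fin (α (ta x.1))) K :=
      diagonal fun i => if i.val = 0 then (((t (ta x.1))⁻¹ : Kˣ) : K) else 1
    let v1 : Matrix (Fin (α (ha x.1))) (Fin (α (ta x.1))) K := v x.1
    change ((chi t (wtv x) : Kˣ) : K) * v1 x.2.1 x.2.2 = (D1 * v1 * D2) x.2.1 x.2.2
    rw [mul_diagonal, diagonal_mul, wtv, chi_sub]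
    by_cases h1 : x.2.1.val = 0 <;> by_cases h2 : x.2.2.val = 0 <;>
      simp [h1, h2, chi_single, chi_zero] <;> ring
  exact congrArg (fun f : SK →ₐ[K] K => f s) this

theorem ev_ext [Infinite K] {s s' : SK}
    (h : ∀ v : RepV K ta ha α, aeval (repCoords v) s = aeval (repCoords v) s') : s = s' := by
  refine MvPolynomial.funext fun x => ?_
  exact h (fun a i j => x ⟨a, (i, j)⟩)

theorem tor_GL [Infinite K] {s : SK} (h : s ∈ QI) (t : Q0 → Kˣ) :
    tor t s = s := ev_ext fun v => by rw [ev_tor, (mem_GL' s).1 h]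

theorem tor_SL {s : SK} (h : s ∈ QS) (t : Q0 → Kˣ) :
    tor t s ∈ QS := by
  rw [mem_SL'] at h ⊢
  intro A hA v
  rw [ev_tor, ev_tor, ← ac_mul, show dgl t * A = (dgl t * A * (dgl t)⁻¹) * dgl t by rw [inv_mul_cancel_right], ac_mul]
  apply h
  intro b
  rw [Pi.mul_apply, Pi.mul_apply, Pi.inv_apply, Units.val_mul, Units.val_mul, det_mul, det_mul, hA, mul_one, ← det_mul,
    Units.mul_inv, det_one]

theorem exists_npow [Infinite K] (n : ℤ) (hn : n ≠ 0) : ∃ u : Kˣ, u ^ n ≠ 1 := by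
  by_contra h
  push Not at h
  have h2 : ∀ u : Kˣ, u ^ n.natAbs = 1 := by
    intro u
    rcases Int.natAbs_eq n with e | e
    · have := h u; rw [e] at this; exact_mod_cast this
    · have := h u; rw [e, _root_.zpow_neg, inv_eq_one] at this; exact_mod_cast this
  have hp : (Polynomial.X ^ n.natAbs - 1 : Polynomial K) * Polynomial.X = 0 := by
    refine Polynomial.funext fun x => ?_
    by_cases hx : x = 0
    · simp [hx]
    · have := congrArg Units.val (h2 (Units.mk0 x hx))
      simp only [Units.val_pow_eq_pow_val, Units.val_mk0, Units.val_one] at this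
      simp [this]
  rcases mul_eq_zero.1 hp with h3 | h3
  · exact Polynomial.X_pow_sub_C_ne_zero (Int.natAbs_pos.2 hn) (1 : K) (by rw [Polynomial.C_1]; exact h3)
  · exact Polynomial.X_ne_zero h3

theorem wt_GL [Infinite K] {s : SK} (h : s ∈ QI)
    {m : VQ →₀ ℕ} (hm : coeff m s ≠ 0) : Finsupp.weight wtv m = (0 : Q0 → ℤ) := by
  funext b
  by_contra hb
  obtain ⟨u, hu⟩ := exists_npow (K := K) _ hb
  have h1 := tor_coeff (Pi.mulSingle b u) m s
  rw [tor_GL h, chi, prod_eq_single b, Pi.mulSingle_eq_same] at h1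
  · apply hu
    apply Units.ext
    rw [Units.val_one]
    exact mul_right_cancel₀ hm (by rw [one_mul]; exact h1.symm)
  · intro c _ hc; rw [Pi.mulSingle_eq_of_ne hc, _root_.one_zpow]
  · simp

theorem GL_le_SL : QI ≤ QS := by
  intro s hs
  rw [mem_SL']
  exact fun A _ v => (mem_GL' s).1 hs A v

noncomputable def PP (s : SK) : SK :=
  weightedHomogeneousComponent (wtv : VQ → Q0 → ℤ) 0 s

theorem coeff_PP (s : SK) (m : VQ →₀ ℕ) :
    coeff m (PP s) = if Finsupp.weight wtv m = (0 : Q0 → ℤ) then coeff m s else 0 :=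
  coeff_weightedHomogeneousComponent _ _ _

theorem PP_lin [Infinite K] {r : SK} (hr : r ∈ QI)
    (s : SK) : PP (r * s) = r * PP s := by
  classical
  ext1 m
  rw [coeff_PP, coeff_mul, coeff_mul]
  have key : ∀ x ∈ Finset.HasAntidiagonal.antidiagonal m, coeff x.1 r * coeff x.2 (PP s)
      = if Finsupp.weight wtv m = (0 : Q0 → ℤ) then coeff x.1 r * coeff x.2 s else 0 := by
    intro x hx
    by_cases h0 : coeff x.1 r = 0
    · rw [h0, zero_mul, zero_mul, ite_self]
    rw [coeff_PP, ← Finset.HasAntidiagonal.mem_antidiagonal.1 hx, map_add, wt_GL hr h0, zero_add, mul_ite, mul_zero]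
  rw [sum_congr rfl key]
  by_cases h : Finsupp.weight wtv m = (0 : Q0 → ℤ)
  · simp only [if_pos h]
  · simp only [if_neg h, Finset.sum_const_zero]

theorem PP_GL [Infinite K] {r : SK} (hr : r ∈ QI) : PP r = r := by
  ext1 m
  rw [coeff_PP]
  by_cases h0 : coeff m r = 0
  · rw [h0, ite_self]
  · rw [if_pos (wt_GL hr h0)]

theorem PP_SL [Infinite K] {r : SK} (hr : r ∈ QS) :
    PP r ∈ QS := by
  classical
  obtain ⟨N, hN⟩ : ∃ N : ℕ, ∀ m ∈ r.support, ∀ b, 0 ≤ Finsupp.weight wtv m b + (N : ℤ) := by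
    refine ⟨r.support.sup fun m => univ.sup fun b => (Finsupp.weight wtv m b : ℤ).natAbs, fun m hm b => ?_⟩
    have h1 : (Finsupp.weight wtv m b : ℤ).natAbs ≤ r.support.sup fun m => univ.sup fun b => (Finsupp.weight wtv m b : ℤ).natAbs :=
      (Finset.le_sup (f := fun b => (Finsupp.weight wtv m b : ℤ).natAbs) (mem_univ b)).trans
        (Finset.le_sup (f := fun m => univ.sup fun b => (Finsupp.weight wtv m b : ℤ).natAbs) hm)
    omega
  let ex : (VQ →₀ ℕ) → (Q0 →₀ ℕ) := fun m => Finsupp.equivFunOnFinite.symm fun b => (Finsupp.weight wtv m b + (N : ℤ)).toNat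
  let f : MP Q0 SK := ∑ m ∈ r.support, monomial (ex m) (monomial m (coeff m r))
  have hf := density (QS).toSubmodule f (∏ b, X b)
    (prod_ne_zero_iff.2 fun b _ => X_ne_zero b) ?_ (Finsupp.equivFunOnFinite.symm fun _ => N)
  · have e : coeff (Finsupp.equivFunOnFinite.symm fun _ => N) f = PP r := by
      ext1 u
      rw [coeff_PP, coeff_sum, coeff_sum]
      by_cases hu : coeff u r = 0
      · rw [hu, ite_self]
        refine sum_eq_zero fun m hm => ?_
        rw [coeff_monomial]
        split_ifs
        · rw [coeff_monomial, if_neg]; rintro rfl; exact mem_support_iff.1 hm hu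
        · rw [coeff_zero]
      · rw [sum_eq_single u]
        · rw [coeff_monomial]
          have : ex u = (Finsupp.equivFunOnFinite.symm fun _ => N) ↔ Finsupp.weight wtv u = (0 : Q0 → ℤ) := by
            rw [Equiv.apply_eq_iff_eq, funext_iff, funext_iff]
            refine forall_congr' fun b => ?_
            have := hN u (mem_support_iff.2 hu) b
            rw [Pi.zero_apply]
            omega
          by_cases h : Finsupp.weight wtv u = (0 : Q0 → ℤ)
          · rw [if_pos (this.2 h), if_pos h, coeff_monomial, if_pos rfl]
          · rw [if_neg (fun h' => h (this.1 h')), if_neg h, coeff_zero]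
        · intro m _ hm
          rw [coeff_monomial]
          split_ifs
          · rw [coeff_monomial, if_neg hm]
          · rw [coeff_zero]
        · intro h; exact absurd (mem_support_iff.2 hu) h
    rw [e] at hf; exact hf
  · intro x hx
    rw [map_prod] at hx
    have hx' : ∀ b, x b ≠ 0 := fun b => by
      have := prod_ne_zero_iff.1 hx b (mem_univ b)
      rwa [eval_X] at this
    let t : Q0 → Kˣ := fun b => Units.mk0 (x b) (hx' b)
    have e : eval (fun i => algebraMap K SK (x i)) f = C (∏ b, x b ^ N) * tor t r := by
      conv_rhs => rw [r.as_sum, map_sum, Finset.mul_sum]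
      rw [map_sum]
      refine sum_congr rfl fun m hm => ?_
      rw [eval_monomial, tor_mon, ← mul_assoc, ← C_mul, mul_comm]
      refine congrArg (· * monomial m (coeff m r)) ?_
      rw [Finsupp.prod_fintype _ _ (fun _ => pow_zero _), chi, Units.coe_prod, ← prod_mul_distrib, map_prod]
      refine prod_congr rfl fun b _ => ?_
      have h1 := hN m hm b
      have h2 : x b ^ N * ((t b ^ (Finsupp.weight wtv m b : ℤ) : Kˣ) : K) = x b ^ ex m b := by
        rw [Units.val_zpow_eq_zpow_val, ← zpow_natCast (x b) N, ← zpow_natCast (x b) (ex m b)]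
        change x b ^ (N : ℤ) * x b ^ (Finsupp.weight wtv m b : ℤ) = _
        rw [← zpow_add₀ (hx' b)]
        congr 1
        change _ = (((Finsupp.weight wtv m b + (N : ℤ)).toNat : ℕ) : ℤ)
        omega
      rw [h2, C_pow]; rfl
    rw [e]
    exact (QS).mul_mem ((QS).algebraMap_mem _) (tor_SL hr t)

theorem PP_mem [Infinite K] {r : SK} (hr : r ∈ QS) :
    PP r ∈ QI := by
  rw [mem_GL']
  intro A v
  have ht : ∀ t : Q0 → Kˣ, tor t (PP r) = PP r := by
    intro t
    ext1 m
    rw [tor_coeff, coeff_PP]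
    by_cases h : Finsupp.weight wtv m = (0 : Q0 → ℤ)
    · rw [h, chi_zero, Units.val_one, one_mul]
    · rw [if_neg h, mul_zero]
  have hdet : ∀ b, (A b).val.det ≠ 0 := fun b => ((Matrix.isUnit_iff_isUnit_det _).1 (A b).isUnit).ne_zero
  let t : Q0 → Kˣ := fun b => Units.mk0 _ (hdet b)
  have e : A = (A * (dgl t)⁻¹) * dgl t := by rw [inv_mul_cancel_right]
  rw [e, ac_mul, (mem_SL' _).1 (PP_SL hr), ← ev_tor, ht]
  intro b
  rw [Pi.mul_apply, Pi.inv_apply, Units.val_mul, det_mul]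
  rcases Nat.eq_zero_or_pos (α b) with h | h
  · haveI : IsEmpty (Fin (α b)) := by rw [h]; infer_instance
    rw [det_isEmpty, det_isEmpty, one_mul]
  · have h1 := det_dgl t b h
    have h2 : (dgl (α := α) t b).val.det * ((dgl (α := α) t b)⁻¹).val.det = 1 := by
      rw [← det_mul, Units.mul_inv, det_one]
    rw [h1] at h2; exact h2

end proj

theorem fg_of_contr {K V : Type} [Field K] [Finite V] (R E : Subalgebra K (MP V K)) (hE : R ≤ E)
    [IsNoetherianRing E] (hR : ∀ r ∈ R, ∀ d, homogeneousComponent d r ∈ R)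
    (hP : ∀ (J : Finset E) (θ : E → R) (r : R) (s : E → MP V K), (∀ j, s j ∈ E) →
      (r : MP V K) = ∑ j ∈ J, (θ j : MP V K) * s j → r ∈ Ideal.span (θ '' (J : Set E))) : R.FG := by
  classical
  let A : Set E := {x | (x : MP V K) ∈ R ∧ coeff 0 (x : MP V K) = 0}
  obtain ⟨T, hTA, hT⟩ := (Submodule.fg_span_iff_fg_span_finset_subset (R := E) A).1 (IsNoetherian.noetherian _)
  let θ : E → R := fun x => if h : (x : MP V K) ∈ R then ⟨x, h⟩ else 0
  have hθ : ∀ j ∈ T, (θ j : MP V K) = j := by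
    intro j hj
    simp only [θ, dif_pos (hTA hj).1]
  have key := lemG R ⊥ hR (fun r hr d => by rw [Ideal.mem_bot] at hr ⊢; rw [hr, map_zero]) (T.image Subtype.val)
    (by
      intro f hf
      obtain ⟨x, hx, rfl⟩ := mem_image.1 hf
      exact hTA hx)
    (by
      intro r hr h0
      have h1 : (⟨r, hE hr⟩ : E) ∈ Ideal.span (id '' (T : Set E)) := by
        rw [Set.image_id]
        have : (⟨r, hE hr⟩ : E) ∈ Submodule.span E A := Submodule.subset_span ⟨hr, h0⟩
        rw [hT] at this; exact this
      obtain ⟨b, hb⟩ := mem_span_image_fs T id _ h1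
      have h2 := hP T θ ⟨r, hr⟩ (fun j => b j) (fun j => (b j).2) (by
        have := congrArg Subtype.val hb
        rw [AddSubmonoidClass.coe_finset_sum] at this
        refine this.symm.trans (sum_congr rfl fun j hj => ?_)
        rw [hθ j hj, mul_comm]; rfl)
      obtain ⟨c, hc⟩ := mem_span_image_fs T θ _ h2
      refine ⟨fun f => if h : f ∈ E then (c ⟨f, h⟩ : MP V K) else 0, fun f => ?_, ?_⟩
      · by_cases h : f ∈ E
        · simp only [dif_pos h]; exact (c _).2
        · simp only [dif_neg h]; exact R.zero_mem
      · rw [Ideal.mem_bot, sub_eq_zero, Finset.sum_image (fun x _ y _ h => Subtype.ext h)]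
        have := congrArg Subtype.val hc
        rw [AddSubmonoidClass.coe_finset_sum] at this
        refine this.symm.trans (sum_congr rfl fun j hj => ?_)
        simp only [dif_pos j.2]
        exact congrArg (fun z => (c j : MP V K) * z) (hθ j hj))
  refine Subalgebra.fg_of_fg_map R (Ideal.Quotient.mkₐ K ⊥) ?_ key
  exact (RingHom.injective_iff_ker_eq_bot (Ideal.Quotient.mkₐ K (⊥ : Ideal (MP V K))).toRingHom).2 (Ideal.mk_ker)

section both
variable {K : Type} [Field K] {Q0 Q1 : Type} {ta ha : Q1 → Q0} {α : Q0 → ℕ}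
  [Fintype Q0] [DecidableEq Q0]

theorem SL_hc [Infinite K] (r : SK) (hr : r ∈ QS) (d : ℕ) :
    homogeneousComponent d r ∈ QS := by
  rw [mem_SL] at hr ⊢
  intro g hg
  rw [← act_hc, hr g hg]

theorem GL_hc [Infinite K] (r : SK) (hr : r ∈ QI) (d : ℕ) :
    homogeneousComponent d r ∈ QI := by
  have h1 := SL_hc r (GL_le_SL hr) d
  have h2 : PP (homogeneousComponent d r) = homogeneousComponent d r := by
    ext1 m
    rw [coeff_PP, coeff_homogeneousComponent]
    by_cases h0 : coeff m r = 0
    · rw [h0, ite_self, ite_self]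
    · rw [if_pos (wt_GL hr h0)]
  rw [← h2]; exact PP_mem h1

theorem GL_contr [Infinite K] {ι : Type} (J : Finset ι) (θ : ι → QI)
    (r : QI) (s : ι → SK)
    (hs : ∀ j, s j ∈ QS)
    (h : (r : SK) = ∑ j ∈ J, (θ j : SK) * s j) :
    r ∈ Ideal.span (θ '' (J : Set ι)) := by
  have e : r = ∑ j ∈ J, (⟨_, PP_mem (hs j)⟩ : QI) * θ j := by
    apply Subtype.ext
    rw [AddSubmonoidClass.coe_finset_sum, ← PP_GL r.2, h]
    have : PP (∑ j ∈ J, (θ j : SK) * s j) = ∑ j ∈ J, PP ((θ j : SK) * s j) :=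
      map_sum (weightedHomogeneousComponent (wtv : VQ → Q0 → ℤ) 0) _ _
    rw [this]
    refine sum_congr rfl fun j _ => ?_
    rw [PP_lin (θ j).2, mul_comm]; rfl
  rw [e]
  exact Ideal.sum_mem _ fun j hj => Ideal.mul_mem_left _ _ (Ideal.subset_span ⟨j, hj, rfl⟩)

theorem SL_contr {ι : Type} (J : Finset ι) (θ : ι → QS)
    (r : QS) (s : ι → SK)
    (hs : ∀ j, s j ∈ QS)
    (h : (r : SK) = ∑ j ∈ J, (θ j : SK) * s j) :
    r ∈ Ideal.span (θ '' (J : Set ι)) := by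
  have e : r = ∑ j ∈ J, (⟨_, hs j⟩ : QS) * θ j := by
    apply Subtype.ext
    rw [AddSubmonoidClass.coe_finset_sum, h]
    refine sum_congr rfl fun j _ => ?_
    rw [mul_comm]; rfl
  rw [e]
  exact Ideal.sum_mem _ fun j hj => Ideal.mul_mem_left _ _ (Ideal.subset_span ⟨j, hj, rfl⟩)

theorem SL_fg_char0 [CharZero K] [Finite Q1] : (QS).FG := by
  haveI : IsNoetherianRing (⊤ : Subalgebra K SK) :=
    isNoetherianRing_of_ringEquiv _ (Subalgebra.topEquiv (R := K) (A := SK)).symm.toRingEquiv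
  exact fg_of_contr _ ⊤ le_top SL_hc fun J θ r s _ h => contr J θ r s h

theorem SL_fg [Infinite K] [Finite Q1] : (QS).FG := by
  obtain ⟨p, hp⟩ := CharP.exists K
  rcases CharP.char_is_prime_or_zero K p with h | h
  · haveI := Fact.mk h
    exact SL_fg_charp p
  · subst h
    haveI := CharP.charP_to_charZero K
    exact SL_fg_char0

theorem GL_fg [Infinite K] [Finite Q1] : (QI).FG := by
  haveI : Algebra.FiniteType K QS := (Subalgebra.fg_iff_finiteType _).1 SL_fg
  haveI : IsNoetherianRing QS := Algebra.FiniteType.isNoetherianRing K _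
  exact fg_of_contr _ _ GL_le_SL GL_hc fun J θ r s hs h => GL_contr J θ r s hs h

end both

theorem lemA {K : Type} [Field K] [IsAlgClosed K] {V : Type} [Fintype V] [DecidableEq V]
    (I : Ideal (MP V K)) (r : MP V K) (hr : r ∉ I) :
    ∃ (ℓ : MP V K →ₗ[K] K) (T : Finset K), (∀ x ∈ I, ℓ x = 0) ∧ ℓ r = 1 ∧
      ∀ β, ℓ (monomial β 1) ∈ Algebra.adjoin ℤ (T : Set K) := by
  classical
  let J : Ideal (MP V K) := Submodule.comap (LinearMap.toSpanSingleton (MP V K) _ r) I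
  have hJ : ∀ x, x ∈ J ↔ x * r ∈ I := fun x => Iff.rfl
  have hJt : J ≠ ⊤ := by
    intro h
    have : (1 : MP V K) ∈ J := by rw [h]; trivial
    rw [hJ, one_mul] at this
    exact hr this
  obtain ⟨m, hm, hJm⟩ := Ideal.exists_le_maximal J hJt
  obtain ⟨a, ha⟩ := (isMaximal_iff_eq_vanishingIdeal_singleton (K := K)).1 hm
  have hX : ∀ v, X v - C (a v) ∈ m := by
    intro v; rw [ha, mem_vanishingIdeal_iff]; intro x hx; 
    rw [Set.mem_singleton_iff.1 hx]; simp
  have hk : ∃ k, r ∉ I ⊔ m ^ k := by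
    by_contra hcon
    push Not at hcon
    have h1 : (Submodule.Quotient.mk r : MP V K ⧸ I) ∈
        (⨅ i : ℕ, m ^ i • ⊤ : Submodule (MP V K) (MP V K ⧸ I)) := by
      rw [Submodule.mem_iInf]
      intro k
      obtain ⟨y, hy, z, hz, hyz⟩ := Submodule.mem_sup.1 (hcon k)
      have : (Submodule.Quotient.mk r : MP V K ⧸ I) =
          z • (Submodule.Quotient.mk 1 : MP V K ⧸ I) := by
        rw [← Submodule.Quotient.mk_smul, smul_eq_mul, mul_one, Submodule.Quotient.eq, ← hyz,
          add_sub_cancel_right]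
        exact hy
      rw [this]
      exact Submodule.smul_mem_smul hz trivial
    rw [Ideal.mem_iInf_smul_pow_eq_bot_iff] at h1
    obtain ⟨⟨x, hx⟩, hxr⟩ := h1
    have h2 : x * r - r ∈ I := by
      rw [← Submodule.Quotient.eq]
      exact hxr
    have h3 : 1 - x ∈ J := by
      rw [hJ]
      have := neg_mem h2
      convert this using 1; ring
    have h4 : (1 : MP V K) ∈ m := by
      have := add_mem (hJm h3) hx
      rwa [sub_add_cancel] at this
    exact hm.ne_top ((Ideal.eq_top_iff_one _).2 h4)
  obtain ⟨k, hk⟩ := hk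
  obtain ⟨ℓ0, h0, hle⟩ := Submodule.exists_le_ker_of_notMem
    (p := (I ⊔ m ^ k).restrictScalars K) (v := r) hk
  obtain ⟨ℓ, hℓ1, hℓr⟩ : ∃ ℓ : MP V K →ₗ[K] K, (∀ x ∈ I ⊔ m ^ k, ℓ x = 0) ∧ ℓ r = 1 := by
    refine ⟨(ℓ0 r)⁻¹ • ℓ0, fun x hx => ?_, ?_⟩
    · have : ℓ0 x = 0 := hle hx
      simp [this]
    · simp [h0]
  let μ : (V → ℕ) → MP V K := fun γ => ∏ v, (X v - C (a v)) ^ γ v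
  have hμ0 : μ 0 = 1 := by simp [μ]
  have hμ1 : ∀ γ v, μ (γ + Pi.single v 1) = μ γ * (X v - C (a v)) := by
    intro γ v
    simp only [μ, Pi.add_apply, pow_add, prod_mul_distrib]
    congr 1
    rw [prod_eq_single v]
    · simp
    · intro b _ hb; simp [Pi.single_eq_of_ne hb]
    · simp
  have hμk : ∀ γ v, k ≤ γ v → μ γ ∈ m ^ k := by
    intro γ v h
    have h1 : (X v - C (a v)) ^ γ v ∈ m ^ k :=
      Ideal.pow_le_pow_right h (Ideal.pow_mem_pow (hX v) _)
    exact Ideal.mem_of_dvd _ (Finset.dvd_prod_of_mem _ (mem_univ v)) h1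
  let T : Finset K := univ.image a ∪
    univ.image (fun γ : V → Fin k => ℓ (μ fun v => γ v))
  have hTμ : ∀ γ, ℓ (μ γ) ∈ Algebra.adjoin ℤ (T : Set K) := by
    intro γ
    by_cases h : ∃ v, k ≤ γ v
    · obtain ⟨v, h⟩ := h
      rw [hℓ1 _ ((le_sup_right : m ^ k ≤ I ⊔ m ^ k) (hμk γ v h))]
      exact zero_mem _
    · push Not at h
      refine Algebra.subset_adjoin ?_
      exact Finset.mem_union_right _ (mem_image.2 ⟨fun v => ⟨γ v, h v⟩, mem_univ _, rfl⟩)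
  have hTa : ∀ v, a v ∈ Algebra.adjoin ℤ (T : Set K) := fun v => Algebra.subset_adjoin
    (Finset.mem_union_left _ (Finset.mem_image_of_mem _ (mem_univ _)))
  have key : ∀ f ∈ Submonoid.closure (Set.range (X : V → MP V K)),
      ∀ γ, ℓ (μ γ * f) ∈ Algebra.adjoin ℤ (T : Set K) := by
    intro f hf
    induction hf using Submonoid.closure_induction_right with
    | one => intro γ; rw [mul_one]; exact hTμ γ
    | mul_right x hx y hy ih =>
      obtain ⟨v, rfl⟩ := hy
      intro γ
      have : μ γ * (x * X v) = μ (γ + Pi.single v 1) * x + a v • (μ γ * x) := by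
        rw [hμ1, smul_eq_C_mul]; ring
      rw [this, map_add, _root_.map_smul, smul_eq_mul]
      exact add_mem (ih _) (mul_mem (hTa v) (ih _))
  refine ⟨ℓ, T, fun x hx => hℓ1 x ((le_sup_left : I ≤ I ⊔ m ^ k) hx), hℓr, fun β => ?_⟩
  have hβ : (monomial β 1 : MP V K) ∈ Submonoid.closure (Set.range (X : V → MP V K)) := by
    rw [monomial_eq, C_1, one_mul]
    exact Submonoid.prod_mem _ fun v _ => Submonoid.pow_mem _ (Submonoid.subset_closure (Set.mem_range_self v)) _
  have := key _ hβ 0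
  rwa [hμ0, one_mul] at this

theorem lemB {D κ : Type} [CommRing D] [Field κ] (p : ℕ) [Fact p.Prime] [CharP κ p]
    [PerfectRing κ p] (φ : D →+* κ) {V ι : Type} [Fintype V] [DecidableEq V]
    (c r : MP V D) (J : Finset ι) (θ : ι → MP V D)
    (h : ∀ n : ℕ, ∃ (b : ι → MP V D) (y : MP V D),
      c * r ^ p ^ n = ∑ j ∈ J, b j * θ j ^ p ^ n + (p : MP V D) * y)
    (hc : map φ c ≠ 0) :
    map φ r ∈ Ideal.span ((fun j => map φ (θ j)) '' (J : Set ι)) := by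
  obtain ⟨e, s, u, hu, htr⟩ := trq_unit p (map φ c) hc
  obtain ⟨b, y, hb⟩ := h e
  have h1 := congrArg (map φ) hb
  have hp : (p : MP V κ) = 0 := by
    rw [← C_eq_coe_nat, CharP.cast_eq_zero, C_0]
  rw [map_mul, map_pow, map_add, map_mul, map_natCast, hp, zero_mul, add_zero, map_sum] at h1
  have h2 : trq p e ((map φ r) ^ p ^ e * (map φ c * s)) =
      ∑ j ∈ J, trq p e ((map φ (θ j)) ^ p ^ e * (map φ (b j) * s)) := by
    rw [← trq_sum]
    refine congrArg (trq p e) ?_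
    calc (map φ r) ^ p ^ e * (map φ c * s) = map φ c * (map φ r) ^ p ^ e * s := by ring
      _ = _ := by
        rw [h1, Finset.sum_mul]
        refine sum_congr rfl fun j _ => ?_
        rw [map_mul, map_pow]; ring
  rw [trq_pow_mul, htr] at h2
  have h3 : map φ r = C u⁻¹ * (map φ r * C u) := by
    rw [mul_comm (map φ r), ← mul_assoc, ← C_mul, inv_mul_cancel₀ hu, C_1, one_mul]
  rw [h3, h2]
  refine Ideal.mul_mem_left _ _ (Ideal.sum_mem _ fun j hj => ?_)
  rw [trq_pow_mul]
  exact Ideal.mul_mem_right _ _ (Ideal.subset_span ⟨j, hj, rfl⟩)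

theorem lemC {D κ : Type} [CommRing D] [Field κ] (φ : D →+* κ) {V ι : Type}
    (ℓ : MP V D →ₗ[D] D) (r : MP V D) (J : Finset ι)
    (θ : ι → MP V D) (h : ∀ j f, ℓ (f * θ j) = 0) (hr : ℓ r = 1) :
    map φ r ∉ Ideal.span ((fun j => map φ (θ j)) '' (J : Set ι)) := by
  classical
  let L : MP V κ →ₗ[κ] κ :=
    (basisMonomials V κ).constr κ (fun β => φ (ℓ (monomial β 1)))
  have hL1 : ∀ β (x : κ), L (monomial β x) = x * φ (ℓ (monomial β 1)) := by
    intro β x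
    have h1 : L (monomial β 1) = φ (ℓ (monomial β 1)) :=
      (basisMonomials V κ).constr_basis κ (fun β => φ (ℓ (monomial β 1))) β
    have h2 : (monomial β x : MP V κ) = x • monomial β 1 := by
      rw [smul_monomial, smul_eq_mul, mul_one]
    rw [h2, _root_.map_smul, h1, smul_eq_mul]
  have hL : ∀ f, L (map φ f) = φ (ℓ f) := by
    intro f
    induction f using MvPolynomial.induction_on' with
    | monomial β x =>
      rw [map_monomial, hL1]
      have : monomial β x = x • (monomial β 1 : MP V D) := by
        rw [smul_monomial, smul_eq_mul, mul_one]
      rw [this, _root_.map_smul, smul_eq_mul, map_mul]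
    | add f g hf hg => rw [map_add, map_add, hf, hg, map_add, map_add]
  have hL0 : ∀ j g, L (g * map φ (θ j)) = 0 := by
    intro j g
    induction g using MvPolynomial.induction_on' with
    | monomial β x =>
      have : (monomial β x : MP V κ) = x • map φ (monomial β 1) := by
        rw [map_monomial, map_one, smul_monomial, smul_eq_mul, mul_one]
      rw [this, smul_mul_assoc, ← map_mul, _root_.map_smul, hL, h, map_zero, smul_zero]
    | add f g hf hg => rw [add_mul, map_add, hf, hg, add_zero]
  intro hmem
  obtain ⟨b, hb⟩ := mem_span_image_fs J _ _ hmem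
  have := congrArg L hb
  rw [map_sum, hL, hr, map_one, sum_eq_zero (fun j _ => hL0 j (b j))] at this
  exact zero_ne_one this

theorem jacZ : IsJacobsonRing ℤ := by
  rw [isJacobsonRing_iff_prime_eq]
  intro P hP
  by_cases h : P = ⊥
  · subst h
    rw [eq_bot_iff]
    intro x hx
    have h1 := Ideal.mem_jacobson_bot.1 hx x
    rw [Int.isUnit_iff] at h1
    rw [Ideal.mem_bot]
    rcases h1 with h1 | h1 <;> nlinarith
  · haveI := IsPrime.to_maximal_ideal h
    exact Ideal.jacobson_eq_self_of_isMaximal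

theorem lemF (D : Type) [CommRing D] [Nontrivial D] (hD : Algebra.FiniteType ℤ D) :
    ∃ (κ : Type) (_ : Field κ) (_ : D →+* κ) (p : ℕ) (_ : Fact p.Prime) (_ : CharP κ p),
      PerfectRing κ p := by
  obtain ⟨P, hP⟩ := Ideal.exists_maximal D
  letI : Field (D ⧸ P) := Ideal.Quotient.field P
  haveI h1 : Algebra.FiniteType ℤ (D ⧸ P) := by
    refine Algebra.FiniteType.of_surjective (f := (Ideal.Quotient.mk P).toIntAlgHom) ?_
    exact Ideal.Quotient.mk_surjective
  haveI := jacZ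
  haveI h2 : Module.Finite ℤ (D ⧸ P) := finite_of_finite_type_of_isJacobsonRing ℤ (D ⧸ P)
  obtain ⟨p, hp⟩ := CharP.exists (D ⧸ P)
  rcases CharP.char_is_prime_or_zero (D ⧸ P) p with hpp | rfl
  · haveI : Fact p.Prime := ⟨hpp⟩
    letI := ZMod.algebra (D ⧸ P) p
    haveI : Module.Finite (ZMod p) (D ⧸ P) := Module.Finite.of_restrictScalars_finite ℤ _ _
    haveI : Finite (D ⧸ P) := Module.finite_of_finite (ZMod p)
    exact ⟨D ⧸ P, inferInstance, Ideal.Quotient.mk P, p, inferInstance, hp, inferInstance⟩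
  · exfalso
    haveI : CharZero (D ⧸ P) := CharP.charP_to_charZero _
    haveI : Algebra.IsIntegral ℤ (D ⧸ P) := Algebra.IsIntegral.of_finite ℤ _
    have : IsField ℤ := isField_of_isIntegral_of_isField (R := ℤ) (S := D ⧸ P)
      (by intro a b h; simpa using h) (Field.toIsField _)
    exact Int.not_isField this

theorem lift_poly {K : Type} [Field K] (D : Subalgebra ℤ K) {σ : Type} (f : MP σ K)
    (h : ∀ x ∈ f.coeffs, x ∈ D) : ∃ f' : MP σ D, map (algebraMap D K) f' = f := by
  have := (mem_range_map_iff_coeffs_subset (f := algebraMap D K) (x := f)).2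
    (fun x hx => ⟨⟨x, h x hx⟩, rfl⟩)
  exact this

theorem tclS {D R : Type} [CommRing D] [CommRing R] {s m : ℕ}
    (G : MP (Fin s) D →+* R) (RD : Subring R) (hG : ∀ a, G a ∈ RD)
    (S : Finset (Fin m)) (v : Fin m → R) (hvN : ∀ l, v l ∈ RD)
    (hli : ∀ a : S → MP (Fin s) D, ∑ l : S, G (a l) * v l = 0 → ∀ l, a l = 0)
    (c : MP (Fin s) D)
    (hce : ∀ x ∈ RD, ∃ a : S → MP (Fin s) D, G c * x = ∑ l : S, G (a l) * v l)
    {p : ℕ} (hp : p.Prime) (J : Finset (Fin s)) (i : Fin s) (hi : i ∉ J) (r : R) (hr : r ∈ RD)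
    (b : Fin s → R) (hbN : ∀ j, b j ∈ RD) (hb : ∑ j ∈ J, b j * G (X j) = r * G (X i)) (n : ℕ) :
    ∃ (b' : Fin s → R) (y : R), (∀ j, b' j ∈ RD) ∧ y ∈ RD ∧
      G c * r ^ p ^ n = ∑ j ∈ J, b' j * G (X j) ^ p ^ n + (p : R) * y := by
  letI alg : Algebra (MP (Fin s) D) RD := (G.codRestrict RD hG).toAlgebra
  let e : S → RD := fun l => ⟨v l, hvN l⟩
  have hsm : ∀ (a : MP (Fin s) D) (x : RD), RD.subtype (a • x) = G a * x :=
    fun a x => rfl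
  have hal : ∀ a : MP (Fin s) D, RD.subtype (algebraMap (MP (Fin s) D) RD a) = G a :=
    fun a => rfl
  have he : LinearIndependent (MP (Fin s) D) e := by
    rw [Fintype.linearIndependent_iff]
    intro a ha l
    have h1 : ∑ l : S, G (a l) * v l = 0 := by
      have := congrArg (RD.subtype) ha
      rw [map_sum, map_zero] at this
      exact this
    exact hli a h1 l
  have hce : ∀ x : RD, c • x ∈ Submodule.span (MP (Fin s) D) (Set.range e) := by
    rintro ⟨x, hx⟩
    obtain ⟨a, ha⟩ := hce x hx
    have : c • (⟨x, hx⟩ : RD) = ∑ l : S, a l • e l := by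
      apply RD.subtype_injective
      rw [map_sum]
      exact ha
    rw [this]
    exact (Submodule.sum_mem _ fun l _ =>
      Submodule.smul_mem _ _ (Submodule.subset_span ⟨l, rfl⟩))
  have hmem : (⟨r, hr⟩ : RD) * algebraMap (MP (Fin s) D) RD (X i) ∈
      Ideal.span ((fun j => algebraMap (MP (Fin s) D) RD (X j)) '' (J : Set (Fin s))) := by
    have : (⟨r, hr⟩ : RD) * algebraMap (MP (Fin s) D) RD (X i) =
        ∑ j ∈ J, ⟨b j, hbN j⟩ * algebraMap (MP (Fin s) D) RD (X j) := by
      apply RD.subtype_injective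
      rw [map_sum]
      exact hb.symm
    rw [this]
    exact Ideal.sum_mem _ fun j hj => Ideal.mul_mem_left _ _ (Ideal.subset_span ⟨j, hj, rfl⟩)
  have fin := tcl e he c hce hp J i hi ⟨r, hr⟩ hmem n
  obtain ⟨x, hx, y, hy, hxy⟩ := Submodule.mem_sup.1 fin
  obtain ⟨b', hb'⟩ := mem_span_image_fs J _ _ hx
  obtain ⟨y', hy'⟩ := Ideal.mem_span_singleton'.1 hy
  refine ⟨fun j => b' j, y', fun j => (b' j).2, y'.2, ?_⟩
  have h3 := congrArg RD.subtype hxy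
  rw [← hb', ← hy', map_add, map_sum, map_mul RD.subtype y', map_natCast, mul_comm (RD.subtype y')] at h3
  exact h3.symm

theorem exRD {A R : Type} [CommRing A] [CommRing R] {m : ℕ} (G : A →+* R) (v : Fin m → R)
    (h2 : ∀ k l, ∃ a : Fin m → A, v k * v l = ∑ q, G (a q) * v q)
    (h1 : ∃ a : Fin m → A, 1 = ∑ q, G (a q) * v q) (P : R → Prop)
    (hP : ∀ x, P x → ∃ a : Fin m → A, x = ∑ q, G (a q) * v q) :
    ∃ RD : Subring R, (∀ a, G a ∈ RD) ∧ (∀ x, P x → x ∈ RD) ∧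
      (∀ l, v l ∈ RD) ∧ (∀ x ∈ RD, ∃ a : Fin m → A, x = ∑ l, G (a l) * v l) := by
  letI := G.toAlgebra
  let N : Submodule A R := Submodule.span A (Set.range v)
  have hN : ∀ x, x ∈ N ↔ ∃ a : Fin m → A, x = ∑ l, G (a l) * v l := by
    intro x
    refine (Submodule.mem_span_range_iff_exists_fun _).trans ?_
    exact exists_congr fun a => eq_comm
  have hmul : ∀ x y, x ∈ N → y ∈ N → x * y ∈ N := by
    intro x y hx hy
    obtain ⟨a, rfl⟩ := (hN x).1 hx
    obtain ⟨a', rfl⟩ := (hN y).1 hy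
    rw [Finset.sum_mul_sum]
    refine Submodule.sum_mem _ fun k _ => Submodule.sum_mem _ fun l _ => ?_
    have : G (a k) * v k * (G (a' l) * v l) = (a k * a' l) • (v k * v l) := by
      change _ = G (a k * a' l) * _
      rw [map_mul]; ring
    rw [this]
    exact Submodule.smul_mem _ _ ((hN _).2 (h2 k l))
  refine ⟨{ carrier := N, mul_mem' := fun {x y} => hmul x y, one_mem' := (hN 1).2 h1,
            add_mem' := N.add_mem, zero_mem' := N.zero_mem, neg_mem' := N.neg_mem },
    fun a => ?_, fun x hx => (hN x).2 (hP x hx), fun l => Submodule.subset_span ⟨l, rfl⟩,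
    fun x hx => (hN x).1 hx⟩
  have : G a = a • (1 : R) := (mul_one _).symm
  rw [this]
  exact N.smul_mem a ((hN 1).2 h1)

theorem tclD {K : Type} [Field K] {s m : ℕ} {R : Type} [CommRing R]
    (g : MP (Fin s) K →+* R) (v : Fin m → R)
    (hv : ∀ x : R, ∃ a : Fin m → MP (Fin s) K, x = ∑ l, g (a l) * v l)
    (J : Finset (Fin s)) (i : Fin s) (hi : i ∉ J) (r : R)
    (h : r * g (X i) ∈ Ideal.span ((fun j => g (X j)) '' (J : Set (Fin s)))) :
    ∃ (T : Finset K) (c : MP (Fin s) K), c ≠ 0 ∧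
      ∀ D : Subalgebra ℤ K, (∀ x ∈ T, x ∈ D) → ∀ p : ℕ, p.Prime → ∀ n : ℕ,
        ∃ (b : Fin s → Fin m → MP (Fin s) D) (y : Fin m → MP (Fin s) D),
          g c * r ^ p ^ n = ∑ j ∈ J, (∑ l, g (map (algebraMap D K) (b j l)) * v l) * g (X j) ^ p ^ n
            + (p : R) * ∑ l, g (map (algebraMap D K) (y l)) * v l := by
  classical
  choose co hco using hv
  obtain ⟨b, hb⟩ := mem_span_image_fs J _ _ h
  have hfree : ∃ (S : Finset (Fin m)) (c : MP (Fin s) K)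
      (d : Fin m → Fin m → MP (Fin s) K), c ≠ 0 ∧
      (∀ a : S → MP (Fin s) K, ∑ l : S, g (a l) * v l = 0 → ∀ l, a l = 0) ∧
      ∀ k, g c * v k = ∑ l : S, g (d k l) * v l := by
    letI := g.toAlgebra
    have hsp : Submodule.span (MP (Fin s) K) (Set.range v) = ⊤ := by
      rw [eq_top_iff]
      rintro x -
      rw [hco x]
      refine Submodule.sum_mem _ fun l _ => ?_
      exact Submodule.smul_mem _ (co x l) (Submodule.subset_span ⟨l, rfl⟩)
    obtain ⟨S, c, hc, hli, hsp⟩ := exists_free v hsp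
    have hd : ∀ k, ∃ d : S → MP (Fin s) K, g c * v k = ∑ l : S, g (d l) * v l := by
      intro k
      obtain ⟨d, hd⟩ := (Submodule.mem_span_range_iff_exists_fun _).1 (hsp k)
      exact ⟨d, hd.symm⟩
    choose d hd using hd
    refine ⟨S.toFinset, c, fun k l => if hl : l ∈ S then d k ⟨l, hl⟩ else 0, hc, ?_, ?_⟩
    · have := Fintype.linearIndependent_iff.1 hli
      intro a ha l
      have h2 := this (fun l => a ⟨l.1, Set.mem_toFinset.2 l.2⟩) (by
        rw [← ha]
        refine Fintype.sum_equiv (Equiv.subtypeEquivRight fun x => Set.mem_toFinset.symm) _ _ ?_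
        intro x; rfl) ⟨l.1, Set.mem_toFinset.1 l.2⟩
      exact h2
    · intro k
      rw [hd k]
      refine Fintype.sum_equiv (Equiv.subtypeEquivRight fun x => Set.mem_toFinset.symm) _ _ ?_
      intro x
      simp
  obtain ⟨S, c, d, hc, hli, hd⟩ := hfree
  let F : Finset (MP (Fin s) K) := {c} ∪
    (univ.image fun q : Fin m × Fin m => d q.1 q.2) ∪
    (univ.image fun q : (Fin m × Fin m) × Fin m => co (v q.1.1 * v q.1.2) q.2) ∪
    (univ.image fun q : Fin m => co 1 q) ∪
    (univ.image fun q : Fin m => co r q) ∪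
    (univ.image fun q : Fin s × Fin m => co (b q.1) q.2)
  refine ⟨F.biUnion fun f => f.coeffs, c, hc, fun D hD p hp n => ?_⟩
  have hF : ∀ f ∈ F, ∃ f' : MP (Fin s) D, map (algebraMap D K) f' = f := fun f hf =>
    lift_poly D f fun x hx => hD x (Finset.mem_biUnion.2 ⟨f, hf, hx⟩)
  obtain ⟨cD, hcD⟩ := hF c (by simp [F])
  have hdD : ∀ k l, ∃ f' : MP (Fin s) D, map (algebraMap D K) f' = d k l :=
    fun k l => hF _ (by simp [F])
  choose dD hdD using hdD
  let G : MP (Fin s) D →+* R := g.comp (map (algebraMap D K))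
  have hGd : ∀ a, G a = g (map (algebraMap D K) a) := fun a => rfl
  have hGX : ∀ j, G (X j) = g (X j) := fun j => by rw [hGd, map_X]
  have hinj : Function.Injective (map (σ := Fin s) (algebraMap D K)) :=
    map_injective _ Subtype.val_injective
  have hmain : ∃ RD : Subring R, (∀ a, G a ∈ RD) ∧ (∀ x, (∀ l, co x l ∈ F) → x ∈ RD) ∧
      (∀ l, v l ∈ RD) ∧ (∀ x ∈ RD, ∃ a : Fin m → MP (Fin s) D, x = ∑ l, G (a l) * v l) :=
    exRD G v (by
      intro k l
      have hq : ∀ q, ∃ f', map (algebraMap D K) f' = co (v k * v l) q := fun q => hF _ (by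
        simp only [F, mem_union, mem_image, mem_univ, true_and]
        exact Or.inl (Or.inl (Or.inl (Or.inr ⟨((k, l), q), rfl⟩))))
      choose f hf using hq
      exact ⟨f, (hco (v k * v l)).trans (sum_congr rfl fun q _ => by rw [hGd, hf])⟩)
      (by
      have hq : ∀ q, ∃ f', map (algebraMap D K) f' = co 1 q := fun q => hF _ (by simp [F])
      choose f hf using hq
      exact ⟨f, (hco 1).trans (sum_congr rfl fun q _ => by rw [hGd, hf])⟩)
      (fun x => ∀ l, co x l ∈ F) (by
      intro x hx
      have hq : ∀ q, ∃ f', map (algebraMap D K) f' = co x q := fun q => hF _ (hx q)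
      choose f hf using hq
      exact ⟨f, (hco x).trans (sum_congr rfl fun q _ => by rw [hGd, hf])⟩)
  obtain ⟨RD, hG, hRD, hvN, hex⟩ := hmain
  have hli' : ∀ a : S → MP (Fin s) D, ∑ l : S, G (a l) * v l = 0 → ∀ l, a l = 0 := by
    intro a ha l
    have h2 := hli (fun l => map (algebraMap D K) (a l)) ha l
    exact hinj (by rw [h2, map_zero])
  have hce : ∀ x ∈ RD, ∃ a : S → MP (Fin s) D, G cD * x = ∑ l : S, G (a l) * v l := by
    intro x hx
    obtain ⟨a, rfl⟩ := hex x hx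
    refine ⟨fun l => ∑ k, a k * dD k l, ?_⟩
    simp only [map_sum, map_mul, Finset.sum_mul]
    rw [Finset.sum_comm, Finset.mul_sum]
    refine sum_congr rfl fun k _ => ?_
    calc G cD * (G (a k) * v k) = G (a k) * (g c * v k) := by rw [hGd cD, hcD]; ring
      _ = _ := by
        rw [hd, Finset.mul_sum]
        refine sum_congr rfl fun l _ => ?_
        rw [hGd (dD k l), hdD, mul_assoc]
  obtain ⟨b', y, hb', hy, heq⟩ := tclS G RD hG S v hvN hli' cD hce hp J i hi r
    (hRD r fun l => by simp [F]) b
    (fun j => hRD (b j) fun l => by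
      simp only [F, mem_union, mem_image, mem_univ, true_and]
      exact Or.inr ⟨(j, l), rfl⟩) (by simp only [hGX]; exact hb) n
  choose B hB using fun j => hex _ (hb' j)
  obtain ⟨Y, hY⟩ := hex _ hy
  refine ⟨B, Y, ?_⟩
  simp only [hGX] at heq
  rw [hGd cD, hcD] at heq
  rw [heq, hY]
  refine congrArg₂ _ (sum_congr rfl fun j _ => ?_) rfl
  rw [hB j]; rfl

theorem P4 {K : Type} [Field K] [IsAlgClosed K] {V : Type} [Fintype V] [DecidableEq V]
    (R' : Subalgebra K (MP V K)) {s : ℕ} (g : MP (Fin s) K →ₐ[K] R')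
    (hg : Function.Injective g) (hfin : g.Finite) (J : Finset (Fin s)) (i : Fin s) (hi : i ∉ J)
    (r : R') (h : r * g (X i) ∈ Ideal.span ((fun j => g (X j)) '' (J : Set (Fin s)))) :
    (r : MP V K) ∈
      Ideal.span ((fun j => (g (X j) : MP V K)) '' (J : Set (Fin s))) := by
  classical
  by_contra hcon
  obtain ⟨ℓ, T1, hℓ0, hℓr, hℓT⟩ := lemA _ _ hcon
  obtain ⟨m, v, hv⟩ := fin_hom g.toRingHom hfin
  obtain ⟨T2, c, hc, htc⟩ := tclD g.toRingHom v hv J i hi r h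
  have hgc : ((g c : R') : MP V K) ≠ 0 := by
    intro h0
    apply hc
    apply hg
    rw [map_zero]
    exact Subtype.ext h0
  obtain ⟨μ, hμ⟩ := ne_zero_iff.1 hgc
  let T : Finset K := T1 ∪ T2 ∪ {(coeff μ ((g c : R') : MP V K))⁻¹} ∪
    ((g c : R') : MP V K).coeffs ∪ (r : MP V K).coeffs ∪
    (univ.biUnion fun l => ((v l : R') : MP V K).coeffs) ∪
    (univ.biUnion fun j => ((g (X j) : R') : MP V K).coeffs)
  obtain ⟨D, hDT, hD1, hDft⟩ : ∃ D : Subalgebra ℤ K, (∀ x ∈ T, x ∈ D) ∧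
      (∀ x ∈ Algebra.adjoin ℤ (T1 : Set K), x ∈ D) ∧ Algebra.FiniteType ℤ D := by
    refine ⟨Algebra.adjoin ℤ (T : Set K), fun x hx => Algebra.subset_adjoin hx, ?_, ?_⟩
    · refine Algebra.adjoin_mono ?_
      intro x hx
      have : x ∈ T1 := hx
      simp [T, this]
    · exact (Subalgebra.fg_iff_finiteType _).1 (Subalgebra.fg_adjoin_finset T)
  obtain ⟨κ, _, φ, p, _, _, _⟩ := lemF D hDft
  obtain ⟨cS, hcS⟩ := lift_poly D ((g c : R') : MP V K)
    (fun x hx => hDT x (by simp only [T, mem_union]; tauto))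
  obtain ⟨rS, hrS⟩ := lift_poly D (r : MP V K)
    (fun x hx => hDT x (by simp only [T, mem_union]; tauto))
  have hvS : ∀ l, ∃ f', map (algebraMap D K) f' = ((v l : R') : MP V K) := fun l =>
    lift_poly D _ (fun x hx => hDT x (by
      have : x ∈ (univ.biUnion fun l => ((v l : R') : MP V K).coeffs) :=
        Finset.mem_biUnion.2 ⟨l, mem_univ _, hx⟩
      simp only [T, mem_union]; tauto))
  have hθS : ∀ l, ∃ f', map (algebraMap D K) f' = ((g (X l) : R') : MP V K) := fun l =>
    lift_poly D _ (fun x hx => hDT x (by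
      have : x ∈ (univ.biUnion fun j => ((g (X j) : R') : MP V K).coeffs) :=
        Finset.mem_biUnion.2 ⟨l, mem_univ _, hx⟩
      simp only [T, mem_union]; tauto))
  choose vS hvS using hvS
  choose θS hθS using hθS
  have hgS : ∀ a : MP (Fin s) D, ∃ f' : MP V D,
      map (algebraMap D K) f' = ((g (map (algebraMap D K) a) : R') : MP V K) := by
    intro a
    induction a using MvPolynomial.induction_on with
    | C x =>
      refine ⟨C x, ?_⟩
      rw [map_C, map_C]
      have : g (C (algebraMap D K x)) = algebraMap K R' (algebraMap D K x) := g.commutes _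
      rw [this]; rfl
    | add a b ha hb =>
      obtain ⟨f, hf⟩ := ha
      obtain ⟨f', hf'⟩ := hb
      exact ⟨f + f', by rw [map_add, hf, hf', map_add, map_add]; rfl⟩
    | mul_X a j ha =>
      obtain ⟨f, hf⟩ := ha
      exact ⟨f * θS j, by rw [map_mul, hf, hθS, map_mul, map_mul, map_X]; rfl⟩
  have hRS : ∀ a : Fin m → MP (Fin s) D, ∃ f' : MP V D,
      map (algebraMap D K) f' =
        ((∑ l, g.toRingHom (map (algebraMap D K) (a l)) * v l : R') : MP V K) := by
    intro a
    choose f hf using fun l => hgS (a l)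
    refine ⟨∑ l, f l * vS l, ?_⟩
    rw [map_sum, AddSubmonoidClass.coe_finset_sum]
    refine sum_congr rfl fun l _ => ?_
    rw [map_mul, hf, hvS]; rfl
  have hinj : Function.Injective (map (σ := V) (algebraMap D K)) :=
    map_injective _ Subtype.val_injective
  have hB : map φ rS ∈ Ideal.span ((fun j => map φ (θS j)) '' (J : Set (Fin s))) := by
    refine lemB p φ cS rS J θS ?_ ?_
    · intro n
      obtain ⟨b, y, hby⟩ := htc D (fun x hx => hDT x (by simp only [T, mem_union]; tauto))
        p Fact.out n
      choose B hB using fun j => hRS (b j)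
      obtain ⟨Y, hY⟩ := hRS y
      refine ⟨B, Y, hinj ?_⟩
      rw [map_mul, map_pow, hcS, hrS, map_add, map_mul, map_natCast, hY, map_sum]
      have h1 := congrArg R'.val hby
      rw [map_mul, map_pow, map_add, map_mul, map_natCast, map_sum] at h1
      refine Eq.trans h1 (congrArg₂ _ (sum_congr rfl fun j _ => ?_) rfl)
      rw [map_mul, map_pow, map_mul, map_pow, hB, hθS]; rfl
    · intro h0
      have h1 : φ (coeff μ cS) = 0 := by rw [← coeff_map, h0, coeff_zero]
      have h2 : (coeff μ cS : D) * ⟨(coeff μ ((g c : R') : MP V K))⁻¹,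
          hDT _ (by simp [T])⟩ = 1 := by
        apply Subtype.ext
        change algebraMap D K (coeff μ cS) * _ = 1
        rw [← coeff_map, hcS]
        exact mul_inv_cancel₀ hμ
      have h3 := congrArg φ h2
      rw [map_mul, h1, zero_mul, map_one] at h3
      exact zero_ne_one h3
  let ℓD : MP V D →ₗ[D] D := (basisMonomials V D).constr D
    (fun β => (⟨ℓ (monomial β 1), hD1 _ (hℓT β)⟩ : D))
  have hℓD : ∀ f, algebraMap D K (ℓD f) = ℓ (map (algebraMap D K) f) := by
    intro f
    induction f using MvPolynomial.induction_on' with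
    | monomial β x =>
      have h1 : ℓD (monomial β 1) = ⟨ℓ (monomial β 1), hD1 _ (hℓT β)⟩ :=
        (basisMonomials V D).constr_basis D _ β
      have h2 : (monomial β x : MP V D) = x • monomial β 1 := by
        rw [smul_monomial, smul_eq_mul, mul_one]
      have h3 : (map (algebraMap D K) (monomial β x)) =
          (algebraMap D K x) • (monomial β 1 : MP V K) := by
        rw [map_monomial, smul_monomial, smul_eq_mul, mul_one]
      rw [h3, _root_.map_smul, h2, _root_.map_smul, h1, smul_eq_mul, map_mul]; rfl
    | add f g hf hg => rw [map_add, map_add, hf, hg, map_add, map_add]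
  refine lemC φ ℓD rS J (fun j => if j ∈ J then θS j else 0) ?_ ?_ ?_
  · intro j f
    by_cases hj : j ∈ J
    · rw [if_pos hj]
      apply Subtype.val_injective (p := fun x => x ∈ D)
      change algebraMap D K (ℓD (f * θS j)) = 0
      rw [hℓD, map_mul, hθS]
      exact hℓ0 _ (Ideal.mul_mem_left _ _ (Ideal.subset_span ⟨j, hj, rfl⟩))
    · rw [if_neg hj, mul_zero, map_zero]
  · apply Subtype.val_injective (p := fun x => x ∈ D)
    change algebraMap D K (ℓD rS) = 1
    rw [hℓD, hrS, hℓr]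
  · refine Ideal.span_mono ?_ hB
    rintro _ ⟨j, hj, rfl⟩
    have : j ∈ J := hj
    exact ⟨j, hj, by simp [this]⟩

theorem mainCM {K : Type} [Field K] [IsAlgClosed K] {Q0 Q1 : Type} [Fintype Q0] [Fintype Q1]
    [DecidableEq Q0] [DecidableEq Q1] (ta ha : Q1 → Q0) (α : Q0 → ℕ)
    (R' : Subalgebra K SK) (hle : R' ≤ QS)
    (hfg : R'.FG)
    (hP : ∀ (s : ℕ) (J : Finset (Fin s)) (θ : Fin s → R') (r : R')
      (t : Fin s → SK),
      (∀ j, t j ∈ QS) →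
      (r : SK) = ∑ j ∈ J, (θ j : SK) * t j →
      r ∈ Ideal.span (θ '' (J : Set (Fin s)))) :
    IsCohenMacaulayRing R' := by
  classical
  haveI : Infinite K := IsAlgClosed.instInfinite
  haveI : Algebra.FiniteType K R' := (Subalgebra.fg_iff_finiteType _).1 hfg
  refine cmCriterion K R' fun s g hg hfin i r hr => ?_
  let J : Finset (Fin s) := univ.filter (· < i)
  have hJ : (J : Set (Fin s)) = {j | j < i} := by ext; simp [J]
  have hi : i ∉ J := by simp [J]
  rw [← hJ] at hr ⊢
  let incl : R' →+* QS := (Subalgebra.inclusion hle).toRingHom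
  have hinc : ∀ x : R', ((incl x : QS) : SK) = x :=
    fun x => rfl
  suffices hSL : incl r ∈ Ideal.span ((fun j => incl (g (X j))) '' (J : Set (Fin s))) by
    obtain ⟨b, hb⟩ := mem_span_image_fs J _ _ hSL
    refine hP s J (fun j => g (X j)) r (fun j => b j) (fun j => (b j).2) ?_
    have := congrArg (QS).val hb
    rw [map_sum] at this
    refine this.symm.trans (sum_congr rfl fun j _ => ?_)
    rw [map_mul, mul_comm]; rfl
  obtain ⟨p, hp⟩ := CharP.exists K
  rcases CharP.char_is_prime_or_zero K p with hpp | rfl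
  · haveI : Fact p.Prime := ⟨hpp⟩
    haveI : PerfectRing K p := PerfectField.toPerfectRing p
    have hfree : ∃ c : MP (Fin s) K, c ≠ 0 ∧ ∀ n, g c * r ^ p ^ n ∈
        Ideal.span ((fun j => g (X j) ^ p ^ n) '' (J : Set (Fin s))) := by
      letI := g.toRingHom.toAlgebra
      obtain ⟨m, v, hv⟩ := fin_hom g.toRingHom hfin
      have hsp : Submodule.span (MP (Fin s) K) (Set.range v) = ⊤ := by
        rw [eq_top_iff]
        rintro x -
        obtain ⟨a, rfl⟩ := hv x
        refine Submodule.sum_mem _ fun l _ => ?_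
        exact Submodule.smul_mem _ (a l) (Submodule.subset_span ⟨l, rfl⟩)
      obtain ⟨S, c, hc, hli, hcs⟩ := exists_free v hsp
      refine ⟨c, hc, fun n => ?_⟩
      have hce : ∀ x : R', c • x ∈ Submodule.span (MP (Fin s) K)
          (Set.range fun i : S => v i) := by
        intro x
        obtain ⟨a, rfl⟩ := hv x
        rw [Finset.smul_sum]
        refine Submodule.sum_mem _ fun l _ => ?_
        have : c • (g.toRingHom (a l) * v l) = a l • c • v l := smul_comm c (a l) (v l)
        rw [this]
        exact Submodule.smul_mem _ _ (hcs l)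
      have h1 := tcl (fun i : S => v i) hli c hce hpp J i hi r hr n
      have h2 : (p : R') = 0 := by
        rw [← map_natCast (algebraMap K R'), CharP.cast_eq_zero, map_zero]
      rw [h2, Ideal.span_singleton_zero, sup_bot_eq] at h1
      exact h1
    obtain ⟨c, hc, hcn⟩ := hfree
    refine TCbig p ta ha α (incl r) (incl (g c)) ?_ J (fun j => incl (g (X j))) fun n => ?_
    · intro h0
      apply hc
      apply hg
      rw [map_zero]
      exact Subtype.ext (congrArg (QS).val h0)
    · have := Ideal.mem_map_of_mem incl (hcn n)
      rw [map_mul, map_pow, Ideal.map_span, ← Set.image_comp] at this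
      have he : (incl ∘ fun j => g (X j) ^ p ^ n) = fun j => incl (g (X j)) ^ p ^ n := by
        funext j; exact map_pow incl _ _
      rw [he] at this
      exact this
  · haveI : CharZero K := CharP.charP_to_charZero K
    have h4 := P4 R' g hg hfin J i hi r hr
    obtain ⟨b, hb⟩ := mem_span_image_fs J _ _ h4
    refine contr J (fun j => incl (g (X j))) (incl r) b ?_
    rw [hinc, ← hb]
    exact sum_congr rfl fun j _ => mul_comm _ _

/-- The rings `SI(Q,α)` and `I(Q,α)` are Cohen-Macaulay in arbitrary
characteristic. -/
theorem stmt_13 (K : Type) [Field K] [IsAlgClosed K] {Q0 Q1 : Type} [Fintype Q0] [Fintype Q1]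
    (ta ha : Q1 → Q0) (α : Q0 → ℕ) :
    IsCohenMacaulayRing ↥(quiverSemiInvariants K ta ha α) ∧
      IsCohenMacaulayRing ↥(quiverInvariants K ta ha α) := by
  classical
  haveI : Infinite K := IsAlgClosed.instInfinite
  exact ⟨mainCM ta ha α _ le_rfl SL_fg fun s J θ r t ht h => SL_contr J θ r t ht h,
    mainCM ta ha α _ GL_le_SL GL_fg fun s J θ r t ht h => GL_contr J θ r t ht h⟩
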